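/- For all k ≥ 1, d ≥ 1 and β > 0 there exists ε₀ > 0 such that for every ε ∈ (0, ε₀) there exist t ∈ ℕ and constants c, C > 0 (depending on k, d, ε) with the following property: for every measurable A ⊆ ℝ^k with 0 < |A| < ∞ and |A+A| ≤ 2^{k+d}(2−ε)|A|, if every finite set X ⊆ ℝ^k with #X ≤ t, every (d−1)-GAP P ⊆ ℝ^k and every parallelotope Q ⊆ ℝ^k with A ⊆ X+P+Q satisfy |X+P+Q| ≥ c|A|, then there exist a set X' ⊆ ℝ^k with #X' ≤ (1+β)·(k+d+1)/(2ε), a d-GAP P' ⊆ ℝ^k and a parallelotope Q' ⊆ ℝ^k such that A ⊆ X'+P'+Q' and |X'+P'+Q'| ≤ C|A|. -/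

import Mathlib

open Set Pointwise MeasureTheory ENNReal

/-- `P ⊆ ℝ^k` is a `d`-dimensional generalized arithmetic progression:
`P = {∑ i, λ i • a i : 1 ≤ λ i ≤ ℓ i}`. -/
def IsGAPR (k d : ℕ) (P : Set (Fin k → ℝ)) : Prop :=
  ∃ (a : Fin d → (Fin k → ℝ)) (l : Fin d → ℕ), (∀ i, 1 ≤ l i) ∧
    P = (fun lam : Fin d → ℕ => ∑ i, (lam i : ℝ) • a i) ''
          {lam | ∀ i, 1 ≤ lam i ∧ lam i ≤ l i}

/-- `P ⊆ ℝ^k` is a proper `d`-GAP: the parametrisation is injective. -/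
def IsProperGAPR (k d : ℕ) (P : Set (Fin k → ℝ)) : Prop :=
  ∃ (a : Fin d → (Fin k → ℝ)) (l : Fin d → ℕ), (∀ i, 1 ≤ l i) ∧
    P = (fun lam : Fin d → ℕ => ∑ i, (lam i : ℝ) • a i) ''
          {lam | ∀ i, 1 ≤ lam i ∧ lam i ≤ l i} ∧
    Set.InjOn (fun lam : Fin d → ℕ => ∑ i, (lam i : ℝ) • a i)
      {lam | ∀ i, 1 ≤ lam i ∧ lam i ≤ l i}

/-- A parallelotope in `ℝ^k`: `{x₀ + ∑ i, λ i • v i : λ i ∈ [0,1]}`. -/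
def IsParallelotope (k : ℕ) (Q : Set (Fin k → ℝ)) : Prop :=
  ∃ (x₀ : Fin k → ℝ) (v : Fin k → (Fin k → ℝ)),
    Q = (fun lam : Fin k → ℝ => x₀ + ∑ i, lam i • v i) '' (Set.Icc 0 1)

/-- If every superlevel set of `g` is at most as large as that of `f`, the power sums compare. -/
lemma sum_pow_le_of_card_superlevel_le {α β : Type*} [DecidableEq α] [DecidableEq β]
    {D : ℕ} (hD : D ≠ 0) (t : Finset β) (s : Finset α) (f : α → ℝ) (g : β → ℝ)
    (hf : ∀ p ∈ s, 0 ≤ f p) (hg : ∀ q ∈ t, 0 ≤ g q)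
    (h : ∀ u : ℝ, 0 < u → (t.filter (fun q => u ≤ g q)).card ≤
      (s.filter (fun p => u ≤ f p)).card) :
    ∑ q ∈ t, g q ^ D ≤ ∑ p ∈ s, f p ^ D := by
  induction hn : t.card generalizing t s with
  | zero =>
    rw [Finset.card_eq_zero] at hn
    subst hn
    simpa using Finset.sum_nonneg fun p hp => pow_nonneg (hf p hp) D
  | succ n ih =>
    have hne : t.Nonempty := by rw [← Finset.card_pos]; omega
    obtain ⟨q₀, hq₀, hmax⟩ := t.exists_max_image g hne
    rcases (hg q₀ hq₀).eq_or_lt with h0 | h0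
    · have : ∀ q ∈ t, g q ^ D = 0 := by
        intro q hq
        have : g q = 0 := le_antisymm (h0 ▸ hmax q hq) (hg q hq)
        rw [this, zero_pow hD]
      rw [Finset.sum_eq_zero this]
      exact Finset.sum_nonneg fun p hp => pow_nonneg (hf p hp) D
    · have h1 := h (g q₀) h0
      have h2 : 0 < (t.filter (fun q => g q₀ ≤ g q)).card :=
        Finset.card_pos.2 ⟨q₀, by simp [hq₀]⟩
      have hs : s.Nonempty := by
        obtain ⟨p, hp⟩ := Finset.card_pos.1 (h2.trans_le h1)
        exact ⟨p, (Finset.mem_filter.1 hp).1⟩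
      obtain ⟨p, hp⟩ := Finset.card_pos.1 (h2.trans_le h1)
      obtain ⟨p₀, hp₀, hpmax⟩ := s.exists_max_image f hs
      have hfg : g q₀ ≤ f p₀ :=
        (Finset.mem_filter.1 hp).2.trans (hpmax p (Finset.mem_filter.1 hp).1)
      rw [← Finset.add_sum_erase t _ hq₀, ← Finset.add_sum_erase s _ hp₀]
      refine add_le_add (pow_le_pow_left₀ h0.le hfg D) ?_
      refine ih (t.erase q₀) (s.erase p₀) (fun p hp => hf p (Finset.mem_of_mem_erase hp))
        (fun p hp => hg p (Finset.mem_of_mem_erase hp)) ?_ ?_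
      · intro u hu
        rcases le_or_gt u (g q₀) with hu' | hu'
        · have e1 : ((t.erase q₀).filter (fun q => u ≤ g q)) =
              (t.filter (fun q => u ≤ g q)).erase q₀ := by
            ext; simp; tauto
          have e2 : ((s.erase p₀).filter (fun q => u ≤ f q)) =
              (s.filter (fun q => u ≤ f q)).erase p₀ := by
            ext; simp; tauto
          rw [e1, e2, Finset.card_erase_of_mem (by simp [hq₀, hu']),
            Finset.card_erase_of_mem (by simp [hp₀, hu'.trans hfg])]
          exact Nat.sub_le_sub_right (h u hu) 1
        · have : ((t.erase q₀).filter (fun q => u ≤ g q)) = ∅ := by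
            rw [Finset.filter_eq_empty_iff]
            intro q hq
            exact not_le.2 ((hmax q (Finset.mem_of_mem_erase hq)).trans_lt hu')
          simp [this]
      · rw [Finset.card_erase_of_mem hq₀]; omega

lemma pow_add_pow_le_add_pow {x y : ℝ} (hx : 0 ≤ x) (hy : 0 ≤ y) {D : ℕ} (hD : D ≠ 0) :
    x ^ D + y ^ D ≤ (x + y) ^ D := by
  obtain ⟨m, rfl⟩ := Nat.exists_eq_succ_of_ne_zero hD
  have h1 : x ^ m ≤ (x + y) ^ m := pow_le_pow_left₀ hx (by linarith) m
  have h2 : y ^ m ≤ (x + y) ^ m := pow_le_pow_left₀ hy (by linarith) m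
  rw [pow_succ, pow_succ, pow_succ]
  nlinarith

lemma pow_sub_pow_le_mul {x y : ℝ} (hy : 0 ≤ y) (hxy : y ≤ x) (D : ℕ) :
    x ^ D - y ^ D ≤ D * (x - y) * x ^ (D - 1) := by
  induction D with
  | zero => simp
  | succ m ih =>
    have h1 : y ^ m ≤ x ^ m := pow_le_pow_left₀ hy hxy m
    have hx : 0 ≤ x := hy.trans hxy
    have e : x * ((m : ℝ) * (x - y) * x ^ (m - 1)) = m * (x - y) * x ^ m := by
      rcases m with _ | m
      · simp
      · simp [pow_succ]; ring
    have h3 := mul_le_mul_of_nonneg_left ih hx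
    rw [e] at h3
    simp only [Nat.add_sub_cancel]
    push_cast
    have h4 : (x - y) * y ^ m ≤ (x - y) * x ^ m :=
      mul_le_mul_of_nonneg_left h1 (by linarith)
    rw [pow_succ, pow_succ]
    linarith

lemma mul_le_pow_sub_pow {x y : ℝ} (hy : 0 ≤ y) (hxy : y ≤ x) (D : ℕ) :
    D * (x - y) * y ^ (D - 1) ≤ x ^ D - y ^ D := by
  induction D with
  | zero => simp
  | succ m ih =>
    have h1 : y ^ m ≤ x ^ m := pow_le_pow_left₀ hy hxy m
    have e : y * ((m : ℝ) * (x - y) * y ^ (m - 1)) = m * (x - y) * y ^ m := by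
      rcases m with _ | m
      · simp
      · simp [pow_succ]; ring
    have h3 := mul_le_mul_of_nonneg_left ih hy
    rw [e] at h3
    simp only [Nat.add_sub_cancel]
    push_cast
    have h4 : (x - y) * y ^ m ≤ (x - y) * x ^ m :=
      mul_le_mul_of_nonneg_left h1 (by linarith)
    rw [pow_succ, pow_succ]
    linarith

lemma sum_range_two_mul_add_one (f : ℕ → ℝ) (n : ℕ) :
    ∑ l ∈ Finset.range (2 * n + 1), f l =
      ∑ i ∈ Finset.range (n + 1), f (2 * i) + ∑ i ∈ Finset.range n, f (2 * i + 1) := by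
  induction n with
  | zero => simp
  | succ n ih =>
    rw [show 2 * (n + 1) + 1 = 2 * n + 1 + 1 + 1 by ring, Finset.sum_range_succ,
      Finset.sum_range_succ, ih, Finset.sum_range_succ _ (n + 1), Finset.sum_range_succ _ n,
      show 2 * (n + 1) = 2 * n + 1 + 1 by ring, Finset.sum_range_succ _ n]
    ring

/-- Approximate midpoint concavity coming from the small-sumset inequality. -/
lemma approx_midpoint {D : ℕ} (hD : D ≠ 0) {n : ℕ} {a b : ℕ → ℝ} (ha : Antitone a)
    (h0 : ∀ i, 0 ≤ a i) (hb : ∀ i j, i ≤ n → j ≤ n → a i + a j ≤ b (i + j))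
    (hs : ∑ l ∈ Finset.range (2 * n + 1), ((b l / 2) ^ D - a ((l + 1) / 2) ^ D) ≤ 1)
    {η : ℝ} (hη : 0 < η) {W : ℕ} (hW : 1 < (W + 1) * η ^ D)
    {p r : ℕ} (hr : r ≤ p) (hpr : p + r + W ≤ n) :
    (a (p - r) + a (p + r + W)) / 2 - η ≤ a p := by
  by_contra! hlt
  have hbl : ∀ l ∈ Finset.range (2 * n + 1), a ((l + 1) / 2) ≤ b l / 2 := by
    intro l hl
    rw [Finset.mem_range] at hl
    have h1 := hb (l / 2) ((l + 1) / 2) (by omega) (by omega)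
    rw [show l / 2 + (l + 1) / 2 = l by omega] at h1
    have h2 : a ((l + 1) / 2) ≤ a (l / 2) := ha (by omega)
    linarith
  have hnn : ∀ l ∈ Finset.range (2 * n + 1), 0 ≤ (b l / 2) ^ D - a ((l + 1) / 2) ^ D := by
    intro l hl
    have := pow_le_pow_left₀ (h0 _) (hbl l hl) D
    linarith
  have hsub : (Finset.Icc (2 * p) (2 * p + W)) ⊆ Finset.range (2 * n + 1) := by
    intro l hl
    simp only [Finset.mem_Icc, Finset.mem_range] at hl ⊢
    omega
  have h1 := Finset.sum_le_sum_of_subset_of_nonneg hsub (fun l hl _ => hnn l hl)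
  have h2 : ∑ l ∈ Finset.Icc (2 * p) (2 * p + W), η ^ D ≤
      ∑ l ∈ Finset.Icc (2 * p) (2 * p + W), ((b l / 2) ^ D - a ((l + 1) / 2) ^ D) := by
    refine Finset.sum_le_sum fun l hl => ?_
    rw [Finset.mem_Icc] at hl
    have h3 := hb (p - r) (l - (p - r)) (by omega) (by omega)
    rw [show p - r + (l - (p - r)) = l by omega] at h3
    have h4 : a (p + r + W) ≤ a (l - (p - r)) := ha (by omega)
    have h5 : a ((l + 1) / 2) ≤ a p := ha (by omega)
    have h6 : a ((l + 1) / 2) + η ≤ b l / 2 := by linarith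
    have h7 := pow_le_pow_left₀ (by have := h0 ((l+1)/2); linarith) h6 D
    have h8 := pow_add_pow_le_add_pow (h0 ((l + 1) / 2)) hη.le hD
    linarith
  rw [Finset.sum_const, Nat.card_Icc, nsmul_eq_mul] at h2
  have : ((2 * p + W + 1 - 2 * p : ℕ) : ℝ) = W + 1 := by
    rw [show 2 * p + W + 1 - 2 * p = W + 1 by omega]; push_cast; ring
  rw [this] at h2
  linarith

/-- Under approximate midpoint concavity, a large jump amplifies geometrically. -/
lemma jump_le {n W J : ℕ} {a : ℕ → ℝ} (h0 : ∀ i, 0 ≤ a i) (h1 : ∀ i, a i ≤ 1)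
    {η η₁ : ℝ} (hη : 0 < η) (hηη : 4 * η ≤ η₁)
    (hmid : ∀ p r, r ≤ p → p + r + W ≤ n → (a (p - r) + a (p + r + W)) / 2 - η ≤ a p)
    (hJ : 2 ≤ 2 ^ J * η₁) {i : ℕ} (hi : i + 2 ^ J * (1 + W) ≤ n) :
    a i - a (i + 1) ≤ η₁ := by
  by_contra! hlt
  have key : ∀ j, i + 2 ^ j * (1 + W) ≤ n →
      2 ^ j * (η₁ - 2 * η) + 2 * η ≤ a i - a (i + (2 ^ j * (1 + W) - W)) := by
    intro j
    induction j with
    | zero =>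
      intro _
      simp only [pow_zero, one_mul, Nat.add_sub_cancel]
      linarith
    | succ j ih =>
      intro hj
      have hj' : 2 ^ (j + 1) * (1 + W) = 2 * (2 ^ j * (1 + W)) := by ring
      rw [hj'] at hj ⊢
      set y := 2 ^ j * (1 + W) with hy
      have hyW : 1 + W ≤ y := Nat.le_mul_of_pos_left _ (by positivity)
      have h2 := ih (by omega)
      have h3 := hmid (i + (y - W)) (y - W) (by omega) (by omega)
      rw [show i + (y - W) - (y - W) = i by omega,
        show i + (y - W) + (y - W) + W = i + (2 * y - W) by omega] at h3
      rw [pow_succ]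
      linarith
  have h2 := key J hi
  have h3 := h0 (i + (2 ^ J * (1 + W) - W))
  have h4 := h1 i
  have h5 : (2:ℝ) ^ J * (4 * η) ≤ 2 ^ J * η₁ := mul_le_mul_of_nonneg_left hηη (by positivity)
  nlinarith

/-- Under approximate midpoint concavity, the sequence lies above its chord up to a small error. -/
lemma chord_le {m W : ℕ} (hm : 1 ≤ m) {a : ℕ → ℝ} (ha : Antitone a) (h0 : 0 ≤ a m)
    (ha0 : a 0 = 1) {η : ℝ} (hη : 0 < η)
    (hmid : ∀ p r, r ≤ p → p + r + W ≤ m → (a (p - r) + a (p + r + W)) / 2 - η ≤ a p)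
    (hWm : (W : ℝ) ≤ η * m) {i : ℕ} (hi : i ≤ m) :
    1 - (1 - a m) * (i / m) - 3 * η ≤ a i := by
  obtain ⟨p, hp, hpmax⟩ := (Finset.range (m + 1)).exists_max_image
    (fun p : ℕ => 1 - (1 - a m) * (p / m) - a p) ⟨0, by simp⟩
  simp only [Finset.mem_range] at hp hpmax
  have h1 : a m ≤ 1 := ha0 ▸ ha (Nat.zero_le m)
  have hmR : (0 : ℝ) < m := by exact_mod_cast hm
  have hw : (W : ℝ) / m ≤ η := by rw [div_le_iff₀ hmR]; exact hWm
  have hw0 : (0 : ℝ) ≤ (W : ℝ) / m := by positivity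
  have hw' : (1 - a m) * ((W : ℝ) / m) ≤ η := by nlinarith
  suffices 1 - (1 - a m) * (p / m) - a p ≤ 3 * η by
    have := hpmax i (by omega); linarith
  rcases le_or_gt (2 * p + W) m with hc | hc
  · have h2 := hmid p p le_rfl (by omega)
    rw [Nat.sub_self, ha0] at h2
    have h3 := hpmax (p + p + W) (by omega)
    push_cast at h3
    rw [show ((p : ℝ) + p + W) / m = p / m + p / m + W / m by ring] at h3
    nlinarith
  · rcases le_or_gt (p + W) m with hc' | hc'
    · have h2 := hmid p (m - p - W) (by omega) (by omega)
      rw [show p + (m - p - W) + W = m by omega] at h2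
      have h3 := hpmax (p - (m - p - W)) (by omega)
      have e : ((p - (m - p - W) : ℕ) : ℝ) = 2 * p + W - m := by
        rw [show p - (m - p - W) = 2 * p + W - m by omega, Nat.cast_sub hc.le]; push_cast; ring
      rw [e, show (2 * (p : ℝ) + W - m) / m = p / m + p / m + W / m - 1 by field_simp; ring] at h3
      nlinarith
    · have h2 : a m ≤ a p := ha (by omega)
      have h3 : (m : ℝ) ≤ p + W := by exact_mod_cast hc'.le
      have h4 : 1 ≤ (p : ℝ) / m + W / m := by
        rw [← add_div, le_div_iff₀ hmR]; linarith
      nlinarith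

lemma sum_chord_pow_ge {D m : ℕ} (hD : D ≠ 0) (hm : 1 ≤ m) {h : ℝ} (h0 : 0 ≤ h) (h1 : h ≤ 1) :
    m * (1 + h ^ D) ≤
      (D + 1) * ∑ i ∈ Finset.range m, (1 - (1 - h) * ((i : ℝ) / m)) ^ D := by
  have hmR : (0 : ℝ) < m := by exact_mod_cast hm
  rcases h1.eq_or_lt with rfl | hlt
  · have : (1 : ℝ) ≤ D := by exact_mod_cast Nat.one_le_iff_ne_zero.2 hD
    simp
    nlinarith
  · set S := ∑ i ∈ Finset.range m, (1 - (1 - h) * ((i : ℝ) / m)) ^ D with hS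
    have htel := Finset.sum_range_sub' (fun i : ℕ => (1 - (1 - h) * ((i : ℝ) / m)) ^ (D + 1)) m
    have h2 : ∑ i ∈ Finset.range m, ((1 - (1 - h) * ((i : ℝ) / m)) ^ (D + 1) -
        (1 - (1 - h) * (((i + 1 : ℕ) : ℝ) / m)) ^ (D + 1)) ≤
        ∑ i ∈ Finset.range m, (D + 1) * ((1 - h) / m) * (1 - (1 - h) * ((i : ℝ) / m)) ^ D := by
      refine Finset.sum_le_sum fun i hi => ?_
      rw [Finset.mem_range] at hi
      have hi' : ((i + 1 : ℕ) : ℝ) / m ≤ 1 := by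
        rw [div_le_one hmR]; exact_mod_cast hi
      have hd : ((i + 1 : ℕ) : ℝ) / m = i / m + 1 / m := by push_cast; ring
      have hm' : 0 ≤ 1 / (m : ℝ) := by positivity
      have := pow_sub_pow_le_mul (x := 1 - (1 - h) * ((i : ℝ) / m))
        (y := 1 - (1 - h) * (((i + 1 : ℕ) : ℝ) / m)) (by nlinarith) (by rw [hd]; nlinarith) (D + 1)
      refine this.trans (le_of_eq ?_)
      rw [hd]
      simp only [Nat.add_sub_cancel]
      push_cast
      ring
    rw [htel, ← Finset.mul_sum, ← hS] at h2
    simp only [Nat.cast_zero, zero_div, mul_zero, sub_zero, one_pow, div_self hmR.ne',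
      mul_one, _root_.sub_sub_cancel] at h2
    have h3 : (1 - h) * (1 + h ^ D) ≤ 1 - h ^ (D + 1) := by
      have : h ^ D ≤ h := pow_le_of_le_one h0 h1 hD
      rw [pow_succ]
      nlinarith
    have h4 : (1 - h) * (1 + h ^ D) ≤ (1 - h) * ((D + 1) * S / m) := by
      refine h3.trans (h2.trans (le_of_eq ?_)); ring
    have h5 := le_of_mul_le_mul_left h4 (by linarith)
    rw [le_div_iff₀ hmR] at h5
    linarith

lemma midpoint_defect_le {x y : ℝ} (hy : 0 ≤ y) (hxy : y ≤ x) (D : ℕ) :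
    (x ^ D + y ^ D) / 2 - ((x + y) / 2) ^ D ≤
      D / 4 * (x - y) * (x ^ (D - 1) - y ^ (D - 1)) := by
  have h1 := pow_sub_pow_le_mul (x := x) (y := (x + y) / 2) (by linarith) (by linarith) D
  have h2 := mul_le_pow_sub_pow (x := (x + y) / 2) (y := y) hy (by linarith) D
  have e1 : x - (x + y) / 2 = (x - y) / 2 := by ring
  have e2 : (x + y) / 2 - y = (x - y) / 2 := by ring
  rw [e1] at h1
  rw [e2] at h2
  linarith

lemma eps_mul_sum_le {D n m : ℕ} (hmn : m ≤ n) {a b : ℕ → ℝ} (ha : Antitone a)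
    (h0 : ∀ i, 0 ≤ a i) (ha0 : a 0 = 1)
    (hb : ∀ i j, i ≤ n → j ≤ n → a i + a j ≤ b (i + j)) {ε η₁ : ℝ} (hη₁ : 0 ≤ η₁)
    (hs : ∑ l ∈ Finset.range (2 * n + 1), (b l / 2) ^ D ≤
      (2 - ε) * ∑ i ∈ Finset.range (n + 1), a i ^ D)
    (hj : ∀ i < m, a i - a (i + 1) ≤ η₁) :
    ε * ∑ i ∈ Finset.range (n + 1), a i ^ D ≤ (1 + a m ^ D) / 2 + η₁ * D / 4 := by
  rw [sum_range_two_mul_add_one] at hs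
  have h1 : ∑ i ∈ Finset.range (n + 1), a i ^ D ≤
      ∑ i ∈ Finset.range (n + 1), (b (2 * i) / 2) ^ D := by
    refine Finset.sum_le_sum fun i hi => pow_le_pow_left₀ (h0 i) ?_ D
    rw [Finset.mem_range] at hi
    have := hb i i (by omega) (by omega)
    rw [← two_mul i] at this
    linarith
  have h2 : ∑ i ∈ Finset.range n, ((a i + a (i + 1)) / 2) ^ D ≤
      ∑ i ∈ Finset.range n, (b (2 * i + 1) / 2) ^ D := by
    refine Finset.sum_le_sum fun i hi =>
      pow_le_pow_left₀ (by have := h0 i; have := h0 (i+1); linarith) ?_ D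
    rw [Finset.mem_range] at hi
    have := hb i (i + 1) (by omega) (by omega)
    rw [show i + (i + 1) = 2 * i + 1 by ring] at this
    linarith
  have h3 : ∑ i ∈ Finset.range (n + 1), a i ^ D =
      (1 + a n ^ D) / 2 + ∑ i ∈ Finset.range n, (a i ^ D + a (i + 1) ^ D) / 2 := by
    have e1 := Finset.sum_range_succ (fun i => a i ^ D) n
    have e2 := Finset.sum_range_succ' (fun i => a i ^ D) n
    simp only [ha0, one_pow] at e2
    rw [← Finset.sum_div, Finset.sum_add_distrib]
    linarith
  have h4 : ∑ i ∈ Finset.range n, ((a i ^ D + a (i + 1) ^ D) / 2 -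
      ((a i + a (i + 1)) / 2) ^ D) ≤ (a m ^ D - a n ^ D) / 2 + η₁ * D / 4 := by
    rw [← Finset.sum_range_add_sum_Ico _ hmn]
    have h5 : ∑ i ∈ Finset.range m, ((a i ^ D + a (i + 1) ^ D) / 2 -
        ((a i + a (i + 1)) / 2) ^ D) ≤
        ∑ i ∈ Finset.range m, D / 4 * η₁ * (a i ^ (D - 1) - a (i + 1) ^ (D - 1)) := by
      refine Finset.sum_le_sum fun i hi => ?_
      rw [Finset.mem_range] at hi
      have hle : a (i + 1) ≤ a i := ha (Nat.le_succ i)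
      refine (midpoint_defect_le (h0 (i + 1)) hle D).trans ?_
      refine mul_le_mul_of_nonneg_right
        (mul_le_mul_of_nonneg_left (hj i hi) (by positivity)) ?_
      have := pow_le_pow_left₀ (h0 (i + 1)) hle (D - 1)
      linarith
    have h6 : ∑ i ∈ Finset.Ico m n, ((a i ^ D + a (i + 1) ^ D) / 2 -
        ((a i + a (i + 1)) / 2) ^ D) ≤
        ∑ i ∈ Finset.Ico m n, (a i ^ D - a (i + 1) ^ D) / 2 := by
      refine Finset.sum_le_sum fun i hi => ?_
      have hle : a (i + 1) ≤ a i := ha (Nat.le_succ i)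
      have := pow_le_pow_left₀ (h0 (i + 1))
        (show a (i + 1) ≤ (a i + a (i + 1)) / 2 by linarith) D
      linarith
    rw [← Finset.mul_sum, Finset.sum_range_sub', ha0, one_pow] at h5
    rw [← Finset.sum_div] at h6
    have h7 : ∑ i ∈ Finset.Ico m n, (a i ^ D - a (i + 1) ^ D) = a m ^ D - a n ^ D := by
      have := Finset.sum_Ico_sub (fun i => a i ^ D) hmn
      rw [← neg_inj, ← Finset.sum_neg_distrib]
      simp only [neg_sub]
      exact this
    rw [h7] at h6
    have h8 : 0 ≤ D / 4 * η₁ * a m ^ (D - 1) := by have := h0 m; positivity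
    nlinarith
  rw [Finset.sum_sub_distrib] at h4
  linarith

set_option maxHeartbeats 2000000 in
lemma seq_length_le_normalized {D : ℕ} (hD : D ≠ 0) {β : ℝ} (hβ : 0 < β) (hβ1 : β ≤ 1) :
    ∃ ε₀ : ℝ, 0 < ε₀ ∧ ∀ ε : ℝ, 0 < ε → ε < ε₀ → ∀ (n : ℕ) (a b : ℕ → ℝ), Antitone a →
      (∀ i, 0 ≤ a i) → a 0 = 1 → (∀ i j, i ≤ n → j ≤ n → a i + a j ≤ b (i + j)) →
      ∑ l ∈ Finset.range (2 * n + 1), (b l / 2) ^ D ≤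
        (2 - ε) * ∑ i ∈ Finset.range (n + 1), a i ^ D →
      (n + 1 : ℝ) ≤ (1 + β) * (D + 1) / (2 * ε) := by
  have hD1 : (1 : ℝ) ≤ D := by exact_mod_cast Nat.one_le_iff_ne_zero.2 hD
  set η₁ : ℝ := β / (2 * D) with hη₁
  set η : ℝ := β / (24 * D * (D + 1)) with hη
  have hη₁0 : 0 < η₁ := by positivity
  have hη0 : 0 < η := by positivity
  have hηη : 4 * η ≤ η₁ := by
    rw [hη, hη₁, mul_div_assoc', div_le_div_iff₀ (by positivity) (by positivity)]
    nlinarith [mul_pos hβ (by linarith : (0:ℝ) < D)]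
  have hηθ : 3 * η * D * (D + 1) / 2 = β / 16 := by rw [hη]; field_simp; norm_num
  have hη₁θ : η₁ * D / 4 = β / 8 := by rw [hη₁]; field_simp; norm_num
  obtain ⟨W, hW⟩ : ∃ W : ℕ, 1 < (W + 1) * η ^ D := by
    obtain ⟨W, hW⟩ := exists_nat_gt (1 / η ^ D)
    refine ⟨W, ?_⟩
    rw [div_lt_iff₀ (by positivity)] at hW
    have : 0 < η ^ D := by positivity
    linarith
  obtain ⟨J, hJ⟩ : ∃ J : ℕ, 2 ≤ 2 ^ J * η₁ := by
    obtain ⟨J, hJ⟩ := pow_unbounded_of_one_lt (2 / η₁) (by norm_num : (1:ℝ) < 2)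
    refine ⟨J, ?_⟩
    rw [div_lt_iff₀ hη₁0] at hJ
    exact hJ.le
  set W' := 2 ^ J * (1 + W) with hW'
  set N : ℝ := 8 * (W' + 1) / β + W / η + W' + 2 with hN
  have hN0 : 0 < N := by positivity
  refine ⟨(D + 1) / (2 * N), by positivity, ?_⟩
  intro ε hε hεε n a b ha h0 ha0 hb hs
  by_contra! hlt
  have hnN : N < n + 1 := by
    refine lt_of_le_of_lt ?_ hlt
    rw [lt_div_iff₀ (by positivity)] at hεε
    rw [le_div_iff₀ (by positivity)]
    nlinarith
  have hpos1 : 0 ≤ 8 * ((W' : ℝ) + 1) / β := by positivity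
  have hpos2 : 0 ≤ (W : ℝ) / η := by positivity
  have hWn : W' + 1 ≤ n := by
    have : ((W' + 1 : ℕ) : ℝ) < n := by push_cast; linarith
    exact_mod_cast this.le
  obtain ⟨m, hm⟩ : ∃ m, n = m + W' := ⟨n - W', by omega⟩
  have hm1 : 1 ≤ m := by omega
  have hnm : (n : ℝ) = m + W' := by rw [hm]; push_cast; ring
  have hWm : (W : ℝ) ≤ η * m := by
    have : (W : ℝ) / η ≤ m := by linarith
    rw [div_le_iff₀ hη0] at this
    linarith
  have hfrac : (1 - β / 8) * (n + 1) ≤ m := by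
    have : 8 * ((W' : ℝ) + 1) / β ≤ n + 1 := by linarith [Nat.cast_nonneg (α := ℝ) W']
    rw [div_le_iff₀ hβ] at this
    nlinarith
  have ha1 : ∀ i, a i ≤ 1 := fun i => ha0 ▸ ha (Nat.zero_le i)
  set s := ∑ i ∈ Finset.range (n + 1), a i ^ D with hsdef
  have hdiff : ∑ l ∈ Finset.range (2 * n + 1), ((b l / 2) ^ D - a ((l + 1) / 2) ^ D) ≤ 1 := by
    rw [Finset.sum_sub_distrib]
    have : ∑ l ∈ Finset.range (2 * n + 1), a ((l + 1) / 2) ^ D = 2 * s - 1 := by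
      rw [sum_range_two_mul_add_one (fun l => a ((l + 1) / 2) ^ D)]
      have e2 := Finset.sum_range_succ' (fun i => a i ^ D) n
      simp only [ha0, one_pow] at e2
      have e3 : ∀ i, (2 * i + 1) / 2 = i := fun i => by omega
      have e4 : ∀ i, (2 * i + 1 + 1) / 2 = i + 1 := fun i => by omega
      simp only [e3, e4]
      rw [← hsdef] at e2 ⊢
      linarith
    have hs0 : 0 ≤ s := Finset.sum_nonneg fun i _ => pow_nonneg (h0 i) D
    nlinarith
  have hmid : ∀ p r, r ≤ p → p + r + W ≤ n → (a (p - r) + a (p + r + W)) / 2 - η ≤ a p :=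
    fun p r hr hpr => approx_midpoint hD ha h0 hb hdiff hη0 hW hr hpr
  have hjump : ∀ i < m, a i - a (i + 1) ≤ η₁ := fun i hi =>
    jump_le h0 ha1 hη0 hηη hmid hJ (by omega)
  have hup := eps_mul_sum_le (by omega : m ≤ n) ha h0 ha0 hb hη₁0.le hs hjump
  have hchord : ∀ i ≤ m, 1 - (1 - a m) * ((i : ℝ) / m) - 3 * η ≤ a i := fun i hi =>
    chord_le hm1 ha (h0 m) ha0 hη0 (fun p r hr hpr => hmid p r hr (by omega)) hWm hi
  have hlow : ∑ i ∈ Finset.range m, ((1 - (1 - a m) * ((i : ℝ) / m)) ^ D - 3 * η * D) ≤ s := by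
    refine le_trans ?_ (Finset.sum_le_sum_of_subset_of_nonneg
      (Finset.range_subset_range.2 (by omega : m ≤ n + 1)) fun i _ _ => pow_nonneg (h0 i) D)
    refine Finset.sum_le_sum fun i hi => ?_
    rw [Finset.mem_range] at hi
    have hc := hchord i hi.le
    have hmR : (0 : ℝ) < m := by exact_mod_cast hm1
    have hi0 : 0 ≤ (i : ℝ) / m := by positivity
    have hi1 : (i : ℝ) / m ≤ 1 := by rw [div_le_one hmR]; exact_mod_cast hi.le
    have hc1 : 1 - (1 - a m) * ((i : ℝ) / m) ≤ 1 := by nlinarith [ha1 m]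
    have hc0 : 0 ≤ 1 - (1 - a m) * ((i : ℝ) / m) := by nlinarith [ha1 m, h0 m]
    rcases le_total (1 - (1 - a m) * ((i : ℝ) / m)) (a i) with hle | hle
    · have := pow_le_pow_left₀ hc0 hle D
      have : 0 ≤ 3 * η * D := by positivity
      linarith
    · have h3 := pow_sub_pow_le_mul (h0 i) hle D
      have h4 := pow_le_one₀ hc0 hc1 (n := D - 1)
      have h5 : 0 ≤ (1 - (1 - a m) * ((i : ℝ) / m)) ^ (D - 1) := pow_nonneg hc0 _
      set c := 1 - (1 - a m) * ((i : ℝ) / m)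
      have h6 : D * (c - a i) * c ^ (D - 1) ≤ D * (c - a i) * 1 :=
        mul_le_mul_of_nonneg_left h4 (mul_nonneg (by linarith) (by linarith))
      nlinarith
  rw [Finset.sum_sub_distrib, Finset.sum_const, Finset.card_range, nsmul_eq_mul] at hlow
  have hchs := sum_chord_pow_ge hD hm1 (h0 m) (ha1 m)
  set H := (1 + a m ^ D) / 2 with hH
  have hH1 : H ≤ 1 := by have := pow_le_one₀ (h0 m) (ha1 m) (n := D); rw [hH]; linarith
  have hH0 : 1 / 2 ≤ H := by have := pow_nonneg (h0 m) D; rw [hH]; linarith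
  have hlow2 : 2 * m * (H - β / 16) ≤ (D + 1) * s := by
    have := mul_le_mul_of_nonneg_left hlow (by linarith : (0:ℝ) ≤ D + 1)
    have e : 2 * m * (H - β / 16) = m * (1 + a m ^ D) - (D + 1) * (m * (3 * η * D)) := by
      rw [hH, ← hηθ]; ring
    rw [e]; linarith
  rw [hη₁θ] at hup
  rw [div_lt_iff₀ (by positivity)] at hlt
  have h9 : 2 * m * (H - β / 16) * ε ≤ (D + 1) * (H + β / 8) := by
    have := mul_le_mul_of_nonneg_right hlow2 hε.le
    have := mul_le_mul_of_nonneg_left hup (by linarith : (0:ℝ) ≤ D + 1)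
    linarith
  have hHb : 0 < H - β / 16 := by linarith
  have h10 : (1 - β / 8) * ((1 + β) * (D + 1)) * (H - β / 16) ≤ 2 * m * (H - β / 16) * ε := by
    have h11 : (1 - β / 8) * ((1 + β) * (D + 1)) ≤ (1 - β / 8) * ((n + 1) * (2 * ε)) :=
      mul_le_mul_of_nonneg_left hlt.le (by linarith)
    have h12 := mul_le_mul_of_nonneg_right hfrac (by linarith : 0 ≤ 2 * ε)
    have h13 : (1 - β / 8) * ((1 + β) * (D + 1)) ≤ m * (2 * ε) := by linarith
    have := mul_le_mul_of_nonneg_right h13 hHb.le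
    linarith
  have h14 : (D + 1) * ((1 - β / 8) * (1 + β) * (H - β / 16)) ≤ (D + 1) * (H + β / 8) := by
    linarith
  have h15 := le_of_mul_le_mul_left h14 (by linarith)
  have h16 : (1 + 3 * β / 4) ≤ (1 - β / 8) * (1 + β) := by nlinarith
  have h17 := mul_le_mul_of_nonneg_right h16 hHb.le
  nlinarith

/-- Sharp length bound for decreasing sequences with small sumset of `D`-th powers. -/
lemma seq_length_le {D : ℕ} (hD : D ≠ 0) {β : ℝ} (hβ : 0 < β) :
    ∃ ε₀ : ℝ, 0 < ε₀ ∧ ∀ ε : ℝ, 0 < ε → ε < ε₀ → ∀ (n : ℕ) (a b : ℕ → ℝ), Antitone a →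
      (∀ i, 0 ≤ a i) → 0 < a 0 → (∀ i j, i ≤ n → j ≤ n → a i + a j ≤ b (i + j)) →
      ∑ l ∈ Finset.range (2 * n + 1), b l ^ D ≤
        2 ^ D * (2 - ε) * ∑ i ∈ Finset.range (n + 1), a i ^ D →
      (n + 1 : ℝ) ≤ (1 + β) * (D + 1) / (2 * ε) := by
  obtain ⟨ε₀, hε₀, h⟩ := seq_length_le_normalized hD (lt_min hβ one_pos) (min_le_right β 1)
  refine ⟨ε₀, hε₀, fun ε hε hεε n a b ha h0 ha0 hb hs => ?_⟩
  refine (h ε hε hεε n (fun i => a i / a 0) (fun l => b l / a 0)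
    (fun i j hij => div_le_div_of_nonneg_right (ha hij) ha0.le)
    (fun i => div_nonneg (h0 i) ha0.le) (div_self ha0.ne') (fun i j hi hj => ?_) ?_).trans ?_
  · rw [← add_div]
    exact div_le_div_of_nonneg_right (hb i j hi hj) ha0.le
  · simp only [div_pow]
    rw [← Finset.sum_div, ← Finset.sum_div, ← Finset.sum_div, div_le_iff₀ (by positivity),
      div_le_iff₀ (by positivity)]
    refine hs.trans (le_of_eq ?_)
    field_simp
  · gcongr
    exact min_le_left _ _

/-- A subset `E` of `G` with a norm-preserving local homomorphism `Φ` into `V`, closed under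
addition as long as the image stays in the ball of radius `R`. -/
structure IsLocalGroup {G V : Type*} [AddCommGroup G] [NormedAddCommGroup V]
    (E : Set G) (Φ : G → V) (R : ℝ) : Prop where
  zero_mem : (0 : G) ∈ E
  neg_mem : ∀ x ∈ E, -x ∈ E
  map_neg : ∀ x ∈ E, Φ (-x) = -Φ x
  map_add : ∀ x ∈ E, ∀ y ∈ E, Φ (x + y) = Φ x + Φ y
  norm_le : ∀ x ∈ E, ‖Φ x‖ ≤ R
  add_mem : ∀ x ∈ E, ∀ y ∈ E, ‖Φ x + Φ y‖ ≤ R → x + y ∈ E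

namespace IsLocalGroup

variable {G V : Type*} [AddCommGroup G] [NormedAddCommGroup V] {E : Set G} {Φ : G → V} {R : ℝ}

lemma add_nsmul_mem (h : IsLocalGroup E Φ R) {x f : G} (hx : x ∈ E) (hf : f ∈ E) (n : ℕ)
    (hn : ‖Φ x‖ + n * ‖Φ f‖ ≤ R) : x + n • f ∈ E ∧ Φ (x + n • f) = Φ x + n • Φ f := by
  induction n with
  | zero => simpa using hx
  | succ n ih =>
    push_cast at hn
    have h1 := ih (by nlinarith [norm_nonneg (Φ f)])
    rw [succ_nsmul, ← add_assoc, succ_nsmul, ← add_assoc, ← h1.2]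
    refine ⟨h.add_mem _ h1.1 _ hf ?_, h.map_add _ h1.1 _ hf⟩
    rw [h1.2, add_assoc, ← succ_nsmul]
    refine (norm_add_le _ _).trans (le_trans (add_le_add_right (norm_nsmul_le) _) ?_)
    push_cast
    linarith

lemma add_zsmul_mem (h : IsLocalGroup E Φ R) {x f : G} (hx : x ∈ E) (hf : f ∈ E) (n : ℤ)
    (hn : ‖Φ x‖ + |(n : ℝ)| * ‖Φ f‖ ≤ R) : x + n • f ∈ E ∧ Φ (x + n • f) = Φ x + n • Φ f := by
  obtain ⟨m, rfl | rfl⟩ := n.eq_nat_or_neg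
  · simpa using h.add_nsmul_mem hx hf m (by simpa using hn)
  · have := h.add_nsmul_mem hx (h.neg_mem f hf) m (by rw [h.map_neg f hf]; simpa using hn)
    rw [h.map_neg f hf] at this
    simpa using this

lemma add_sum_mem (h : IsLocalGroup E Φ R) {ι : Type*} (s : Finset ι) {x : G} {f : ι → G}
    (hx : x ∈ E) (hf : ∀ i, f i ∈ E) (n : ι → ℤ)
    (hn : ‖Φ x‖ + ∑ i ∈ s, |(n i : ℝ)| * ‖Φ (f i)‖ ≤ R) :
    x + ∑ i ∈ s, n i • f i ∈ E ∧ Φ (x + ∑ i ∈ s, n i • f i) = Φ x + ∑ i ∈ s, n i • Φ (f i) := by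
  classical
  induction s using Finset.induction_on generalizing x with
  | empty => simpa using hx
  | insert i s hi ih =>
    rw [Finset.sum_insert hi] at hn ⊢
    rw [Finset.sum_insert hi]
    have hnn : 0 ≤ ∑ i ∈ s, |(n i : ℝ)| * ‖Φ (f i)‖ := Finset.sum_nonneg fun _ _ => by positivity
    have h1 := h.add_zsmul_mem hx (hf i) (n i) (by linarith)
    have hz : ‖n i • Φ (f i)‖ ≤ |(n i : ℝ)| * ‖Φ (f i)‖ := by
      refine (norm_zsmul_le _ _).trans (le_of_eq ?_)
      simp [Int.norm_eq_abs]
    have h2 := ih h1.1 (by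
      rw [h1.2]
      have := norm_add_le (Φ x) (n i • Φ (f i))
      linarith)
    rw [← add_assoc, ← add_assoc, ← h1.2]
    exact h2

lemma sum_mem (h : IsLocalGroup E Φ R) {ι : Type*} (s : Finset ι) {f : ι → G}
    (hf : ∀ i, f i ∈ E) (n : ι → ℤ) (hn : ∑ i ∈ s, |(n i : ℝ)| * ‖Φ (f i)‖ ≤ R) :
    ∑ i ∈ s, n i • f i ∈ E ∧ Φ (∑ i ∈ s, n i • f i) = ∑ i ∈ s, n i • Φ (f i) := by
  have h0 : Φ 0 = 0 := by simpa using h.map_add 0 h.zero_mem 0 h.zero_mem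
  simpa [h0] using h.add_sum_mem s h.zero_mem hf n (by simpa [h0] using hn)

end IsLocalGroup

section ReducedBasis

variable {V : Type*} [NormedAddCommGroup V] [InnerProductSpace ℝ V]

/-- Component along `u`. -/
noncomputable def alongCoeff (u e : V) : ℝ := inner ℝ u e / ‖u‖ ^ 2

/-- Orthogonal projection away from `u`. -/
noncomputable def awayProj (u : V) : V →ₗ[ℝ] V where
  toFun e := e - alongCoeff u e • u
  map_add' x y := by simp [alongCoeff, inner_add_right, add_div, add_smul]; abel
  map_smul' t x := by
    simp [alongCoeff, inner_smul_right, mul_div_assoc, mul_smul, smul_sub]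

lemma awayProj_apply (u e : V) : awayProj u e = e - alongCoeff u e • u := rfl

lemma inner_awayProj {u : V} (hu : u ≠ 0) (e : V) : inner ℝ u (awayProj u e) = 0 := by
  have : ‖u‖ ^ 2 ≠ 0 := by simpa using hu
  rw [awayProj_apply, inner_sub_right, inner_smul_right, real_inner_self_eq_norm_sq,
    alongCoeff, div_mul_cancel₀ _ this, sub_self]

lemma norm_sq_eq_awayProj {u : V} (hu : u ≠ 0) (e : V) :
    ‖e‖ ^ 2 = ‖awayProj u e‖ ^ 2 + alongCoeff u e ^ 2 * ‖u‖ ^ 2 := by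
  have h : e = awayProj u e + alongCoeff u e • u := by rw [awayProj_apply]; abel
  conv_lhs => rw [h]
  rw [norm_add_sq_real, inner_smul_right, real_inner_comm, inner_awayProj hu, norm_smul, mul_pow]
  simp

lemma norm_awayProj_le {u : V} (hu : u ≠ 0) (e : V) : ‖awayProj u e‖ ≤ ‖e‖ := by
  have := norm_sq_eq_awayProj hu e
  have h2 : 0 ≤ alongCoeff u e ^ 2 * ‖u‖ ^ 2 := by positivity
  exact le_of_sq_le_sq (by linarith) (norm_nonneg e)

lemma awayProj_self {u : V} (hu : u ≠ 0) : awayProj u u = 0 := by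
  have : ‖u‖ ^ 2 ≠ 0 := by simpa using hu
  rw [awayProj_apply, alongCoeff, real_inner_self_eq_norm_sq, div_self this, one_smul, sub_self]

lemma norm_le_of_awayProj {u : V} (e : V) :
    ‖e‖ ≤ ‖awayProj u e‖ + |alongCoeff u e| * ‖u‖ := by
  have h : e = awayProj u e + alongCoeff u e • u := by rw [awayProj_apply]; abel
  conv_lhs => rw [h]
  refine (norm_add_le _ _).trans ?_
  rw [norm_smul, Real.norm_eq_abs]

/-- A finite local subgroup of a finite-dimensional inner product space has a reduced basis. -/
lemma exists_reduced_basis (m : ℕ) : ∀ (W : Submodule ℝ V) (E : Set V) (R : ℝ),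
    FiniteDimensional ℝ W → Module.finrank ℝ W ≤ m → E ⊆ W → E.Finite → IsLocalGroup E id R →
    ∃ r ≤ m, ∃ u : Fin r → V, (∀ i, u i ∈ E) ∧ (∀ i, u i ≠ 0) ∧
      (∀ t : Fin r → ℝ, (1 / 16) ^ m * ∑ i, |t i| * ‖u i‖ ≤ ‖∑ i, t i • u i‖) ∧
      ∀ e ∈ E, ‖e‖ ≤ (1 / 16) ^ m * R → ∃ n : Fin r → ℤ, e = ∑ i, n i • u i := by
  induction m with
  | zero =>
    intro W E R hfd hW hEW _ _
    refine ⟨0, le_rfl, Fin.elim0, fun i => i.elim0, fun i => i.elim0, fun t => by simp, ?_⟩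
    intro e he _
    have : W = ⊥ := Submodule.finrank_eq_zero.1 (Nat.le_zero.1 hW)
    refine ⟨Fin.elim0, ?_⟩
    have h2 := hEW he
    rw [this] at h2
    simpa using h2
  | succ m ih =>
    intro W E R hfd hW hEW hfin hE
    have hR0 : 0 ≤ R := by simpa using hE.norm_le 0 hE.zero_mem
    set c' : ℝ := (1 / 16) ^ m with hc'
    have hc'0 : 0 < c' := by positivity
    have hc'1 : c' ≤ 1 := pow_le_one₀ (by norm_num) (by norm_num)
    have hc : (1 / 16 : ℝ) ^ (m + 1) = c' / 16 := by rw [pow_succ, hc']; ring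
    rw [hc]
    by_cases hnz : ∃ e ∈ E, e ≠ 0 ∧ ‖e‖ ≤ c' / 16 * R
    swap
    · refine ⟨0, Nat.zero_le _, Fin.elim0, fun i => i.elim0, fun i => i.elim0,
        fun t => by simp, ?_⟩
      intro e he hle
      refine ⟨Fin.elim0, ?_⟩
      by_contra hne
      exact hnz ⟨e, he, by simpa using hne, hle⟩
    obtain ⟨e₀, he₀, he₀0, he₀R⟩ := hnz
    obtain ⟨u, ⟨huE, hu0⟩, humin⟩ := Set.exists_min_image (E ∩ {e | e ≠ 0}) (fun e => ‖e‖)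
      (hfin.inter_of_left _) ⟨e₀, he₀, he₀0⟩
    simp only [mem_ofPred_eq] at hu0
    have huR : ‖u‖ ≤ c' / 16 * R := (humin e₀ ⟨he₀, he₀0⟩).trans he₀R
    have hu : 0 < ‖u‖ := norm_pos_iff.2 hu0
    have huR' : ‖u‖ ≤ R / 16 := by nlinarith
    have hcoeff_sub : ∀ e : V, ∀ t : ℝ, alongCoeff u (e + t • u) = alongCoeff u e + t := by
      intro e t
      have : ‖u‖ ^ 2 ≠ 0 := by positivity
      rw [alongCoeff, inner_add_right, inner_smul_right, real_inner_self_eq_norm_sq, add_div,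
        mul_div_cancel_right₀ _ this, alongCoeff]
    have hproj_add : ∀ e : V, ∀ t : ℝ, awayProj u (e + t • u) = awayProj u e := by
      intro e t
      rw [_root_.map_add, map_smul, awayProj_self hu0, smul_zero, add_zero]
    set E' : Set V := {p | ‖p‖ ≤ R / 4 ∧ ∃ e ∈ E, awayProj u e = p} with hE'
    have hlift : ∀ p ∈ E', ∃ e ∈ E, awayProj u e = p ∧ |alongCoeff u e| ≤ 1 / 2 := by
      rintro p ⟨hp, e₁, he₁, hpe₁⟩
      obtain ⟨e, ⟨heE, hep⟩, hemin⟩ := Set.exists_min_image (E ∩ {e | awayProj u e = p})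
        (fun e => ‖e‖) (hfin.inter_of_left _) ⟨e₁, he₁, hpe₁⟩
      simp only [mem_ofPred_eq] at hep
      refine ⟨e, heE, hep, ?_⟩
      by_contra! hgt
      have step : ∀ t : ℝ, t • u ∈ E → (alongCoeff u e + t) ^ 2 < alongCoeff u e ^ 2 → False := by
        intro t ht hlt
        have h1 := norm_sq_eq_awayProj hu0 e
        have h2 := norm_sq_eq_awayProj hu0 (e + t • u)
        rw [hcoeff_sub, hproj_add] at h2
        have h3 : ‖e + t • u‖ ^ 2 < ‖e‖ ^ 2 := by
          rw [h1, h2]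
          have : 0 < ‖u‖ ^ 2 := by positivity
          nlinarith
        have h4 : ‖e + t • u‖ < ‖e‖ := lt_of_pow_lt_pow_left₀ 2 (norm_nonneg _) h3
        have h5 : e + t • u ∈ E := hE.add_mem _ heE _ ht (h4.le.trans (hE.norm_le e heE))
        exact absurd (hemin _ ⟨h5, by simp only [mem_ofPred_eq]; rw [hproj_add, hep]⟩)
          (not_le.2 h4)
      rcases lt_abs.1 hgt with h | h
      · exact step (-1) (by simpa using hE.neg_mem u huE) (by nlinarith)
      · exact step 1 (by simpa using huE) (by nlinarith)
    have hE'loc : IsLocalGroup E' (id : V → V) (R / 4) := by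
      refine ⟨⟨by simp; linarith, 0, hE.zero_mem, by simp⟩, ?_, fun _ _ => rfl,
        fun _ _ _ _ => rfl, fun p hp => hp.1, ?_⟩
      · rintro p ⟨hp, e, he, rfl⟩
        exact ⟨by simpa using hp, -e, hE.neg_mem e he, by simp⟩
      · intro p hp q hq hpq
        obtain ⟨e, he, rfl, hea⟩ := hlift p hp
        obtain ⟨f, hf, rfl, hfa⟩ := hlift q hq
        refine ⟨hpq, e + f, hE.add_mem e he f hf ?_, by simp⟩
        have h1 := norm_le_of_awayProj (u := u) (e + f)
        have h2 : alongCoeff u (e + f) = alongCoeff u e + alongCoeff u f := by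
          simp [alongCoeff, inner_add_right, add_div]
        have h3 : |alongCoeff u (e + f)| ≤ 1 := by
          rw [h2]; exact (abs_add_le _ _).trans (by linarith)
        simp only [id] at hpq ⊢
        rw [_root_.map_add] at h1
        nlinarith
    have hE'fin : E'.Finite := (hfin.image (awayProj u)).subset (by
      rintro p ⟨_, e, he, rfl⟩; exact ⟨e, he, rfl⟩)
    set W' : Submodule ℝ V := W ⊓ (ℝ ∙ u)ᗮ with hW'
    have hE'W : E' ⊆ W' := by
      rintro p ⟨_, e, he, rfl⟩
      refine ⟨W.sub_mem (hEW he) (W.smul_mem _ (hEW huE)), ?_⟩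
      rw [SetLike.mem_coe, Submodule.mem_orthogonal_singleton_iff_inner_right]
      exact inner_awayProj hu0 e
    have hlt : W' < W := by
      refine lt_of_le_of_ne inf_le_left fun h => ?_
      have h1 : u ∈ W' := by rw [h]; exact hEW huE
      have h2 := h1.2
      rw [SetLike.mem_coe, Submodule.mem_orthogonal_singleton_iff_inner_right,
        real_inner_self_eq_norm_sq] at h2
      have : 0 < ‖u‖ ^ 2 := by positivity
      linarith
    have hfd' : FiniteDimensional ℝ W' := Submodule.finiteDimensional_of_le hlt.le
    have hfr : Module.finrank ℝ W' ≤ m := by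
      have := Submodule.finrank_lt_finrank_of_lt hlt
      omega
    obtain ⟨r, hr, u', hu'E, hu'0, hred, hgen⟩ := ih W' E' (R / 4) hfd' hfr hE'W hE'fin hE'loc
    choose v hvE hvp hva using fun i => hlift (u' i) (hu'E i)
    have hvn : ∀ i, ‖v i‖ ≤ 2 * ‖u' i‖ := by
      intro i
      have hv0 : v i ≠ 0 := by
        intro h; apply hu'0 i; rw [← hvp i, h, _root_.map_zero]
      have h1 : ‖u‖ ≤ ‖v i‖ := humin _ ⟨hvE i, hv0⟩
      have h2 := norm_sq_eq_awayProj hu0 (v i)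
      rw [hvp i] at h2
      have h3 : alongCoeff u (v i) ^ 2 ≤ 1 / 4 := by
        have := abs_le.1 (hva i); nlinarith
      have h4 : ‖v i‖ ^ 2 ≤ (2 * ‖u' i‖) ^ 2 := by nlinarith [norm_nonneg u, norm_nonneg (v i)]
      exact le_of_sq_le_sq h4 (by positivity)
    have hsum' : ∀ t : Fin r → ℝ, awayProj u (∑ i, t i • v i) = ∑ i, t i • u' i := by
      intro t
      simp [map_sum, hvp]
    refine ⟨r + 1, by omega, Fin.cons u v, ?_, ?_, ?_, ?_⟩
    · intro i; refine Fin.cases ?_ (fun j => ?_) i <;> simp [huE, hvE]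
    · intro i
      refine Fin.cases ?_ (fun j => ?_) i
      · simpa using hu0
      · simp only [Fin.cons_succ]
        intro h; apply hu'0 j; rw [← hvp j, h, _root_.map_zero]
    · intro t
      rw [Fin.sum_univ_succ, Fin.sum_univ_succ]
      simp only [Fin.cons_zero, Fin.cons_succ]
      set N := ‖t 0 • u + ∑ i : Fin r, t i.succ • v i‖ with hN
      set σ₁ := ∑ i : Fin r, |t i.succ| * ‖u' i‖ with hσ₁
      set σ₂ := ∑ i : Fin r, |t i.succ| * ‖v i‖ with hσ₂
      have h1 : c' * σ₁ ≤ N := by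
        refine (hred fun i => t i.succ).trans ?_
        rw [← hsum']
        have := norm_awayProj_le hu0 (t 0 • u + ∑ i : Fin r, t i.succ • v i)
        rwa [_root_.map_add, map_smul, awayProj_self hu0, smul_zero, zero_add] at this
      have h2 : σ₂ ≤ 2 * σ₁ := by
        rw [hσ₁, hσ₂, Finset.mul_sum]
        refine Finset.sum_le_sum fun i _ => ?_
        have := mul_le_mul_of_nonneg_left (hvn i) (abs_nonneg (t i.succ))
        linarith
      have h3 : ‖∑ i : Fin r, t i.succ • v i‖ ≤ σ₂ := by
        refine (norm_sum_le _ _).trans (le_of_eq ?_)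
        simp [norm_smul, hσ₂]
      have h4 : |t 0| * ‖u‖ ≤ N + σ₂ := by
        rw [← Real.norm_eq_abs, ← norm_smul]
        have := norm_sub_le (t 0 • u + ∑ i : Fin r, t i.succ • v i) (∑ i : Fin r, t i.succ • v i)
        rw [add_sub_cancel_right] at this
        linarith
      have hN0 : 0 ≤ N := norm_nonneg _
      nlinarith
    · intro e he hle
      have hpe : awayProj u e ∈ E' := by
        refine ⟨(norm_awayProj_le hu0 e).trans (hle.trans ?_), e, he, rfl⟩
        nlinarith
      obtain ⟨n, hn⟩ := hgen _ hpe ((norm_awayProj_le hu0 e).trans (hle.trans (by nlinarith)))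
      have hnsum : c' * ∑ i, |(n i : ℝ)| * ‖u' i‖ ≤ c' / 16 * R := by
        refine (hred fun i => (n i : ℝ)).trans ?_
        have : ∑ i, (n i : ℝ) • u' i = awayProj u e := by
          rw [hn]; exact Finset.sum_congr rfl fun i _ => Int.cast_smul_eq_zsmul ℝ _ _
        rw [this]
        exact (norm_awayProj_le hu0 e).trans hle
      have hnsum2 : ∑ i, |(n i : ℝ)| * ‖u' i‖ ≤ R / 16 :=
        le_of_mul_le_mul_left (by linarith) hc'0
      have hnsum3 : ∑ i, |(n i : ℝ)| * ‖v i‖ ≤ R / 8 := by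
        have : ∑ i, |(n i : ℝ)| * ‖v i‖ ≤ ∑ i, 2 * (|(n i : ℝ)| * ‖u' i‖) := by
          refine Finset.sum_le_sum fun i _ => ?_
          have := mul_le_mul_of_nonneg_left (hvn i) (abs_nonneg (n i : ℝ))
          linarith
        rw [← Finset.mul_sum] at this
        linarith
      have heR : ‖e‖ ≤ R / 16 := hle.trans (by nlinarith)
      obtain ⟨hxE, -⟩ := hE.add_sum_mem Finset.univ he hvE (fun i => -n i) (by
        simp only [id, Int.cast_neg, abs_neg]
        linarith)
      have hxn : ‖e + ∑ i, -n i • v i‖ ≤ R / 4 := by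
        refine (norm_add_le _ _).trans ?_
        have : ‖∑ i, -n i • v i‖ ≤ ∑ i, |(n i : ℝ)| * ‖v i‖ := by
          refine (norm_sum_le _ _).trans (Finset.sum_le_sum fun i _ => ?_)
          rw [← Int.cast_smul_eq_zsmul ℝ, norm_smul]
          simp
        linarith
      set x := e + ∑ i, -n i • v i with hx
      have hpx : awayProj u x = 0 := by
        rw [hx, _root_.map_add, hn]
        have := hsum' (fun i => -(n i : ℝ))
        have e1 : ∑ i, (-n i) • v i = ∑ i, (-(n i : ℝ)) • v i :=
          Finset.sum_congr rfl fun i _ => by rw [← Int.cast_smul_eq_zsmul ℝ]; simp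
        rw [e1, this, ← Finset.sum_add_distrib]
        refine Finset.sum_eq_zero fun i _ => ?_
        rw [← Int.cast_smul_eq_zsmul ℝ]; simp
      set t := alongCoeff u x with ht
      have hxt : x = t • u := by
        rw [awayProj_apply, sub_eq_zero] at hpx; exact hpx
      have htn : |t| * ‖u‖ ≤ R / 4 := by
        rw [← Real.norm_eq_abs, ← norm_smul, ← hxt]; exact hxn
      have hround := abs_sub_round t
      have hrn : |(round t : ℝ)| * ‖u‖ ≤ R / 2 := by
        have h1 : |(round t : ℝ)| ≤ |t| + 1 / 2 := by
          have := abs_sub_abs_le_abs_sub (round t : ℝ) t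
          rw [abs_sub_comm] at this
          linarith
        nlinarith
      obtain ⟨hyE, -⟩ := hE.add_zsmul_mem hxE huE (-round t) (by
        simp only [id, Int.cast_neg, abs_neg]
        linarith)
      have hy : x + -round t • u = (t - round t) • u := by
        rw [hxt, ← Int.cast_smul_eq_zsmul ℝ, ← add_smul]
        simp [sub_eq_add_neg]
      have hy0 : x + -round t • u = 0 := by
        by_contra hne
        have h1 := humin _ ⟨hyE, hne⟩
        rw [hy, norm_smul, Real.norm_eq_abs] at h1
        nlinarith
      refine ⟨Fin.cons (round t) n, ?_⟩
      rw [Fin.sum_univ_succ]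
      simp only [Fin.cons_zero, Fin.cons_succ]
      have h5 : e = x + ∑ i, n i • v i := by
        rw [hx]; simp
      rw [h5]
      congr 1
      rw [neg_smul] at hy0
      exact eq_of_sub_eq_zero (by rw [sub_eq_add_neg]; exact hy0)

end ReducedBasis

/-- Rearrangement lower bound for power sums of a sup-convolution on `ℤ`. -/
lemma sum_pow_supConv_ge {m : ℕ} (hm : m ≠ 0) {S T : Finset ℤ} {a g b : ℤ → ℝ}
    (ha : ∀ s ∈ S, 0 ≤ a s) (hg : ∀ t ∈ T, 0 ≤ g t)
    (hb : ∀ s ∈ S, ∀ t ∈ T, a s + g t ≤ b (s + t)) {s₀ t₀ : ℤ} (hs₀ : s₀ ∈ S) (ht₀ : t₀ ∈ T)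
    (has : ∀ s ∈ S, a s ≤ a s₀) (hgt : ∀ t ∈ T, g t ≤ g t₀) (h0a : 0 < a s₀) (h0g : 0 < g t₀) :
    (a s₀ + g t₀) ^ m * (∑ s ∈ S, (a s / a s₀) ^ m + ∑ t ∈ T, (g t / g t₀) ^ m - 1) ≤
      ∑ r ∈ S + T, b r ^ m := by
  classical
  set w := a s₀ + g t₀ with hw
  have hw0 : 0 < w := by positivity
  have key := sum_pow_le_of_card_superlevel_le (D := m) hm (S.disjSum (T.erase t₀)) (S + T) b
    (Sum.elim (fun s => w * (a s / a s₀)) (fun t => w * (g t / g t₀))) ?_ ?_ ?_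
  · refine le_trans (le_of_eq ?_) key
    rw [Finset.sum_disjSum]
    simp only [Sum.elim_inl, Sum.elim_inr, mul_pow]
    rw [← Finset.mul_sum, ← Finset.mul_sum, ← Finset.add_sum_erase T _ ht₀, div_self h0g.ne']
    ring
  · intro r hr
    obtain ⟨s, hs, t, ht, rfl⟩ := Finset.mem_add.1 hr
    exact (add_nonneg (ha s hs) (hg t ht)).trans (hb s hs t ht)
  · intro q hq
    rcases Finset.mem_disjSum.1 hq with ⟨s, hs, rfl⟩ | ⟨t, ht, rfl⟩
    · have := ha s hs; simp only [Sum.elim_inl]; positivity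
    · have := hg t (Finset.mem_of_mem_erase ht); simp only [Sum.elim_inr]; positivity
  · intro u hu
    have efil : (S.disjSum (T.erase t₀)).filter (fun q => u ≤ Sum.elim
        (fun s => w * (a s / a s₀)) (fun t => w * (g t / g t₀)) q) =
        (S.filter (fun s => u ≤ w * (a s / a s₀))).disjSum
          ((T.erase t₀).filter (fun t => u ≤ w * (g t / g t₀))) := by
      ext (q | q) <;> simp
    rw [efil, Finset.card_disjSum]
    rcases le_or_gt u w with huw | huw
    · set I := S.filter (fun s => u ≤ w * (a s / a s₀))
      set J := T.filter (fun t => u ≤ w * (g t / g t₀))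
      have hI : s₀ ∈ I := by simp [I, hs₀, div_self h0a.ne', huw]
      have hJ : t₀ ∈ J := by simp [J, ht₀, div_self h0g.ne', huw]
      have e : (T.erase t₀).filter (fun t => u ≤ w * (g t / g t₀)) = J.erase t₀ := by
        ext; simp [J]; tauto
      rw [e, Finset.card_erase_of_mem hJ]
      have h1 := cauchy_davenport_add_of_linearOrder_isCancelAdd ⟨s₀, hI⟩ ⟨t₀, hJ⟩
      have h2 : I + J ⊆ (S + T).filter (fun r => u ≤ b r) := by
        intro r hr
        obtain ⟨s, hs, t, ht, rfl⟩ := Finset.mem_add.1 hr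
        simp only [I, J, Finset.mem_filter] at hs ht
        refine Finset.mem_filter.2 ⟨Finset.add_mem_add hs.1 ht.1, ?_⟩
        refine le_trans ?_ (hb s hs.1 t ht.1)
        have h3 := hs.2
        have h4 := ht.2
        rw [mul_div_assoc', le_div_iff₀ h0a] at h3
        rw [mul_div_assoc', le_div_iff₀ h0g] at h4
        have : u * w ≤ w * (a s + g t) := by rw [hw] at h3 h4 ⊢; linarith
        exact le_of_mul_le_mul_left (by linarith) hw0
      have h3 := Finset.card_le_card h2
      have h4 : 1 ≤ J.card := Finset.card_pos.2 ⟨t₀, hJ⟩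
      omega
    · have e1 : S.filter (fun s => u ≤ w * (a s / a s₀)) = ∅ := by
        rw [Finset.filter_eq_empty_iff]
        intro s hs
        have : a s / a s₀ ≤ 1 := by rw [div_le_one h0a]; exact has s hs
        nlinarith
      have e2 : (T.erase t₀).filter (fun t => u ≤ w * (g t / g t₀)) = ∅ := by
        rw [Finset.filter_eq_empty_iff]
        intro t ht
        have : g t / g t₀ ≤ 1 := by rw [div_le_one h0g]; exact hgt t (Finset.mem_of_mem_erase ht)
        nlinarith
      rw [e1, e2]; simp

lemma radon_ineq {m : ℕ} {x y α γ : ℝ} (hx : 0 ≤ x) (hy : 0 ≤ y) (hα : 0 < α) (hγ : 0 < γ) :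
    (x + y) ^ (m + 1) ≤ (α + γ) ^ m * (x ^ (m + 1) / α ^ m + y ^ (m + 1) / γ ^ m) := by
  have h := (convexOn_pow (m + 1)).2 (show x / α ∈ Ici (0 : ℝ) from div_nonneg hx hα.le)
    (show y / γ ∈ Ici (0 : ℝ) from div_nonneg hy hγ.le)
    (show 0 ≤ α / (α + γ) by positivity) (show 0 ≤ γ / (α + γ) by positivity)
    (by field_simp)
  simp only [smul_eq_mul] at h
  have e1 : α / (α + γ) * (x / α) + γ / (α + γ) * (y / γ) = (x + y) / (α + γ) := by
    field_simp
  have e2 : α / (α + γ) * (x / α) ^ (m + 1) + γ / (α + γ) * (y / γ) ^ (m + 1) =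
      (x ^ (m + 1) / α ^ m + y ^ (m + 1) / γ ^ m) / (α + γ) := by
    rw [div_pow, div_pow, pow_succ α, pow_succ γ]
    field_simp
  rw [e1, e2, div_pow, div_le_div_iff₀ (by positivity) (by positivity), pow_succ (α + γ)] at h
  have : 0 < α + γ := by positivity
  refine le_of_mul_le_mul_right (h.trans (le_of_eq ?_)) this
  ring

/-- Slice of a finite set of lattice points by the value of the first coordinate. -/
def firstSlice {m : ℕ} (U : Finset (Fin (m + 1) → ℤ)) (s : ℤ) : Finset (Fin m → ℤ) :=
  (U.filter (fun x => x 0 = s)).image Fin.tail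

lemma mem_firstSlice {m : ℕ} {U : Finset (Fin (m + 1) → ℤ)} {s : ℤ} {y : Fin m → ℤ} :
    y ∈ firstSlice U s ↔ (Fin.cons s y : Fin (m + 1) → ℤ) ∈ U := by
  simp only [firstSlice, Finset.mem_image, Finset.mem_filter]
  constructor
  · rintro ⟨x, ⟨hx, rfl⟩, rfl⟩
    rwa [Fin.cons_self_tail]
  · intro h
    exact ⟨_, ⟨h, by simp⟩, by simp⟩

lemma sum_card_firstSlice {m : ℕ} (U : Finset (Fin (m + 1) → ℤ)) :
    ∑ s ∈ U.image (fun x => x 0), (firstSlice U s).card = U.card := by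
  rw [Finset.card_eq_sum_card_image (fun x : Fin (m + 1) → ℤ => x 0) U]
  refine Finset.sum_congr rfl fun s _ => Finset.card_image_of_injOn ?_
  intro x hx y hy hxy
  simp only [Finset.coe_filter, mem_ofPred_eq] at hx hy
  rw [← Fin.cons_self_tail x, ← Fin.cons_self_tail y, hx.2, hy.2, hxy]

lemma card_le_prod_of_box {ι : Type*} [Fintype ι] [DecidableEq ι] (U : Finset (ι → ℤ)) (M : ι → ℕ)
    (hU : ∀ x ∈ U, ∀ i, |x i| ≤ M i) : (U.card : ℝ) ≤ ∏ i, (2 * (M i : ℝ) + 1) := by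
  have h1 : U ⊆ Fintype.piFinset (fun i => Finset.Icc (-(M i : ℤ)) (M i)) := by
    intro x hx
    rw [Fintype.mem_piFinset]
    intro i
    exact Finset.mem_Icc.2 (abs_le.1 (hU x hx i))
  have h2 := Finset.card_le_card h1
  rw [Fintype.card_piFinset] at h2
  have h3 : ∀ i, ((Finset.Icc (-(M i : ℤ)) (M i)).card : ℝ) = 2 * (M i : ℝ) + 1 := by
    intro i
    rw [Int.card_Icc, show ((M i : ℤ) + 1 - -(M i : ℤ)).toNat = 2 * M i + 1 by omega]
    push_cast; ring
  calc (U.card : ℝ) ≤ ((∏ i, (Finset.Icc (-(M i : ℤ)) (M i)).card : ℕ) : ℝ) := by exact_mod_cast h2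
    _ = ∏ i, (2 * (M i : ℝ) + 1) := by rw [Nat.cast_prod]; exact Finset.prod_congr rfl fun i _ => h3 i

set_option maxHeartbeats 1000000 in
/-- Asymptotic discrete Brunn–Minkowski inequality in boxes with long sides. -/
lemma discrete_brunn_minkowski (m : ℕ) : ∃ c : ℝ, 0 ≤ c ∧
    ∀ (U V : Finset (Fin (m + 1) → ℤ)) (M : Fin (m + 1) → ℕ) (L : ℕ) (α γ : ℝ),
      1 ≤ L → (∀ i, L ≤ M i) → U.Nonempty → V.Nonempty →
      (∀ x ∈ U, ∀ i, |x i| ≤ M i) → (∀ x ∈ V, ∀ i, |x i| ≤ M i) → 0 ≤ α → 0 ≤ γ →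
      α ^ (m + 1) ≤ U.card → γ ^ (m + 1) ≤ V.card →
      (α + γ) ^ (m + 1) - c * (∏ i, (2 * (M i : ℝ) + 1)) / L ≤ (U + V).card := by
  induction m with
  | zero =>
    refine ⟨1, zero_le_one, ?_⟩
    intro U V M L α γ hL hM hU hV hUM hVM hα hγ hαU hγV
    have h1 := cauchy_davenport_of_isAddTorsionFree hU hV
    have h2 : (U.card : ℝ) + V.card ≤ (U + V).card + 1 := by
      have : U.card + V.card ≤ (U + V).card + 1 := by omega
      exact_mod_cast this
    have h3 : 1 ≤ 1 * (∏ i, (2 * (M i : ℝ) + 1)) / L := by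
      rw [le_div_iff₀ (by exact_mod_cast hL)]
      simp
      have : (L : ℝ) ≤ M 0 := by exact_mod_cast hM 0
      linarith [Nat.cast_nonneg (α := ℝ) (M 0)]
    simp only [zero_add, pow_one] at hαU hγV ⊢
    linarith
  | succ m ih =>
    obtain ⟨c, hc0, ih⟩ := ih
    refine ⟨2 * c + 2 ^ (m + 1), by positivity, ?_⟩
    intro U V M L x y hL hM hU hV hUM hVM hx hy hxU hyV
    set S := U.image (fun x => x 0) with hS
    set T := V.image (fun x => x 0) with hT
    have hLR : (0 : ℝ) < L := by exact_mod_cast hL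
    set Pr := ∏ i : Fin (m + 1), (2 * (M i.succ : ℝ) + 1) with hPi
    have hPi0 : 0 < Pr := Finset.prod_pos fun i _ => by positivity
    have hprod : ∏ i, (2 * (M i : ℝ) + 1) = (2 * (M 0 : ℝ) + 1) * Pr := Fin.prod_univ_succ _
    rw [hprod]
    set rt : ℕ → ℝ := fun n => (n : ℝ) ^ ((m + 1 : ℕ) : ℝ)⁻¹ with hrt
    have hrt0 : ∀ n, 0 ≤ rt n := fun n => by positivity
    have hrtp : ∀ n, rt n ^ (m + 1) = n := fun n =>
      Real.rpow_inv_natCast_pow (Nat.cast_nonneg n) (Nat.succ_ne_zero m)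
    set a : ℤ → ℝ := fun s => rt (firstSlice U s).card with ha
    set g : ℤ → ℝ := fun s => rt (firstSlice V s).card with hg
    have hslU : ∀ s ∈ S, (firstSlice U s).Nonempty := by
      intro s hs
      obtain ⟨x, hx, rfl⟩ := Finset.mem_image.1 hs
      exact ⟨Fin.tail x, mem_firstSlice.2 (by rwa [Fin.cons_self_tail])⟩
    have hslV : ∀ s ∈ T, (firstSlice V s).Nonempty := by
      intro s hs
      obtain ⟨x, hx, rfl⟩ := Finset.mem_image.1 hs
      exact ⟨Fin.tail x, mem_firstSlice.2 (by rwa [Fin.cons_self_tail])⟩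
    have hboxU : ∀ s, ∀ y ∈ firstSlice U s, ∀ i, |y i| ≤ M (Fin.succ i) := by
      intro s y hy i
      simpa using hUM _ (mem_firstSlice.1 hy) i.succ
    have hboxV : ∀ s, ∀ y ∈ firstSlice V s, ∀ i, |y i| ≤ M (Fin.succ i) := by
      intro s y hy i
      simpa using hVM _ (mem_firstSlice.1 hy) i.succ
    have hapos : ∀ s ∈ S, 0 < a s := fun s hs =>
      Real.rpow_pos_of_pos (by exact_mod_cast Finset.card_pos.2 (hslU s hs)) _
    have hgpos : ∀ s ∈ T, 0 < g s := fun s hs =>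
      Real.rpow_pos_of_pos (by exact_mod_cast Finset.card_pos.2 (hslV s hs)) _
    set e : ℝ := c * Pr / L with he
    have he0 : 0 ≤ e := by positivity
    set b : ℤ → ℝ := fun r => ((((firstSlice (U + V) r).card : ℝ) + e)) ^ ((m + 1 : ℕ) : ℝ)⁻¹ with hb
    have hb0 : ∀ r, 0 ≤ b r := fun r => by positivity
    have hbp : ∀ r, b r ^ (m + 1) = (firstSlice (U + V) r).card + e := fun r =>
      Real.rpow_inv_natCast_pow (by positivity) (Nat.succ_ne_zero m)
    have hbag : ∀ s ∈ S, ∀ t ∈ T, a s + g t ≤ b (s + t) := by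
      intro s hs t ht
      have h1 := ih (firstSlice U s) (firstSlice V t) (fun i => M i.succ) L (a s) (g t) hL
        (fun i => hM _) (hslU s hs) (hslV t ht) (hboxU s) (hboxV t) (hrt0 _) (hrt0 _)
        (hrtp _).le (hrtp _).le
      have h2 : firstSlice U s + firstSlice V t ⊆ firstSlice (U + V) (s + t) := by
        intro z hz
        obtain ⟨p, hp, q, hq, rfl⟩ := Finset.mem_add.1 hz
        rw [mem_firstSlice] at hp hq ⊢
        have := Finset.add_mem_add hp hq
        convert this using 1
        ext i
        refine Fin.cases ?_ (fun j => ?_) i <;> simp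
      have h3 : ((firstSlice U s + firstSlice V t).card : ℝ) ≤ (firstSlice (U + V) (s + t)).card := by
        exact_mod_cast Finset.card_le_card h2
      refine le_of_pow_le_pow_left₀ (Nat.succ_ne_zero m) (hb0 _) ?_
      rw [hbp, Nat.succ_eq_add_one]
      rw [← hPi, ← he] at h1
      linarith
    obtain ⟨s₀, hs₀, has⟩ := S.exists_max_image a (hU.image _)
    obtain ⟨t₀, ht₀, hgt⟩ := T.exists_max_image g (hV.image _)
    have h1 := sum_pow_supConv_ge (Nat.succ_ne_zero m) (fun s hs => (hapos s hs).le)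
      (fun s hs => (hgpos s hs).le) hbag hs₀ ht₀ has hgt (hapos s₀ hs₀) (hgpos t₀ ht₀)
    have hsumU : ∑ s ∈ S, (a s / a s₀) ^ (m + 1) = U.card / a s₀ ^ (m + 1) := by
      simp only [div_pow]
      rw [← Finset.sum_div, ← sum_card_firstSlice U, Nat.cast_sum]
      congr 1
      exact Finset.sum_congr rfl fun s _ => hrtp _
    have hsumV : ∑ s ∈ T, (g s / g t₀) ^ (m + 1) = V.card / g t₀ ^ (m + 1) := by
      simp only [div_pow]
      rw [← Finset.sum_div, ← sum_card_firstSlice V, Nat.cast_sum]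
      congr 1
      exact Finset.sum_congr rfl fun s _ => hrtp _
    have hST : (U + V).image (fun x => x 0) = S + T := by
      ext r
      simp only [hS, hT, Finset.mem_image, Finset.mem_add]
      constructor
      · rintro ⟨z, ⟨p, hp, q, hq, rfl⟩, rfl⟩
        exact ⟨p 0, ⟨p, hp, rfl⟩, q 0, ⟨q, hq, rfl⟩, rfl⟩
      · rintro ⟨_, ⟨p, hp, rfl⟩, _, ⟨q, hq, rfl⟩, rfl⟩
        exact ⟨p + q, ⟨p, hp, q, hq, rfl⟩, rfl⟩
    have hsumb : ∑ r ∈ S + T, b r ^ (m + 1) = (U + V).card + (S + T).card * e := by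
      rw [Finset.sum_congr rfl fun r _ => hbp r, Finset.sum_add_distrib, Finset.sum_const,
        nsmul_eq_mul, ← hST, ← sum_card_firstSlice (U + V), Nat.cast_sum]
    have hcardST : ((S + T).card : ℝ) ≤ 2 * (2 * (M 0 : ℝ) + 1) := by
      have h2 : S + T ⊆ Finset.Icc (-(2 * M 0 : ℤ)) (2 * M 0) := by
        intro r hr
        obtain ⟨s, hs, t, ht, rfl⟩ := Finset.mem_add.1 hr
        obtain ⟨p, hp, rfl⟩ := Finset.mem_image.1 hs
        obtain ⟨q, hq, rfl⟩ := Finset.mem_image.1 ht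
        have h3 := abs_le.1 (hUM p hp 0)
        have h4 := abs_le.1 (hVM q hq 0)
        rw [Finset.mem_Icc]
        constructor <;> linarith
      have h3 := Finset.card_le_card h2
      rw [Int.card_Icc] at h3
      have h4 : (S + T).card ≤ 4 * M 0 + 1 := by omega
      have h5 : ((S + T).card : ℝ) ≤ 4 * M 0 + 1 := by exact_mod_cast h4
      linarith
    have haPr : a s₀ ^ (m + 1) ≤ Pr := by
      exact (hrtp _).le.trans (card_le_prod_of_box _ (fun i : Fin (m + 1) => M i.succ) (hboxU s₀))
    have hgPr : g t₀ ^ (m + 1) ≤ Pr := by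
      exact (hrtp _).le.trans (card_le_prod_of_box _ (fun i : Fin (m + 1) => M i.succ) (hboxV t₀))
    have hagPr : (a s₀ + g t₀) ^ (m + 1) ≤ 2 ^ (m + 1) * Pr := by
      rcases le_total (a s₀) (g t₀) with h | h
      · calc (a s₀ + g t₀) ^ (m + 1) ≤ (2 * g t₀) ^ (m + 1) :=
              pow_le_pow_left₀ (add_nonneg (hrt0 _) (hrt0 _)) (by linarith) _
          _ = 2 ^ (m + 1) * g t₀ ^ (m + 1) := mul_pow _ _ _
          _ ≤ _ := by gcongr
      · calc (a s₀ + g t₀) ^ (m + 1) ≤ (2 * a s₀) ^ (m + 1) :=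
              pow_le_pow_left₀ (add_nonneg (hrt0 _) (hrt0 _)) (by linarith) _
          _ = 2 ^ (m + 1) * a s₀ ^ (m + 1) := mul_pow _ _ _
          _ ≤ _ := by gcongr
    have hrad := radon_ineq (m := m + 1) hx hy (hapos s₀ hs₀) (hgpos t₀ ht₀)
    have hmono : x ^ (m + 1 + 1) / a s₀ ^ (m + 1) + y ^ (m + 1 + 1) / g t₀ ^ (m + 1) ≤
        U.card / a s₀ ^ (m + 1) + V.card / g t₀ ^ (m + 1) := by
      have h3 := hapos s₀ hs₀
      have h4 := hgpos t₀ ht₀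
      gcongr
    have hpos : 0 ≤ (a s₀ + g t₀) ^ (m + 1) := pow_nonneg (add_nonneg (hrt0 _) (hrt0 _)) _
    have h2 := mul_le_mul_of_nonneg_left hmono hpos
    rw [hsumU, hsumV, hsumb] at h1
    simp only [Nat.succ_eq_add_one] at h1
    have h3 : (S + T).card * e ≤ 2 * c * ((2 * (M 0 : ℝ) + 1) * Pr) / L := by
      refine (mul_le_mul_of_nonneg_right hcardST he0).trans (le_of_eq ?_)
      rw [he]; ring
    have h4 : (2 : ℝ) ^ (m + 1) * Pr ≤ 2 ^ (m + 1) * ((2 * (M 0 : ℝ) + 1) * Pr) / L := by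
      rw [le_div_iff₀ hLR]
      have : (L : ℝ) ≤ M 0 := by exact_mod_cast hM 0
      have h5 : (L : ℝ) ≤ 2 * M 0 + 1 := by linarith
      have h6 : 0 ≤ (2 : ℝ) ^ (m + 1) * Pr := by positivity
      nlinarith
    have h5 : (2 * c + 2 ^ (m + 1)) * ((2 * (M 0 : ℝ) + 1) * Pr) / L =
        2 * c * ((2 * (M 0 : ℝ) + 1) * Pr) / L + 2 ^ (m + 1) * ((2 * (M 0 : ℝ) + 1) * Pr) / L := by
      ring
    rw [h5]
    linarith

/-! ### Sumset growth -/

section Growth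

variable {G : Type*} [AddCommGroup G] [DecidableEq G]

lemma exists_coeff_of_mem_nsmul (X : Finset G) (n : ℕ) :
    ∀ y ∈ n • X, ∃ c : G → ℕ, (∀ x, c x ≤ n) ∧ y = ∑ x ∈ X, c x • x := by
  induction n with
  | zero =>
    intro y hy
    refine ⟨fun _ => 0, fun _ => le_rfl, ?_⟩
    simpa using hy
  | succ n ih =>
    intro y hy
    rw [succ_nsmul, Finset.mem_add] at hy
    obtain ⟨z, hz, x, hx, rfl⟩ := hy
    obtain ⟨c, hc, rfl⟩ := ih z hz
    refine ⟨fun w => c w + if w = x then 1 else 0, fun w => ?_, ?_⟩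
    · have := hc w
      dsimp only
      split_ifs <;> omega
    · simp [add_smul, Finset.sum_add_distrib, ite_smul, hx]

lemma card_nsmul_le_pow (X : Finset G) (n : ℕ) : (n • X).card ≤ (n + 1) ^ X.card := by
  have : n • X ⊆ (Finset.univ : Finset (X → Fin (n + 1))).image
      fun c => ∑ x : X, (c x : ℕ) • (x : G) := by
    intro y hy
    obtain ⟨c, hc, rfl⟩ := exists_coeff_of_mem_nsmul X n y hy
    refine Finset.mem_image.2 ⟨fun x => ⟨c x, Nat.lt_succ_of_le (hc x)⟩, Finset.mem_univ _, ?_⟩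
    exact Finset.sum_coe_sort X (fun x => c x • x)
  refine (Finset.card_le_card this).trans (Finset.card_image_le.trans ?_)
  simp

lemma nsmul_succ_subset_of_two_nsmul_subset {A X : Finset G} (h : 2 • A ⊆ X + A) (n : ℕ) :
    (n + 1) • A ⊆ n • X + A := by
  induction n with
  | zero => simp
  | succ n ih =>
    calc (n + 1 + 1) • A = (n + 1) • A + A := succ_nsmul _ _
      _ ⊆ n • X + A + A := Finset.add_subset_add_right ih
      _ = n • X + 2 • A := by rw [add_assoc, two_nsmul]
      _ ⊆ n • X + (X + A) := Finset.add_subset_add_left h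
      _ = (n + 1) • X + A := by rw [← add_assoc, succ_nsmul]

lemma card_nsmul_mono {A : Finset G} (h0 : (0 : G) ∈ A) {m n : ℕ} (h : m ≤ n) :
    (m • A).card ≤ (n • A).card :=
  Finset.card_le_card (Finset.nsmul_subset_nsmul_right h0 h)

lemma exists_covering_of_small_doubling {K : ℕ} {S : Finset G} (hS : S.Nonempty)
    (hK : (S + S).card ≤ K * S.card) :
    ∃ X : Finset G, X.card ≤ K ^ 5 ∧ 2 • (S - S) ⊆ X + (S - S) := by
  have h1 := Finset.pluennecke_ruzsa_inequality_nsmul_sub_nsmul_add hS S 3 2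
  have hpos : (0 : ℚ≥0) < S.card := by exact_mod_cast hS.card_pos
  have h2 : ((S + S).card / S.card : ℚ≥0) ≤ K := by
    rw [div_le_iff₀ hpos]; exact_mod_cast hK
  have h3 : ((3 • S - 2 • S).card : ℚ≥0) ≤ (K : ℚ≥0) ^ 5 * S.card :=
    h1.trans (by gcongr)
  have h4 : (3 • S - 2 • S).card ≤ K ^ 5 * S.card := by exact_mod_cast h3
  have e : 2 • (S - S) + S = 3 • S - 2 • S := by
    rw [nsmul_sub, sub_add_eq_add_sub, ← succ_nsmul]
  obtain ⟨F, -, hF, hc⟩ := Finset.ruzsa_covering_add (A := 2 • (S - S)) (B := S)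
    (K := ((K ^ 5 : ℕ) : ℝ)) hS (by rw [e]; exact_mod_cast h4)
  exact ⟨F, by exact_mod_cast hF, hc⟩

lemma exists_stable_multiple (r : ℕ) {ν : ℝ} (hν : 0 < ν) :
    ∃ J : ℕ, ∀ {G : Type} [AddCommGroup G] [DecidableEq G] (A X : Finset G), (0 : G) ∈ A →
      X.card ≤ r → 2 • A ⊆ X + A →
      ∃ j, 1 ≤ j ∧ j ≤ J ∧ (((j + 1) • A).card : ℝ) ≤ (1 + ν) * (j • A).card ∧
        ((2 * j) • A).card ≤ 16 ^ r * (j • A).card := by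
  obtain ⟨n0, hn0⟩ := pow_unbounded_of_one_lt ((16 : ℝ) ^ r) (by linarith : 1 < 1 + ν)
  refine ⟨2 * 4 ^ (2 * (n0 + 1)), ?_⟩
  intro G _ _ A X h0 hX hA
  have hA0 : ∀ n, 0 < (n • A).card := fun n =>
    Finset.card_pos.2 (Finset.Nonempty.nsmul ⟨0, h0⟩)
  have hgrow : ∀ n, 1 ≤ n → (n • A).card ≤ n ^ r * A.card := by
    intro n hn
    obtain ⟨n, rfl⟩ := Nat.exists_eq_add_of_le' hn
    calc ((n + 1) • A).card ≤ (n • X + A).card :=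
          Finset.card_le_card (nsmul_succ_subset_of_two_nsmul_subset hA n)
      _ ≤ (n • X).card * A.card := Finset.card_add_le
      _ ≤ (n + 1) ^ X.card * A.card := by gcongr; exact card_nsmul_le_pow X n
      _ ≤ (n + 1) ^ r * A.card := by gcongr
  have hi : ∃ i, n0 + 1 ≤ i ∧ i < 2 * (n0 + 1) ∧
      ((4 ^ (i + 1)) • A).card ≤ 16 ^ r * ((4 ^ i) • A).card := by
    by_contra! hcon
    have key : ∀ s, 1 ≤ s → s ≤ n0 + 1 → (16 ^ r) ^ s * ((4 ^ (n0 + 1)) • A).card <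
        ((4 ^ (n0 + 1 + s)) • A).card := by
      intro s hs
      induction s, hs using Nat.le_induction with
      | base => intro _; simpa using hcon (n0 + 1) le_rfl (by omega)
      | succ s hs ih =>
        intro hs'
        calc (16 ^ r) ^ (s + 1) * ((4 ^ (n0 + 1)) • A).card
            = 16 ^ r * ((16 ^ r) ^ s * ((4 ^ (n0 + 1)) • A).card) := by ring
          _ ≤ 16 ^ r * ((4 ^ (n0 + 1 + s)) • A).card := by
              gcongr; exact (ih (by omega)).le
          _ < _ := hcon _ (by omega) (by omega)
    have h1 := key (n0 + 1) (by omega) le_rfl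
    have h2 := hgrow (4 ^ (n0 + 1 + (n0 + 1))) (Nat.one_le_pow _ _ (by norm_num))
    have h3 : A.card ≤ ((4 ^ (n0 + 1)) • A).card := by
      simpa using card_nsmul_mono h0 (Nat.one_le_pow (n0 + 1) 4 (by norm_num))
    have h4 : (4 ^ (n0 + 1 + (n0 + 1))) ^ r = (16 ^ r) ^ (n0 + 1) := by
      rw [show (16 : ℕ) = 4 ^ 2 by norm_num, ← pow_mul, ← pow_mul, ← pow_mul]
      ring_nf
    rw [h4] at h2
    have := Nat.mul_le_mul_left ((16 ^ r) ^ (n0 + 1)) h3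
    omega
  obtain ⟨i, hi1, hi2, hi3⟩ := hi
  have hj : ∃ j, 4 ^ i ≤ j ∧ j < 2 * 4 ^ i ∧
      (((j + 1) • A).card : ℝ) ≤ (1 + ν) * (j • A).card := by
    by_contra! hcon
    have key : ∀ s, s ≤ 4 ^ i → (1 + ν) ^ s * ((4 ^ i) • A).card ≤
        (((4 ^ i + s) • A).card : ℝ) := by
      intro s
      induction s with
      | zero => intro _; simp
      | succ s ih =>
        intro hs'
        calc (1 + ν) ^ (s + 1) * ((4 ^ i) • A).card
            = (1 + ν) * ((1 + ν) ^ s * ((4 ^ i) • A).card) := by ring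
          _ ≤ (1 + ν) * ((4 ^ i + s) • A).card := by
              gcongr; exact ih (by omega)
          _ ≤ _ := (hcon _ (by omega) (by omega)).le
    have h1 := key (4 ^ i) le_rfl
    have h2 : (16 : ℝ) ^ r < (1 + ν) ^ (4 ^ i) := by
      refine hn0.trans_le (pow_le_pow_right₀ (by linarith) ?_)
      have := Nat.lt_pow_self (n := i) (by norm_num : 1 < 4)
      omega
    have h3 : ((4 ^ i + 4 ^ i) • A).card ≤ ((4 ^ (i + 1)) • A).card :=
      card_nsmul_mono h0 (by rw [pow_succ]; omega)
    have h4 : (((4 ^ i + 4 ^ i) • A).card : ℝ) ≤ 16 ^ r * ((4 ^ i) • A).card := by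
      exact_mod_cast h3.trans hi3
    have h5 : (0 : ℝ) < ((4 ^ i) • A).card := by exact_mod_cast hA0 _
    have := mul_lt_mul_of_pos_right h2 h5
    linarith
  obtain ⟨j, hj1, hj2, hj3⟩ := hj
  refine ⟨j, (Nat.one_le_pow _ _ (by norm_num)).trans hj1, ?_, hj3, ?_⟩
  · refine hj2.le.trans ?_
    gcongr
    · norm_num
  · calc ((2 * j) • A).card ≤ ((4 ^ (i + 1)) • A).card :=
          card_nsmul_mono h0 (by rw [pow_succ]; omega)
      _ ≤ 16 ^ r * ((4 ^ i) • A).card := hi3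
      _ ≤ _ := Nat.mul_le_mul_left _ (card_nsmul_mono h0 hj1)

end Growth

/-! ### Bogolyubov's argument -/

section Bogolyubov

variable {G : Type*} [AddCommGroup G] [Fintype G] [DecidableEq G]

noncomputable def charSum (B : Finset G) (ψ : AddChar G ℂ) : ℂ := ∑ b ∈ B, ψ b

lemma norm_charSum_le (B : Finset G) (ψ : AddChar G ℂ) : ‖charSum B ψ‖ ≤ B.card := by
  refine (norm_sum_le _ _).trans ?_
  simp [AddChar.norm_apply]

lemma sum_addChar_sum {ι : Type*} (s : Finset ι) (f : ι → G) :
    ∑ ψ : AddChar G ℂ, ∑ i ∈ s, ψ (f i) =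
      (Fintype.card G : ℂ) * (s.filter fun i => f i = 0).card := by
  rw [Finset.sum_comm]
  simp_rw [AddChar.sum_apply_eq_ite]
  rw [← Finset.sum_filter]
  simp [mul_comm]

lemma charSum_mul_conj (B : Finset G) (ψ : AddChar G ℂ) :
    ((‖charSum B ψ‖ ^ 2 : ℝ) : ℂ) = ∑ p ∈ B ×ˢ B, ψ (p.1 - p.2) := by
  rw [Complex.ofReal_pow, ← Complex.mul_conj', charSum, map_sum, Finset.sum_mul_sum,
    Finset.sum_product]
  simp [sub_eq_add_neg, AddChar.map_add_eq_mul, AddChar.map_neg_eq_conj]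

lemma sum_norm_charSum_sq (B : Finset G) :
    ∑ ψ : AddChar G ℂ, ‖charSum B ψ‖ ^ 2 = Fintype.card G * B.card := by
  have h : ((∑ ψ : AddChar G ℂ, ‖charSum B ψ‖ ^ 2 : ℝ) : ℂ) = Fintype.card G * B.card := by
    rw [Complex.ofReal_sum]
    simp_rw [charSum_mul_conj]
    rw [sum_addChar_sum]
    congr 2
    have : (B ×ˢ B).filter (fun p => p.1 - p.2 = 0) = B.diag := by
      ext ⟨a, b⟩
      simp [sub_eq_zero, Finset.mem_diag]
      aesop
    rw [this, Finset.diag_card]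
  exact_mod_cast h

lemma sum_norm_charSum_pow_four_mul (B : Finset G) (x : G) :
    ∑ ψ : AddChar G ℂ, ((‖charSum B ψ‖ ^ 4 : ℝ) : ℂ) * ψ (-x) = Fintype.card G *
      (((B ×ˢ B) ×ˢ (B ×ˢ B)).filter
        fun p => (p.1.1 - p.1.2) + (p.2.1 - p.2.2) + -x = 0).card := by
  rw [← sum_addChar_sum]
  refine Finset.sum_congr rfl fun ψ _ => ?_
  have : ((‖charSum B ψ‖ ^ 4 : ℝ) : ℂ) =
      ((‖charSum B ψ‖ ^ 2 : ℝ) : ℂ) * ((‖charSum B ψ‖ ^ 2 : ℝ) : ℂ) := by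
    push_cast; ring
  rw [this, charSum_mul_conj, Finset.sum_mul_sum, Finset.sum_product (B ×ˢ B), Finset.sum_mul]
  simp_rw [Finset.sum_mul, ← AddChar.map_add_eq_mul]

lemma le_sum_norm_charSum_pow_four {κ : ℝ} {B : Finset G} (hB : B.Nonempty)
    (h : ((B + B).card : ℝ) ≤ κ * B.card) :
    (Fintype.card G : ℝ) * B.card ^ 3 ≤ κ * ∑ ψ : AddChar G ℂ, ‖charSum B ψ‖ ^ 4 := by
  have h1 := sum_norm_charSum_pow_four_mul B 0
  simp only [neg_zero, AddChar.map_zero_eq_one, mul_one, add_zero] at h1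
  have h2 : ∑ ψ : AddChar G ℂ, ‖charSum B ψ‖ ^ 4 = (Fintype.card G : ℝ) *
      (((B ×ˢ B) ×ˢ (B ×ˢ B)).filter
        fun p => (p.1.1 - p.1.2) + (p.2.1 - p.2.2) = 0).card := by
    exact_mod_cast h1
  have h3 : (((B ×ˢ B) ×ˢ (B ×ˢ B)).filter
        fun p => (p.1.1 - p.1.2) + (p.2.1 - p.2.2) = 0) =
      (((B ×ˢ B) ×ˢ (B ×ˢ B)).filter fun p => p.1.1 + p.2.1 = p.1.2 + p.2.2) := by
    refine Finset.filter_congr fun p _ => ?_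
    rw [← sub_eq_zero (a := p.1.1 + p.2.1)]
    constructor <;> intro h <;> rw [← h] <;> abel
  have h4 := Finset.le_card_add_mul_addEnergy B B
  rw [Finset.addEnergy, ← h3] at h4
  rw [h2]
  set e := (((B ×ˢ B) ×ˢ (B ×ˢ B)).filter
        fun p => (p.1.1 - p.1.2) + (p.2.1 - p.2.2) = 0).card
  have h4' : (B.card : ℝ) ^ 2 * B.card ^ 2 ≤ (B + B).card * e := by exact_mod_cast h4
  have hb : (0 : ℝ) < B.card := by exact_mod_cast hB.card_pos
  have h5 : (B.card : ℝ) ^ 3 * B.card ≤ κ * e * B.card := by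
    calc (B.card : ℝ) ^ 3 * B.card = (B.card : ℝ) ^ 2 * B.card ^ 2 := by ring
      _ ≤ ((B + B).card : ℝ) * e := h4'
      _ ≤ κ * B.card * e := by gcongr
      _ = _ := by ring
  have h6 := le_of_mul_le_mul_right h5 hb
  calc (Fintype.card G : ℝ) * B.card ^ 3 ≤ Fintype.card G * (κ * e) := by gcongr
    _ = _ := by ring

lemma mem_of_forall_large_charSum {κ τ : ℝ} (hκ : 0 < κ) (hτ : 4 * κ * τ ^ 2 = 1) (hτ0 : 0 < τ)
    {B : Finset G} (hB : B.Nonempty) (h : ((B + B).card : ℝ) ≤ κ * B.card) {x : G}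
    (hx : ∀ ψ : AddChar G ℂ, τ * B.card ≤ ‖charSum B ψ‖ → ‖ψ x - 1‖ ≤ 1 / 2) :
    x ∈ 2 • B - 2 • B := by
  by_contra hcon
  have h0 : (((B ×ˢ B) ×ˢ (B ×ˢ B)).filter
        fun p => (p.1.1 - p.1.2) + (p.2.1 - p.2.2) + -x = 0) = ∅ := by
    refine Finset.filter_eq_empty_iff.2 fun p hp hp' => hcon ?_
    simp only [Finset.mem_product] at hp
    rw [two_nsmul]
    have : x = (p.1.1 + p.2.1) - (p.1.2 + p.2.2) := by
      rw [← sub_eq_zero, ← neg_eq_zero, ← hp']; abel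
    rw [this]
    exact Finset.sub_mem_sub (Finset.add_mem_add hp.1.1 hp.2.1) (Finset.add_mem_add hp.1.2 hp.2.2)
  have h1 := sum_norm_charSum_pow_four_mul B x
  rw [h0] at h1
  have h2 : ∑ ψ : AddChar G ℂ, ‖charSum B ψ‖ ^ 4 * (ψ (-x)).re = 0 := by
    have := congrArg Complex.re h1
    simpa [Complex.re_sum, ← Complex.ofReal_pow, Complex.re_ofReal_mul] using this
  have hb : (0 : ℝ) < B.card := by exact_mod_cast hB.card_pos
  have hpt : ∀ ψ : AddChar G ℂ, ‖charSum B ψ‖ ^ 4 * (1 / 2) -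
      (3 / 2) * τ ^ 2 * B.card ^ 2 * ‖charSum B ψ‖ ^ 2 ≤ ‖charSum B ψ‖ ^ 4 * (ψ (-x)).re := by
    intro ψ
    by_cases hψ : τ * B.card ≤ ‖charSum B ψ‖
    · have h3 := hx ψ hψ
      have h4 : 1 / 2 ≤ (ψ (-x)).re := by
        rw [AddChar.map_neg_eq_conj, Complex.conj_re]
        have := (abs_le.1 ((Complex.abs_re_le_norm (ψ x - 1)).trans h3)).1
        simp at this
        linarith
      have : 0 ≤ ‖charSum B ψ‖ ^ 4 := by positivity
      have : 0 ≤ (3 / 2) * τ ^ 2 * B.card ^ 2 * ‖charSum B ψ‖ ^ 2 := by positivity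
      nlinarith
    · push Not at hψ
      have h4 : -1 ≤ (ψ (-x)).re := by
        have := (abs_le.1 ((Complex.abs_re_le_norm (ψ (-x))))).1
        rwa [AddChar.norm_apply] at this
      have h5 : ‖charSum B ψ‖ ^ 2 ≤ τ ^ 2 * B.card ^ 2 := by
        rw [← mul_pow]; gcongr
      have h6 : ‖charSum B ψ‖ ^ 4 ≤ τ ^ 2 * B.card ^ 2 * ‖charSum B ψ‖ ^ 2 := by
        have : ‖charSum B ψ‖ ^ 4 = ‖charSum B ψ‖ ^ 2 * ‖charSum B ψ‖ ^ 2 := by ring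
        rw [this]; gcongr
      have : 0 ≤ ‖charSum B ψ‖ ^ 4 := by positivity
      nlinarith
  have h3 := Finset.sum_le_sum fun ψ (_ : ψ ∈ (Finset.univ : Finset (AddChar G ℂ))) => hpt ψ
  rw [h2, Finset.sum_sub_distrib, ← Finset.sum_mul, ← Finset.mul_sum, sum_norm_charSum_sq] at h3
  have h4 := le_sum_norm_charSum_pow_four hB h
  have hg : (0 : ℝ) < Fintype.card G := by exact_mod_cast Fintype.card_pos
  set E := ∑ ψ : AddChar G ℂ, ‖charSum B ψ‖ ^ 4
  have h5 : E ≤ 3 * τ ^ 2 * (Fintype.card G * B.card ^ 3) := by nlinarith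
  have h6 : κ * E ≤ κ * (3 * τ ^ 2 * (Fintype.card G * B.card ^ 3)) := by gcongr
  have h7 : 0 < (Fintype.card G : ℝ) * B.card ^ 3 := by positivity
  have h8 : κ * (3 * τ ^ 2 * (Fintype.card G * B.card ^ 3)) =
    3 / 4 * ((4 * κ * τ ^ 2) * (Fintype.card G * B.card ^ 3)) := by ring
  rw [h8, hτ] at h6
  linarith

lemma card_le_of_almost_orthogonal {τ : ℝ} (hτ : 0 < τ) {B : Finset G} (hB : B.Nonempty)
    (Ψ : Finset (AddChar G ℂ)) (hΨ : ∀ ψ ∈ Ψ, τ * B.card ≤ ‖charSum B ψ‖)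
    (hΨ' : ∀ ψ ∈ Ψ, ∀ ψ' ∈ Ψ, ψ ≠ ψ' → ‖charSum B (ψ - ψ')‖ ≤ τ ^ 2 / 2 * B.card) :
    (Ψ.card : ℝ) ≤ 2 / τ ^ 2 := by
  classical
  have hb : (0 : ℝ) < B.card := by exact_mod_cast hB.card_pos
  choose c hc1 hc2 using fun ψ : AddChar G ℂ => Complex.exists_norm_mul_eq_self (charSum B ψ)
  let e : AddChar G ℂ → ℂ := fun ψ => (starRingEnd ℂ) (c ψ)
  have he : ∀ ψ, ‖e ψ‖ = 1 := fun ψ => by simp [e, hc1]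
  have hec : ∀ ψ, e ψ * charSum B ψ = ‖charSum B ψ‖ := by
    intro ψ
    have : e ψ * c ψ = 1 := by
      rw [mul_comm, Complex.mul_conj', hc1]; simp
    linear_combination (-e ψ) * hc2 ψ + (‖charSum B ψ‖ : ℂ) * this
  let F : G → ℂ := fun b => ∑ ψ ∈ Ψ, e ψ * ψ b
  have h1 : ((∑ ψ ∈ Ψ, ‖charSum B ψ‖ : ℝ) : ℂ) = ∑ b ∈ B, F b := by
    rw [Finset.sum_comm]
    push_cast
    refine Finset.sum_congr rfl fun ψ _ => ?_
    rw [← hec, charSum, Finset.mul_sum]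
  have h2 : (Ψ.card : ℝ) * (τ * B.card) ≤ ∑ b ∈ B, ‖F b‖ := by
    calc (Ψ.card : ℝ) * (τ * B.card) ≤ ∑ ψ ∈ Ψ, ‖charSum B ψ‖ := by
          rw [← nsmul_eq_mul]; exact Finset.card_nsmul_le_sum _ _ _ hΨ
      _ = ‖((∑ ψ ∈ Ψ, ‖charSum B ψ‖ : ℝ) : ℂ)‖ := by
          rw [Complex.norm_real, Real.norm_of_nonneg (by positivity)]
      _ ≤ _ := by rw [h1]; exact norm_sum_le _ _
  have h3 : (∑ b ∈ B, ‖F b‖) ^ 2 ≤ B.card * ∑ b ∈ B, ‖F b‖ ^ 2 := sq_sum_le_card_mul_sum_sq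
  have h4 : ((∑ b ∈ B, ‖F b‖ ^ 2 : ℝ) : ℂ) =
      ∑ ψ ∈ Ψ, ∑ ψ' ∈ Ψ, e ψ * c ψ' * charSum B (ψ - ψ') := by
    push_cast
    have : ∀ b, (‖F b‖ : ℂ) ^ 2 =
        ∑ ψ ∈ Ψ, ∑ ψ' ∈ Ψ, e ψ * c ψ' * (ψ - ψ') b := by
      intro b
      rw [← Complex.mul_conj', map_sum, Finset.sum_mul_sum]
      refine Finset.sum_congr rfl fun ψ _ => Finset.sum_congr rfl fun ψ' _ => ?_
      simp [e, sub_eq_add_neg, AddChar.add_apply, AddChar.neg_apply, AddChar.map_neg_eq_conj]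
      ring
    simp_rw [this]
    rw [Finset.sum_comm]
    refine Finset.sum_congr rfl fun ψ _ => ?_
    rw [Finset.sum_comm]
    refine Finset.sum_congr rfl fun ψ' _ => ?_
    rw [charSum, Finset.mul_sum]
  have h5 : ∑ b ∈ B, ‖F b‖ ^ 2 ≤
      ∑ ψ ∈ Ψ, ∑ ψ' ∈ Ψ, ((if ψ = ψ' then (B.card : ℝ) else 0) + τ ^ 2 / 2 * B.card) := by
    have : ∑ b ∈ B, ‖F b‖ ^ 2 = ‖((∑ b ∈ B, ‖F b‖ ^ 2 : ℝ) : ℂ)‖ := by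
      rw [Complex.norm_real, Real.norm_of_nonneg (by positivity)]
    rw [this, h4]
    refine (norm_sum_le _ _).trans (Finset.sum_le_sum fun ψ hψ => (norm_sum_le _ _).trans
      (Finset.sum_le_sum fun ψ' hψ' => ?_))
    rw [norm_mul, norm_mul, he, hc1, one_mul, one_mul]
    split_ifs with hh
    · have := norm_charSum_le B (ψ - ψ')
      have : 0 ≤ τ ^ 2 / 2 * B.card := by positivity
      linarith
    · rw [zero_add]; exact hΨ' ψ hψ ψ' hψ' hh
  have h6 : ∑ ψ ∈ Ψ, ∑ ψ' ∈ Ψ, ((if ψ = ψ' then (B.card : ℝ) else 0) + τ ^ 2 / 2 * B.card) =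
      Ψ.card * B.card + Ψ.card ^ 2 * (τ ^ 2 / 2 * B.card) := by
    simp [Finset.sum_add_distrib]
    ring
  rw [h6] at h5
  have h7 : ((Ψ.card : ℝ) * (τ * B.card)) ^ 2 ≤
      B.card * (Ψ.card * B.card + Ψ.card ^ 2 * (τ ^ 2 / 2 * B.card)) :=
    (pow_le_pow_left₀ (by positivity) h2 2).trans (h3.trans (by gcongr))
  rw [le_div_iff₀ (by positivity)]
  by_contra! hcon
  have hn : (0 : ℝ) < Ψ.card := by
    by_contra! hh
    have : 0 ≤ τ ^ 2 := by positivity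
    nlinarith
  have h8 : (Ψ.card * B.card ^ 2 : ℝ) * (Ψ.card * τ ^ 2) ≤ (Ψ.card * B.card ^ 2 : ℝ) * 2 := by
    nlinarith
  have := le_of_mul_le_mul_left h8 (by positivity)
  linarith

lemma norm_charSum_mul_le {B A : Finset G} (h0 : (0 : G) ∈ A) {x : G} (hx : x ∈ A)
    (χ : AddChar G ℂ) :
    ‖charSum B χ‖ * ‖χ x - 1‖ ≤ 2 * (((B + A).card : ℝ) - B.card) := by
  have key : ∀ y ∈ A, ‖charSum (B + A) χ - charSum B χ * χ y‖ ≤ ((B + A).card : ℝ) - B.card := by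
    intro y hy
    have h1 : charSum B χ * χ y = ∑ b ∈ B.image (· + y), χ b := by
      rw [Finset.sum_image (fun _ _ _ _ h => by simpa using h), charSum, Finset.sum_mul]
      simp [AddChar.map_add_eq_mul]
    have hsub : B.image (· + y) ⊆ B + A := by
      intro z hz
      obtain ⟨b, hb, rfl⟩ := Finset.mem_image.1 hz
      exact Finset.add_mem_add hb hy
    rw [h1, charSum, ← Finset.sum_sdiff hsub, add_sub_cancel_right]
    refine (norm_sum_le _ _).trans ?_
    simp only [AddChar.norm_apply, Finset.sum_const, nsmul_eq_mul, mul_one]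
    rw [Finset.cast_card_sdiff hsub, Finset.card_image_of_injective _ (add_left_injective y)]
  have h1 := key 0 h0
  have h2 := key x hx
  rw [AddChar.map_zero_eq_one, mul_one] at h1
  rw [← norm_mul]
  have : charSum B χ * (χ x - 1) = (charSum (B + A) χ - charSum B χ) -
    (charSum (B + A) χ - charSum B χ * χ x) := by ring
  rw [this]
  refine (norm_sub_le _ _).trans ?_
  linarith

end Bogolyubov

/-! ### Pigeonholing and maximal separated sets -/

lemma exists_maximal_separated {α : Type*} [DecidableEq α] (R : α → α → Prop)
    (hR : ∀ a, R a a) (hs : ∀ a b, R a b → R b a) (s : Finset α) :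
    ∃ t ⊆ s, (∀ a ∈ t, ∀ b ∈ t, a ≠ b → ¬ R a b) ∧ ∀ a ∈ s, ∃ b ∈ t, R a b := by
  classical
  induction s using Finset.induction_on with
  | empty => exact ⟨∅, by simp, by simp, by simp⟩
  | insert x s hx ih =>
    obtain ⟨t, hts, h1, h2⟩ := ih
    by_cases h : ∃ b ∈ t, R x b
    · refine ⟨t, hts.trans (Finset.subset_insert _ _), h1, fun a ha => ?_⟩
      rcases Finset.mem_insert.1 ha with rfl | ha
      · exact h
      · exact h2 a ha
    · push Not at h
      refine ⟨insert x t, Finset.insert_subset_insert _ hts, ?_, ?_⟩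
      · intro a ha b hb hab
        rcases Finset.mem_insert.1 ha with ha' | ha'
        · rcases Finset.mem_insert.1 hb with hb' | hb'
          · exact absurd (ha'.trans hb'.symm) hab
          · exact ha' ▸ h b hb'
        · rcases Finset.mem_insert.1 hb with hb' | hb'
          · exact fun hh => h a ha' (hb' ▸ hs _ _ hh)
          · exact h1 a ha' b hb' hab
      · intro a ha
        rcases Finset.mem_insert.1 ha with rfl | ha
        · exact ⟨a, Finset.mem_insert_self _ _, hR a⟩
        · obtain ⟨b, hb, hab⟩ := h2 a ha
          exact ⟨b, Finset.mem_insert_of_mem hb, hab⟩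

lemma exists_grid_bound {δ : ℝ} (hδ : 0 < δ) : ∃ q : ℕ, 1 ≤ q ∧ ∀ {α ι : Type} [DecidableEq α]
    [Fintype ι] (t : Finset α) (f : α → ι → ℂ) (m : ℕ), (∀ a i, ‖f a i‖ ≤ 1) →
    (∀ u ⊆ t, (∀ a ∈ u, ∀ b ∈ u, ∀ i, ‖f a i - f b i‖ ≤ δ) → u.card ≤ m) →
    t.card ≤ m * q ^ Fintype.card ι := by
  classical
  have htb : TotallyBounded (Metric.closedBall (0 : ℂ) 1) :=
    (isCompact_closedBall _ _).totallyBounded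
  obtain ⟨s, hsf, hs⟩ := Metric.totallyBounded_iff.1 htb (δ / 2) (by positivity)
  lift s to Finset ℂ using hsf
  refine ⟨s.card + 1, by omega, ?_⟩
  intro α ι _ _ t f m hf hm
  have hc : ∀ a i, ∃ y : s, ‖f a i - y‖ < δ / 2 := by
    intro a i
    have := hs (show f a i ∈ Metric.closedBall (0 : ℂ) 1 by simpa using hf a i)
    simp only [mem_iUnion, Metric.mem_ball, dist_eq_norm] at this
    obtain ⟨y, hy, hy'⟩ := this
    exact ⟨⟨y, hy⟩, hy'⟩
  choose c hc using hc
  have h1 := Finset.card_le_mul_card_image (f := c) t m (by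
    intro b _
    refine hm _ (Finset.filter_subset _ _) ?_
    intro x hx y hy i
    have hx' := (Finset.mem_filter.1 hx).2
    have hy' := (Finset.mem_filter.1 hy).2
    have e : f x i - f y i = (f x i - c x i) - (f y i - c y i) := by rw [hx', hy']; ring
    rw [e]
    refine (norm_sub_le _ _).trans ?_
    linarith [hc x i, hc y i])
  refine h1.trans ?_
  gcongr
  refine (Finset.card_le_univ _).trans ?_
  rw [Fintype.card_fun, Fintype.card_coe]
  gcongr
  omega

lemma norm_addChar_add_sub_le {G : Type*} [AddCommGroup G] [Finite G] (ψ φ : AddChar G ℂ)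
    (a b : G) : ‖ψ (a + b) - φ (a + b)‖ ≤ ‖ψ a - φ a‖ + ‖ψ b - φ b‖ := by
  have : ψ (a + b) - φ (a + b) = (ψ a - φ a) * ψ b + φ a * (ψ b - φ b) := by
    rw [AddChar.map_add_eq_mul, AddChar.map_add_eq_mul]; ring
  rw [this]
  refine (norm_add_le _ _).trans ?_
  rw [norm_mul, norm_mul, AddChar.norm_apply, AddChar.norm_apply, one_mul, mul_one]

lemma norm_addChar_nsmul_sub_le {G : Type*} [AddCommGroup G] [Finite G] [DecidableEq G]
    (ψ φ : AddChar G ℂ) {X : Finset G} {δ : ℝ} (h : ∀ x ∈ X, ‖ψ x - φ x‖ ≤ δ) (n : ℕ) :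
    ∀ x ∈ n • X, ‖ψ x - φ x‖ ≤ n * δ := by
  induction n with
  | zero => intro x hx; simp at hx; simp [hx]
  | succ n ih =>
    intro x hx
    rw [succ_nsmul, Finset.mem_add] at hx
    obtain ⟨y, hy, z, hz, rfl⟩ := hx
    refine (norm_addChar_add_sub_le _ _ _ _).trans ?_
    push_cast
    linarith [ih y hy, h z hz]

set_option maxHeartbeats 1000000 in
lemma exists_bohr_of_small_doubling_finite (K : ℕ) : ∃ m J : ℕ, ∀ (G : Type) [AddCommGroup G]
    [Fintype G] [DecidableEq G] (S : Finset G), S.Nonempty → (S + S).card ≤ K * S.card →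
    ∃ j, 1 ≤ j ∧ j ≤ J ∧ ∃ n ≤ m, ∃ χ : Fin n → AddChar G ℂ,
      ∀ x ∈ (16 * j) • (S - S), (∀ i, ‖χ i x - 1‖ ≤ 1 / 8) → x ∈ (4 * j) • (S - S) := by
  classical
  set r := K ^ 5 with hr
  set κ : ℝ := 16 ^ r with hκ
  have hκ0 : 0 < κ := by positivity
  set τ : ℝ := 1 / (2 * √κ) with hτ
  have hτ0 : 0 < τ := by positivity
  have hsq : √κ ^ 2 = κ := Real.sq_sqrt hκ0.le
  have hτ1 : 4 * κ * τ ^ 2 = 1 := by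
    rw [hτ, div_pow, mul_pow, hsq]; field_simp; norm_num
  obtain ⟨J, hJ⟩ := exists_stable_multiple r (ν := 1 / (128 * κ)) (by positivity)
  set δ : ℝ := 1 / (128 * (J + 1)) with hδ
  have hδ0 : 0 < δ := by positivity
  obtain ⟨q, hq1, hq⟩ := exists_grid_bound hδ0
  refine ⟨⌊2 / τ ^ 2⌋₊ * q ^ r, J, ?_⟩
  intro G _ _ _ S hS hK
  obtain ⟨X, hX, hX2⟩ := exists_covering_of_small_doubling hS hK
  set A := S - S with hA
  have h0 : (0 : G) ∈ A := by
    obtain ⟨s, hs⟩ := hS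
    exact Finset.mem_sub.2 ⟨s, hs, s, hs, sub_self s⟩
  obtain ⟨j, hj1, hj2, hj3, hj4⟩ := hJ A X h0 hX hX2
  set B := j • A with hB
  have hBne : B.Nonempty := Finset.Nonempty.nsmul ⟨0, h0⟩
  have hb : (0 : ℝ) < B.card := by exact_mod_cast hBne.card_pos
  have hBB : ((B + B).card : ℝ) ≤ κ * B.card := by
    rw [hB, ← add_nsmul, ← two_mul, hκ]; exact_mod_cast hj4
  have hBA : ((B + A).card : ℝ) - B.card ≤ 1 / (128 * κ) * B.card := by
    rw [hB, ← succ_nsmul]; linarith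
  let Spec : Finset (AddChar G ℂ) := Finset.univ.filter fun ψ => τ * B.card ≤ ‖charSum B ψ‖
  obtain ⟨Ψ, hΨs, hΨ1, hΨ2⟩ := exists_maximal_separated
    (fun ψ φ : AddChar G ℂ => (∀ x ∈ A, ‖ψ x - φ x‖ ≤ 1 / 8) ∧ ∀ x ∈ X, ‖ψ x - φ x‖ ≤ δ)
    (fun ψ => by simp [hδ0.le]) (fun ψ φ h => by simpa only [norm_sub_rev] using h) Spec
  have hcard : Ψ.card ≤ ⌊2 / τ ^ 2⌋₊ * q ^ r := by
    have h1 := hq Ψ (fun ψ (x : X) => ψ x) ⌊2 / τ ^ 2⌋₊ (fun ψ x => (AddChar.norm_apply _ _).le) (by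
      intro u hu hcl
      refine Nat.le_floor (card_le_of_almost_orthogonal hτ0 hBne u ?_ ?_)
      · intro ψ hψ
        exact (Finset.mem_filter.1 (hΨs (hu hψ))).2
      · intro ψ hψ φ hφ hne
        have h2 := hΨ1 ψ (hu hψ) φ (hu hφ) hne
        have h3 : ∃ x ∈ A, 1 / 8 < ‖ψ x - φ x‖ := by
          by_contra! hcon
          exact h2 ⟨hcon, fun x hx => hcl ψ hψ φ hφ ⟨x, hx⟩⟩
        obtain ⟨x, hxA, hx⟩ := h3
        have h4 := norm_charSum_mul_le (B := B) h0 hxA (ψ - φ)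
        have h5 : ‖(ψ - φ) x - 1‖ = ‖ψ x - φ x‖ := by
          have : ψ x - φ x = ((ψ - φ) x - 1) * φ x := by
            rw [sub_mul, one_mul, ← AddChar.add_apply, sub_add_cancel]
          rw [this, norm_mul, AddChar.norm_apply, mul_one]
        rw [h5] at h4
        have h6 : ‖charSum B (ψ - φ)‖ * (1 / 8) ≤ 2 * (1 / (128 * κ) * B.card) :=
          (mul_le_mul_of_nonneg_left hx.le (norm_nonneg _)).trans (h4.trans (by linarith))
        have h7 : τ ^ 2 = 1 / (4 * κ) := by field_simp; linarith
        rw [h7]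
        have h8 : 1 / (4 * κ) / 2 * B.card = 8 * (2 * (1 / (128 * κ) * B.card)) := by
          field_simp; norm_num
        rw [h8]; linarith)
    refine h1.trans ?_
    rw [Fintype.card_coe]
    gcongr
  refine ⟨j, hj1, hj2, Ψ.card, hcard, fun i => (Ψ.equivFin.symm i : AddChar G ℂ), ?_⟩
  intro x hx hχ
  have hA' : -A = A := by rw [hA, neg_sub]
  have h4 : 2 • B - 2 • B = (4 * j) • A := by
    rw [sub_eq_add_neg, hB, ← neg_nsmul, ← neg_nsmul, hA', ← add_nsmul, ← mul_nsmul']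
  rw [← h4]
  refine mem_of_forall_large_charSum hκ0 hτ1 hτ0 hBne hBB ?_
  intro ψ hψ
  obtain ⟨φ, hφ, hcl1, hcl2⟩ := hΨ2 ψ (Finset.mem_filter.2 ⟨Finset.mem_univ _, hψ⟩)
  have h5 : ‖φ x - 1‖ ≤ 1 / 8 := by simpa using hχ (Ψ.equivFin ⟨φ, hφ⟩)
  have h6 : x ∈ (16 * j - 1) • X + A := by
    have := nsmul_succ_subset_of_two_nsmul_subset hX2 (16 * j - 1)
    rw [show 16 * j - 1 + 1 = 16 * j by omega] at this
    exact this hx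
  obtain ⟨y, hy, z, hz, rfl⟩ := Finset.mem_add.1 h6
  have h7 := norm_addChar_nsmul_sub_le ψ φ hcl2 _ y hy
  have h8 := norm_addChar_add_sub_le ψ φ y z
  have h9 := hcl1 z hz
  have h10 : ((16 * j - 1 : ℕ) : ℝ) * δ ≤ 1 / 8 := by
    have : ((16 * j - 1 : ℕ) : ℝ) ≤ 16 * (J + 1) := by
      have : 16 * j - 1 ≤ 16 * (J + 1) := by omega
      exact_mod_cast this
    calc ((16 * j - 1 : ℕ) : ℝ) * δ ≤ 16 * (J + 1) * δ := by gcongr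
      _ = 1 / 8 := by rw [hδ]; field_simp; norm_num
  have h11 : ψ (y + z) - 1 = (ψ (y + z) - φ (y + z)) + (φ (y + z) - 1) := by ring
  rw [h11]
  refine (norm_add_le _ _).trans ?_
  linarith

lemma image_sub_finset {G H : Type*} [AddCommGroup G] [AddCommGroup H] [DecidableEq G]
    [DecidableEq H] (f : G →+ H) (S T : Finset G) : (S - T).image f = S.image f - T.image f := by
  rw [sub_eq_add_neg, Finset.image_add, Finset.image_neg, ← sub_eq_add_neg]

lemma exists_box_bound {k : ℕ} (S : Finset (Fin k → ℤ)) : ∃ M : ℕ, ∀ x ∈ S, ∀ i, |x i| ≤ M := by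
  refine ⟨∑ x ∈ S, ∑ i, (x i).natAbs, fun x hx i => ?_⟩
  rw [Int.abs_eq_natAbs]
  have h1 : (x i).natAbs ≤ ∑ i, (x i).natAbs :=
    Finset.single_le_sum (f := fun i => (x i).natAbs) (fun _ _ => Nat.zero_le _) (Finset.mem_univ i)
  have h2 : ∑ i, (x i).natAbs ≤ ∑ x ∈ S, ∑ i, (x i).natAbs :=
    Finset.single_le_sum (f := fun x : Fin k → ℤ => ∑ i, (x i).natAbs)
      (fun _ _ => Nat.zero_le _) hx
  exact_mod_cast h1.trans h2

set_option maxHeartbeats 1000000 in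
lemma exists_bohr_of_small_doubling (k K : ℕ) : ∃ m J : ℕ, ∀ (S : Finset (Fin k → ℤ)),
    S.Nonempty → (S + S).card ≤ K * S.card →
    ∃ j, 1 ≤ j ∧ j ≤ J ∧ ∃ n ≤ m, ∃ χ : Fin n → AddChar (Fin k → ℤ) ℂ, (∀ i x, ‖χ i x‖ = 1) ∧
      ∀ x ∈ (16 * j) • (S - S), (∀ i, ‖χ i x - 1‖ ≤ 1 / 8) → x ∈ (4 * j) • (S - S) := by
  classical
  obtain ⟨m, J, h⟩ := exists_bohr_of_small_doubling_finite K
  refine ⟨m, J, fun S hS hK => ?_⟩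
  obtain ⟨M, hM⟩ := exists_box_bound ((16 * J) • (S - S) + (S + S - (S + S)))
  set N := 2 * M + 1 with hN
  let π : (Fin k → ℤ) →+ (Fin k → ZMod N) :=
    { toFun := fun x i => (x i : ZMod N)
      map_zero' := by ext; simp
      map_add' := fun x y => by ext; simp }
  have h0 : (0 : Fin k → ℤ) ∈ S - S := by
    obtain ⟨s, hs⟩ := hS
    exact Finset.mem_sub.2 ⟨s, hs, s, hs, sub_self s⟩
  have hbox : ∀ x : Fin k → ℤ, (∀ i, |x i| ≤ M) → ∀ y : Fin k → ℤ, (∀ i, |y i| ≤ M) →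
      π x = π y → x = y := by
    intro x hx y hy hxy
    ext i
    have h1 : ((x i : ℤ) : ZMod N) = (y i : ℤ) := congrFun hxy i
    rw [ZMod.intCast_eq_intCast_iff_dvd_sub] at h1
    have h2 := Int.eq_zero_of_abs_lt_dvd h1 (by
      have := hx i; have := hy i
      rw [abs_le] at *
      rw [abs_lt]
      push_cast [hN]
      constructor <;> linarith)
    linarith
  have hM1 : ∀ x ∈ (16 * J) • (S - S), ∀ i, |x i| ≤ M := by
    intro x hx
    refine hM x ?_
    have h2 : (0 : Fin k → ℤ) ∈ S + S - (S + S) := by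
      obtain ⟨s, hs⟩ := hS
      exact Finset.mem_sub.2 ⟨s + s, Finset.add_mem_add hs hs, s + s, Finset.add_mem_add hs hs,
        sub_self _⟩
    simpa using Finset.add_mem_add hx h2
  have hinj : ∀ T : Finset (Fin k → ℤ), T - T ⊆ S + S - (S + S) → (T.image π).card = T.card := by
    intro T hT
    refine Finset.card_image_of_injOn fun x hx y hy hxy => ?_
    have h3 : π (x - y) = π 0 := by rw [_root_.map_sub, _root_.map_zero, hxy, sub_self]
    have h4 := hbox (x - y) (fun i => hM (x - y) (by
      have := Finset.add_mem_add (Finset.zero_mem_nsmul h0 (n := 16 * J))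
        (hT (Finset.sub_mem_sub hx hy))
      simpa using this) i) 0 (by simp) h3
    exact sub_eq_zero.1 h4
  have hSS : S - S ⊆ S + S - (S + S) := by
    intro x hx
    obtain ⟨a, ha, b, hb, rfl⟩ := Finset.mem_sub.1 hx
    exact Finset.mem_sub.2 ⟨a + a, Finset.add_mem_add ha ha, b + a, Finset.add_mem_add hb ha,
      by abel⟩
  obtain ⟨j, hj1, hj2, n, hn, χ, hχ⟩ := h (Fin k → ZMod N) (S.image π) (hS.image π) (by
    rw [← Finset.image_add, hinj S hSS, hinj (S + S) subset_rfl]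
    exact hK)
  refine ⟨j, hj1, hj2, n, hn, fun i => (χ i).compAddMonoidHom π, fun i x => ?_, ?_⟩
  · simp [AddChar.norm_apply]
  · intro x hx hx2
    have h5 : π x ∈ (16 * j) • (S.image π - S.image π) := by
      rw [← image_sub_finset, ← Finset.image_nsmul]
      exact Finset.mem_image_of_mem _ hx
    have h6 := hχ (π x) h5 (fun i => by simpa using hx2 i)
    rw [← image_sub_finset, ← Finset.image_nsmul] at h6
    obtain ⟨y, hy, hxy⟩ := Finset.mem_image.1 h6
    have h7 : ∀ l, l ≤ J → l • (S - S) ⊆ (16 * J) • (S - S) := fun l hl =>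
      Finset.nsmul_subset_nsmul_right h0 (by omega)
    have h8 := hbox y (hM1 y (Finset.nsmul_subset_nsmul_right h0 (by omega) hy)) x
      (hM1 x (Finset.nsmul_subset_nsmul_right h0 (by omega) hx)) hxy
    exact h8 ▸ hy

lemma card_nsmul_sub_le {G : Type*} [AddCommGroup G] [DecidableEq G] {K : ℕ} {S : Finset G}
    (hS : S.Nonempty) (hK : (S + S).card ≤ K * S.card) (n : ℕ) :
    (n • (S - S)).card ≤ K ^ (2 * n) * S.card := by
  have h1 := Finset.pluennecke_ruzsa_inequality_nsmul_sub_nsmul_add hS S n n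
  have hpos : (0 : ℚ≥0) < S.card := by exact_mod_cast hS.card_pos
  have h2 : ((S + S).card / S.card : ℚ≥0) ≤ K := by
    rw [div_le_iff₀ hpos]; exact_mod_cast hK
  have h3 : ((n • S - n • S).card : ℚ≥0) ≤ (K : ℚ≥0) ^ (n + n) * S.card :=
    h1.trans (by gcongr)
  rw [nsmul_sub, two_mul]
  exact_mod_cast h3

lemma abs_arg_le_of_norm_sub_one_le {z : ℂ} (hz : ‖z‖ = 1) : |z.arg| ≤ 2 * ‖z - 1‖ := by
  have hz0 : z ≠ 0 := by intro h; simp [h] at hz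
  have h := Complex.angle_le_mul_norm_sub (x := 1) (y := z) (by simp) hz
  rw [Complex.angle_one_left hz0, norm_sub_rev] at h
  have : Real.pi / 2 ≤ 2 := by linarith [Real.pi_le_four]
  exact h.trans (by gcongr)

lemma norm_sub_one_le_abs_arg {z : ℂ} (hz : ‖z‖ = 1) : ‖z - 1‖ ≤ |z.arg| := by
  have hz0 : z ≠ 0 := by intro h; simp [h] at hz
  have h := Complex.norm_sub_le_angle (x := 1) (y := z) (by simp) hz
  rwa [Complex.angle_one_left hz0, norm_sub_rev] at h

namespace IsLocalGroup

variable {G V : Type*} [AddCommGroup G] [NormedAddCommGroup V] {E : Set G} {Φ : G → V} {R : ℝ}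

lemma injOn (h : IsLocalGroup E Φ R) [IsAddTorsionFree G] (hE : E.Finite) (hR : 0 ≤ R) :
    InjOn Φ E := by
  have h00 : Φ 0 = 0 := by simpa using h.map_add 0 h.zero_mem 0 h.zero_mem
  have h0 : ∀ z ∈ E, Φ z = 0 → z = 0 := by
    intro z hz hz0
    by_contra hne
    have hinj : Function.Injective fun n : ℕ => n • z := by
      intro a b hab
      have h1 : ((a : ℤ) - b) • z = 0 := by
        have hab' : a • z = b • z := hab
        rw [sub_zsmul, natCast_zsmul, natCast_zsmul, hab', add_neg_cancel]
      rcases IsAddTorsionFree.zsmul_eq_zero_iff.1 h1 with h2 | h2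
      · exact absurd h2 hne
      · omega
    refine (Set.infinite_range_of_injective hinj) (hE.subset ?_)
    rintro _ ⟨n, rfl⟩
    simpa using (h.add_nsmul_mem h.zero_mem hz n (by simpa [h00, hz0] using hR)).1
  intro x hx y hy hxy
  have h1 : Φ x + Φ (-y) = 0 := by rw [h.map_neg y hy, hxy, add_neg_cancel]
  have h2 := h.add_mem x hx (-y) (h.neg_mem y hy) (by rw [h1]; simpa using hR)
  have h3 := h0 _ h2 (by rw [h.map_add x hx _ (h.neg_mem y hy), h1])
  rwa [← sub_eq_add_neg, sub_eq_zero] at h3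

lemma image (h : IsLocalGroup E Φ R) : IsLocalGroup (Φ '' E) id R where
  zero_mem := ⟨0, h.zero_mem, by simpa using h.map_add 0 h.zero_mem 0 h.zero_mem⟩
  neg_mem := by
    rintro _ ⟨x, hx, rfl⟩
    exact ⟨-x, h.neg_mem x hx, h.map_neg x hx⟩
  map_neg := fun _ _ => rfl
  map_add := fun _ _ _ _ => rfl
  norm_le := by
    rintro _ ⟨x, hx, rfl⟩
    exact h.norm_le x hx
  add_mem := by
    rintro _ ⟨x, hx, rfl⟩ _ ⟨y, hy, rfl⟩ hxy
    exact ⟨x + y, h.add_mem x hx y hy hxy, h.map_add x hx y hy⟩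

/-- A finite local group contains a large proper progression containing a smaller ball. -/
lemma exists_progression [InnerProductSpace ℝ V] [FiniteDimensional ℝ V] (h : IsLocalGroup E Φ R)
    [IsAddTorsionFree G] (hE : E.Finite) (hR : 0 < R) (m : ℕ) (hm : Module.finrank ℝ V ≤ m) :
    ∃ r ≤ m, ∃ (v : Fin r → G) (N : Fin r → ℕ), ∏ i, (2 * N i + 1) ≤ E.ncard ∧
      ∀ x ∈ E, ‖Φ x‖ ≤ (1 / 16) ^ m / (m + 1) * R →
        ∃ n : Fin r → ℤ, (∀ i, |n i| ≤ N i) ∧ x = ∑ i, n i • v i := by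
  classical
  obtain ⟨r, hr, u, huE, hu0, hred, hgen⟩ := exists_reduced_basis m (⊤ : Submodule ℝ V) (Φ '' E) R
    inferInstance (by rwa [finrank_top]) (fun _ _ => trivial) (hE.image _) h.image
  choose v hvE hvu using huE
  have hupos : ∀ i, 0 < ‖u i‖ := fun i => norm_pos_iff.2 (hu0 i)
  let N : Fin r → ℕ := fun i => ⌊R / ((m + 1) * ‖u i‖)⌋₊
  have hN : ∀ n : Fin r → ℤ, (∀ i, |n i| ≤ N i) → ∑ i, |(n i : ℝ)| * ‖Φ (v i)‖ ≤ R := by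
    intro n hn
    have h1 : ∀ i, |(n i : ℝ)| * ‖Φ (v i)‖ ≤ R / (m + 1) := by
      intro i
      have h2 : |(n i : ℝ)| ≤ R / ((m + 1) * ‖u i‖) := by
        have h3 : |(n i : ℝ)| ≤ (N i : ℝ) := by exact_mod_cast hn i
        exact h3.trans (Nat.floor_le (by have := hupos i; positivity))
      rw [hvu]
      calc |(n i : ℝ)| * ‖u i‖ ≤ R / ((m + 1) * ‖u i‖) * ‖u i‖ := by gcongr
        _ = R / (m + 1) := by have := (hupos i).ne'; field_simp
    refine (Finset.sum_le_sum fun i _ => h1 i).trans ?_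
    rw [Finset.sum_const, Finset.card_univ, Fintype.card_fin, nsmul_eq_mul, mul_div_assoc',
      div_le_iff₀ (by positivity), mul_comm]
    have : (r : ℝ) ≤ m + 1 := by exact_mod_cast hr.trans (Nat.le_succ m)
    gcongr
  refine ⟨r, hr, v, N, ?_, ?_⟩
  · let B : Finset (Fin r → ℤ) := Fintype.piFinset fun i => Finset.Icc (-(N i : ℤ)) (N i)
    have hB : B.card = ∏ i, (2 * N i + 1) := by
      rw [Fintype.card_piFinset]
      refine Finset.prod_congr rfl fun i _ => ?_
      rw [Int.card_Icc]; omega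
    have hBm : ∀ n ∈ B, ∀ i, |n i| ≤ N i := by
      intro n hn i
      have := Fintype.mem_piFinset.1 hn i
      rw [Finset.mem_Icc] at this
      exact abs_le.2 this
    rw [← hB, ← Set.ncard_coe_finset]
    refine Set.ncard_le_ncard_of_injOn (fun n => ∑ i, n i • v i) ?_ ?_ hE
    · intro n hn
      exact (h.sum_mem Finset.univ hvE n (hN n (hBm n hn))).1
    · intro n hn n' hn' hnn
      have e1 := (h.sum_mem Finset.univ hvE n (hN n (hBm n hn))).2
      have e2 := (h.sum_mem Finset.univ hvE n' (hN n' (hBm n' hn'))).2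
      have hnn' : ∑ i, n i • v i = ∑ i, n' i • v i := hnn
      rw [hnn', e2] at e1
      have e3 : ∑ i, ((n i - n' i : ℤ) : ℝ) • u i = 0 := by
        simp only [hvu] at e1
        simp only [Int.cast_sub, sub_smul, Finset.sum_sub_distrib, Int.cast_smul_eq_zsmul]
        rw [e1, sub_self]
      have e4 := hred fun i => ((n i - n' i : ℤ) : ℝ)
      rw [e3, norm_zero] at e4
      have e5 : ∑ i, |((n i - n' i : ℤ) : ℝ)| * ‖u i‖ ≤ 0 := by
        by_contra! hcon
        have : 0 < (1 / 16 : ℝ) ^ m * ∑ i, |((n i - n' i : ℤ) : ℝ)| * ‖u i‖ := by positivity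
        linarith
      have e6 := (Finset.sum_eq_zero_iff_of_nonneg (fun i _ => by positivity)).1
        (le_antisymm e5 (Finset.sum_nonneg fun i _ => by positivity))
      ext i
      have e7 := e6 i (Finset.mem_univ i)
      rcases mul_eq_zero.1 e7 with e8 | e8
      · have : (n i - n' i : ℤ) = 0 := by exact_mod_cast abs_eq_zero.1 e8
        omega
      · exact absurd e8 (hupos i).ne'
  · intro x hx hxR
    obtain ⟨n, hn⟩ := hgen (Φ x) ⟨x, hx, rfl⟩ (hxR.trans (by
      gcongr
      exact div_le_self (by positivity) (by linarith [(Nat.cast_nonneg m : (0 : ℝ) ≤ m)])))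
    have hnN : ∀ i, |n i| ≤ N i := by
      intro i
      have h1 := hred fun i => (n i : ℝ)
      simp only [Int.cast_smul_eq_zsmul] at h1
      rw [← hn] at h1
      have h2 : |(n i : ℝ)| * ‖u i‖ ≤ ∑ i, |(n i : ℝ)| * ‖u i‖ :=
        Finset.single_le_sum (f := fun i => |(n i : ℝ)| * ‖u i‖) (fun i _ => by positivity)
          (Finset.mem_univ i)
      have h3 : (1 / 16 : ℝ) ^ m * (|(n i : ℝ)| * ‖u i‖) ≤ (1 / 16) ^ m * (R / (m + 1)) := by
        calc (1 / 16 : ℝ) ^ m * (|(n i : ℝ)| * ‖u i‖)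
            ≤ (1 / 16 : ℝ) ^ m * ∑ i, |(n i : ℝ)| * ‖u i‖ := by gcongr
          _ ≤ ‖Φ x‖ := h1
          _ ≤ (1 / 16) ^ m / (m + 1) * R := hxR
          _ = _ := by ring
      have h4 := le_of_mul_le_mul_left h3 (by positivity)
      have h5 : |(n i : ℝ)| ≤ R / ((m + 1) * ‖u i‖) := by
        rw [← div_div, le_div_iff₀ (hupos i)]; exact h4
      have h6 : (n i).natAbs ≤ N i := by
        refine Nat.le_floor ?_
        rw [Nat.cast_natAbs, Int.cast_abs]; exact h5
      rw [Int.abs_eq_natAbs]; exact_mod_cast h6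
    refine ⟨n, hnN, ?_⟩
    have h1 := h.sum_mem Finset.univ hvE n (hN n hnN)
    refine h.injOn hE hR.le hx h1.1 ?_
    rw [h1.2, hn]
    simp [hvu]

end IsLocalGroup

set_option maxHeartbeats 1000000 in
/-- Freiman's theorem in `ℤ^k`, in a covering form. -/
lemma freiman_covering (k K : ℕ) : ∃ r₀ t₀ C₀ : ℕ, ∀ S : Finset (Fin k → ℤ), S.Nonempty →
    (S + S).card ≤ K * S.card → ∃ r ≤ r₀, ∃ (v : Fin r → Fin k → ℤ) (N : Fin r → ℕ)
      (X : Finset (Fin k → ℤ)), X.card ≤ t₀ ∧ ∏ i, (2 * N i + 1) ≤ C₀ * S.card ∧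
      ∀ s ∈ S, ∃ x ∈ X, ∃ n : Fin r → ℤ, (∀ i, |n i| ≤ N i) ∧ s = x + ∑ i, n i • v i := by
  classical
  obtain ⟨m, J, hmJ⟩ := exists_bohr_of_small_doubling k K
  set δ : ℝ := (1 / 16) ^ m / (m + 1) * (1 / 8) / (2 * (m + 1)) with hδ
  have hδ0 : 0 < δ := by positivity
  obtain ⟨q, hq1, hq⟩ := exists_grid_bound hδ0
  refine ⟨m, q ^ m, K ^ (2 * (4 * J)), ?_⟩
  intro S hS hK
  obtain ⟨j, hj1, hj2, n, hn, χ, hχ1, hχ⟩ := hmJ S hS hK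
  have hK1 : 1 ≤ K := by
    rcases Nat.eq_zero_or_pos K with h | h
    · rw [h, zero_mul, Nat.le_zero, Finset.card_eq_zero] at hK
      exact absurd hK (hS.add hS).ne_empty
    · exact h
  set A := S - S with hA
  have h0 : (0 : Fin k → ℤ) ∈ A := by
    obtain ⟨s, hs⟩ := hS
    exact Finset.mem_sub.2 ⟨s, hs, s, hs, sub_self s⟩
  have hneg : ∀ (l : ℕ) (x), x ∈ l • A → -x ∈ l • A := by
    intro l x hx
    have : -(l • A) = l • A := by rw [← neg_nsmul, hA, neg_sub]
    rw [← this]; exact Finset.neg_mem_neg hx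
  let Φ : (Fin k → ℤ) → EuclideanSpace ℝ (Fin n) := fun x =>
    WithLp.toLp 2 fun i => (χ i x).arg
  have hΦi : ∀ x i, |(χ i x).arg| ≤ ‖Φ x‖ := fun x i => by
    simpa using PiLp.norm_apply_le (Φ x) i
  let E : Set (Fin k → ℤ) := {x | x ∈ (8 * j) • A ∧ ‖Φ x‖ ≤ 1 / 8}
  have hE4 : ∀ x ∈ E, x ∈ (4 * j) • A := by
    rintro x ⟨hx, hx'⟩
    refine hχ x (Finset.nsmul_subset_nsmul_right h0 (by omega) hx) fun i => ?_
    exact (norm_sub_one_le_abs_arg (hχ1 i x)).trans ((hΦi x i).trans hx')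
  have hEarg : ∀ x ∈ E, ∀ i, |(χ i x).arg| ≤ 1 / 8 := fun x hx i => (hΦi x i).trans hx.2
  have hχ0 : ∀ i x, χ i x ≠ 0 := fun i x h => by have := hχ1 i x; simp [h] at this
  have hmapneg : ∀ x ∈ E, Φ (-x) = -Φ x := by
    intro x hx
    ext i
    have h1 : χ i (-x) = (χ i x)⁻¹ := AddChar.map_neg_eq_inv _ _
    have h2 : (χ i x).arg ≠ Real.pi := by
      have := (abs_le.1 (hEarg x hx i)).2
      linarith [Real.pi_gt_three]
    simp [Φ, h1, Complex.arg_inv, h2]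
  have hmapadd : ∀ x ∈ E, ∀ y ∈ E, Φ (x + y) = Φ x + Φ y := by
    intro x hx y hy
    ext i
    have h1 := abs_le.1 (hEarg x hx i)
    have h2 := abs_le.1 (hEarg y hy i)
    have := Real.pi_gt_three
    simp only [Φ, PiLp.add_apply, AddChar.map_add_eq_mul]
    rw [Complex.arg_mul_eq_add_arg_iff (hχ0 _ _) (hχ0 _ _)]
    constructor <;> linarith
  have hloc : IsLocalGroup E Φ (1 / 8) := by
    refine ⟨⟨Finset.zero_mem_nsmul h0, ?_⟩, ?_, hmapneg, hmapadd, fun x hx => hx.2, ?_⟩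
    · have : Φ 0 = 0 := by ext i; simp [Φ]
      rw [this]; norm_num
    · intro x hx
      exact ⟨hneg _ _ hx.1, by rw [hmapneg x hx, norm_neg]; exact hx.2⟩
    · intro x hx y hy hxy
      refine ⟨?_, by rw [hmapadd x hx y hy]; exact hxy⟩
      have := Finset.add_mem_add (hE4 x hx) (hE4 y hy)
      rwa [← add_nsmul, show 4 * j + 4 * j = 8 * j by omega] at this
  have hEfin : E.Finite := (Finset.finite_toSet ((8 * j) • A)).subset fun x hx => hx.1
  obtain ⟨r, hr, v, N, hN, hv⟩ := hloc.exists_progression hEfin (by norm_num) m (by simpa using hn)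
  obtain ⟨X, hXS, hX1, hX2⟩ := exists_maximal_separated
    (fun a b : Fin k → ℤ => ∀ i, ‖χ i a - χ i b‖ ≤ δ)
    (fun a => by simp [hδ0.le]) (fun a b h => by simpa only [norm_sub_rev] using h) S
  refine ⟨r, hr, v, N, X, ?_, ?_, ?_⟩
  · have h1 := hq X (fun a i => χ i a) 1 (fun a i => (hχ1 i a).le) (by
      intro u hu hcl
      refine Finset.card_le_one.2 fun a ha b hb => ?_
      by_contra hne
      exact hX1 a (hu ha) b (hu hb) hne (hcl a ha b hb))
    rw [one_mul, Fintype.card_fin] at h1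
    exact h1.trans (pow_le_pow_right₀ hq1 hn)
  · refine hN.trans ?_
    have h1 : E.ncard ≤ ((4 * j) • A).card := by
      rw [← Set.ncard_coe_finset]
      exact Set.ncard_le_ncard hE4 (Finset.finite_toSet _)
    refine h1.trans ((card_nsmul_sub_le hS hK _).trans ?_)
    gcongr
  · intro s hs
    obtain ⟨b, hb, hsb⟩ := hX2 s hs
    have hΦle : ‖Φ (s - b)‖ ≤ (1 / 16) ^ m / (m + 1) * (1 / 8) := by
      have h1 : ∀ i, ‖Φ (s - b) i‖ ≤ 2 * δ := by
        intro i
        have h2 : χ i s - χ i b = (χ i (s - b) - 1) * χ i b := by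
          rw [sub_mul, one_mul, ← AddChar.map_add_eq_mul, sub_add_cancel]
        have h3 := hsb i
        rw [h2, norm_mul, hχ1, mul_one] at h3
        refine (abs_arg_le_of_norm_sub_one_le (hχ1 i _)).trans ?_
        gcongr
      have h4 : ‖Φ (s - b)‖ ≤ ∑ i, ‖Φ (s - b) i‖ := by
        rw [EuclideanSpace.norm_eq]
        refine Real.sqrt_le_iff.2 ⟨by positivity, ?_⟩
        exact Finset.sum_sq_le_sq_sum_of_nonneg fun i _ => norm_nonneg _
      refine h4.trans ((Finset.sum_le_sum fun i _ => h1 i).trans ?_)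
      rw [Finset.sum_const, Finset.card_univ, Fintype.card_fin, nsmul_eq_mul]
      have h5 : (n : ℝ) ≤ m + 1 := by exact_mod_cast hn.trans (Nat.le_succ m)
      calc (n : ℝ) * (2 * δ) ≤ (m + 1) * (2 * δ) := by gcongr
        _ = _ := by rw [hδ]; field_simp
    have h1le : (1 / 16 : ℝ) ^ m / (m + 1) * (1 / 8) ≤ 1 / 8 := by
      have h6 : (1 / 16 : ℝ) ^ m ≤ 1 := pow_le_one₀ (by norm_num) (by norm_num)
      have h7 : (1 / 16 : ℝ) ^ m / (m + 1) ≤ 1 := by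
        rw [div_le_one (by positivity)]
        linarith [(Nat.cast_nonneg m : (0 : ℝ) ≤ m)]
      linarith
    have hmem : s - b ∈ E := by
      refine ⟨?_, hΦle.trans h1le⟩
      have : s - b ∈ 1 • A := by
        rw [one_nsmul]; exact Finset.sub_mem_sub hs (hXS hb)
      exact Finset.nsmul_subset_nsmul_right h0 (by omega) this
    obtain ⟨c, hc1, hc2⟩ := hv (s - b) hmem hΦle
    exact ⟨b, hb, c, hc1, by rw [← hc2]; abel⟩

section ScaledLattice

variable {I : Type*} [Fintype I]

/-- The integer lattice, with the `i`-th coordinate scaled by `1 / N i`. -/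
noncomputable def scaledLattice (N : I → ℕ) : (I → ℤ) →+ EuclideanSpace ℝ I where
  toFun n := WithLp.toLp 2 fun i => (n i : ℝ) / N i
  map_zero' := by ext i; simp
  map_add' x y := by ext i; simp [add_div]

@[simp] lemma scaledLattice_apply (N : I → ℕ) (n : I → ℤ) (i : I) :
    scaledLattice N n i = (n i : ℝ) / N i := rfl

lemma norm_le_sum_abs (v : EuclideanSpace ℝ I) : ‖v‖ ≤ ∑ i, |v i| := by
  rw [EuclideanSpace.norm_eq]
  refine Real.sqrt_le_iff.2 ⟨by positivity, ?_⟩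
  exact Finset.sum_sq_le_sq_sum_of_nonneg fun i _ => norm_nonneg _

lemma norm_scaledLattice_le {N : I → ℕ} (hN : ∀ i, 1 ≤ N i) {n : I → ℤ} {Λ : ℕ}
    (h : ∀ i, |n i| ≤ Λ * N i) : ‖scaledLattice N n‖ ≤ Fintype.card I * Λ := by
  refine (norm_le_sum_abs _).trans ?_
  have : ∀ i, |scaledLattice N n i| ≤ Λ := by
    intro i
    have hN' : (0 : ℝ) < N i := by exact_mod_cast hN i
    rw [scaledLattice_apply, abs_div, Nat.abs_cast, div_le_iff₀ hN', ← Int.cast_abs]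
    exact_mod_cast h i
  refine (Finset.sum_le_sum fun i _ => this i).trans ?_
  simp

lemma abs_le_of_norm_scaledLattice_le {N : I → ℕ} (hN : ∀ i, 1 ≤ N i) {n : I → ℤ} {R : ℝ}
    (h : ‖scaledLattice N n‖ ≤ R) (i : I) : |(n i : ℝ)| ≤ R * N i := by
  have hN' : (0 : ℝ) < N i := by exact_mod_cast hN i
  have h1 := (PiLp.norm_apply_le (scaledLattice N n) i).trans h
  rw [scaledLattice_apply, Real.norm_eq_abs, abs_div, Nat.abs_cast, div_le_iff₀ hN'] at h1
  exact h1

lemma scaledLattice_ball (N : I → ℕ) (hN : ∀ i, 1 ≤ N i) {R : ℕ} (hR : 1 ≤ R) :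
    {n | ‖scaledLattice N n‖ ≤ R}.Finite ∧
      {n | ‖scaledLattice N n‖ ≤ R}.ncard ≤ R ^ Fintype.card I * ∏ i, (2 * N i + 1) := by
  classical
  let B : Finset (I → ℤ) := Fintype.piFinset fun i => Finset.Icc (-(R * N i : ℤ)) (R * N i)
  have hsub : {n | ‖scaledLattice N n‖ ≤ R} ⊆ B := by
    intro n hn
    refine Finset.mem_coe.2 (Fintype.mem_piFinset.2 fun i => ?_)
    have := abs_le_of_norm_scaledLattice_le hN hn i
    rw [Finset.mem_Icc, ← abs_le]
    exact_mod_cast this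
  refine ⟨B.finite_toSet.subset hsub, ?_⟩
  refine (Set.ncard_le_ncard hsub B.finite_toSet).trans ?_
  rw [Set.ncard_coe_finset, Fintype.card_piFinset, ← Finset.card_univ, ← Finset.prod_const,
    ← Finset.prod_mul_distrib]
  refine Finset.prod_le_prod' fun i _ => ?_
  rw [Int.card_Icc]
  have : ((R * N i : ℤ) + 1 - -(R * N i)).toNat = 2 * (R * N i) + 1 := by
    have : (R * N i : ℤ) = ((R * N i : ℕ) : ℤ) := by push_cast; ring
    rw [this]; omega
  rw [this]
  nlinarith

lemma finite_norm_scaledLattice_le (N : I → ℕ) (hN : ∀ i, 1 ≤ N i) (R : ℝ) :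
    {n | ‖scaledLattice N n‖ ≤ R}.Finite := by
  refine (scaledLattice_ball N hN (R := ⌈R⌉₊ + 1) (by omega)).1.subset fun n hn => ?_
  have hn' : ‖scaledLattice N n‖ ≤ R := hn
  refine hn'.trans ((Nat.le_ceil R).trans ?_)
  push_cast; linarith

lemma exists_short_lift (N : I → ℕ) (𝒦 : Set (I → ℤ)) {ρ : ℝ} (hρ : 0 ≤ ρ)
    (hK : ∀ κ ∈ 𝒦, ‖scaledLattice N κ‖ ≤ ρ) (v : EuclideanSpace ℝ I)
    (hv : ∃ n, scaledLattice N n - v ∈ Submodule.span ℝ (scaledLattice N '' 𝒦)) :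
    ∃ n, scaledLattice N n - v ∈ Submodule.span ℝ (scaledLattice N '' 𝒦) ∧
      ‖scaledLattice N n‖ ≤ ‖v‖ + Fintype.card I * ρ := by
  classical
  obtain ⟨n, hn⟩ := hv
  obtain ⟨b, hbs, hspan, hli⟩ := exists_linearIndependent ℝ (scaledLattice N '' 𝒦)
  have hbfin : Finite b := hli.finite
  have : Fintype b := Fintype.ofFinite b
  have hcard : Fintype.card b ≤ Fintype.card I := by
    simpa using hli.fintype_card_le_finrank
  have hn2 := hn
  rw [← hspan] at hn2
  have hrange : Set.range (Subtype.val : b → EuclideanSpace ℝ I) = b := Subtype.range_coe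
  rw [← hrange, Submodule.mem_span_range_iff_exists_fun] at hn2
  obtain ⟨t, ht⟩ := hn2
  choose κ hκ hκb using fun x : b => hbs x.2
  have hbn : ∀ x : b, ‖(x : EuclideanSpace ℝ I)‖ ≤ ρ := fun x => by
    rw [← hκb x]; exact hK _ (hκ x)
  have key : scaledLattice N (n - ∑ x, ⌊t x⌋ • κ x) - v = ∑ x, Int.fract (t x) • (x : EuclideanSpace ℝ I) := by
    rw [_root_.map_sub, map_sum, sub_right_comm, ← ht, ← Finset.sum_sub_distrib]
    refine Finset.sum_congr rfl fun x _ => ?_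
    rw [map_zsmul, hκb, Int.fract, sub_smul, Int.cast_smul_eq_zsmul]
  refine ⟨n - ∑ x, ⌊t x⌋ • κ x, ?_, ?_⟩
  · rw [key]
    refine Submodule.sum_mem _ fun x _ => Submodule.smul_mem _ _ (Submodule.subset_span (hbs x.2))
  · have : scaledLattice N (n - ∑ x, ⌊t x⌋ • κ x) =
        v + ∑ x, Int.fract (t x) • (x : EuclideanSpace ℝ I) := by rw [← key]; abel
    rw [this]
    refine (norm_add_le _ _).trans ?_
    gcongr
    calc ‖∑ x, Int.fract (t x) • (x : EuclideanSpace ℝ I)‖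
        ≤ ∑ x : b, ρ := by
          refine (norm_sum_le _ _).trans (Finset.sum_le_sum fun x _ => ?_)
          rw [norm_smul, Real.norm_of_nonneg (Int.fract_nonneg _)]
          calc Int.fract (t x) * ‖(x : EuclideanSpace ℝ I)‖ ≤ 1 * ρ := by
                gcongr
                · exact (Int.fract_lt_one _).le
                · exact hbn x
            _ = ρ := one_mul _
      _ = Fintype.card b * ρ := by simp
      _ ≤ Fintype.card I * ρ := by gcongr

set_option maxHeartbeats 1000000 in
/-- A reduced basis for the quotient of `ℤ^I` by the subspace spanned by short vectors. -/
lemma exists_quotient_basis (N : I → ℕ) (hN : ∀ i, 1 ≤ N i) (𝒦 : Set (I → ℤ)) {ρ R : ℝ}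
    (hρ : 0 ≤ ρ) (hR : 0 < R) (hK : ∀ κ ∈ 𝒦, ‖scaledLattice N κ‖ ≤ ρ)
    (W : Submodule ℝ (EuclideanSpace ℝ I)) (hW : W = Submodule.span ℝ (scaledLattice N '' 𝒦)) :
    ∃ r, r + Module.finrank ℝ W ≤ Fintype.card I ∧ ∃ (u : Fin r → EuclideanSpace ℝ I)
      (M : Fin r → ℕ), (∀ i, 1 ≤ M i) ∧ (∀ i, ∃ b, scaledLattice N b - u i ∈ W) ∧
      (∀ n, ‖scaledLattice N n‖ ≤ R → ∃ m : Fin r → ℤ, (∀ i, |m i| ≤ M i) ∧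
        ∃ w ∈ W, ‖w‖ ≤ R ∧ scaledLattice N n = ∑ i, m i • u i + w) ∧
      (∀ m : Fin r → ℤ, ∑ i, m i • u i ∈ W → m = 0) ∧
      ∀ (m : Fin r → ℤ) (Λ : ℕ), (∀ i, |m i| ≤ Λ * M i) →
        ∃ n, ‖scaledLattice N n‖ ≤ Λ * (Fintype.card I * (16 ^ Fintype.card I * R)) +
          Fintype.card I * ρ ∧ scaledLattice N n - ∑ i, m i • u i ∈ W := by
  classical
  set q := Fintype.card I with hq
  set RE : ℝ := 16 ^ q * R with hRE
  have hRE0 : 0 < RE := by positivity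
  have hsum : Module.finrank ℝ W + Module.finrank ℝ Wᗮ = q := by
    rw [Submodule.finrank_add_finrank_orthogonal, finrank_euclideanSpace]
  set mm := Module.finrank ℝ Wᗮ with hmm
  let E : Set (EuclideanSpace ℝ I) := {p | p ∈ Wᗮ ∧ ‖p‖ ≤ RE ∧ ∃ n, scaledLattice N n - p ∈ W}
  have hEloc : IsLocalGroup E id RE := by
    refine ⟨⟨Submodule.zero_mem _, by simpa using hRE0.le, 0, by simp⟩, ?_, fun _ _ => rfl,
      fun _ _ _ _ => rfl, fun x hx => hx.2.1, ?_⟩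
    · rintro x ⟨h1, h2, n, h3⟩
      refine ⟨Submodule.neg_mem _ h1, by simpa using h2, -n, ?_⟩
      rw [_root_.map_neg, ← neg_sub']
      exact Submodule.neg_mem _ h3
    · rintro x ⟨h1, h2, n, h3⟩ y ⟨h1', h2', n', h3'⟩ hxy
      refine ⟨Submodule.add_mem _ h1 h1', hxy, n + n', ?_⟩
      rw [_root_.map_add, add_sub_add_comm]
      exact Submodule.add_mem _ h3 h3'
  have hEfin : E.Finite := by
    have hf := (finite_norm_scaledLattice_le N hN (RE + q * ρ)).image
      (fun n => Wᗮ.starProjection (scaledLattice N n))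
    refine hf.subset ?_
    rintro p ⟨h1, h2, hn⟩
    rw [hW] at hn
    obtain ⟨n, hn1, hn2⟩ := exists_short_lift N 𝒦 hρ hK p hn
    refine ⟨n, hn2.trans (by rw [← hq]; gcongr), ?_⟩
    rw [← hW] at hn1
    have e : scaledLattice N n = p + (scaledLattice N n - p) := by abel
    have h3 : Wᗮ.starProjection (scaledLattice N n - p) = 0 := by
      rw [Submodule.starProjection_apply_eq_zero_iff]
      simpa using hn1
    have h4 : Wᗮ.starProjection p = p := Submodule.starProjection_eq_self_iff.2 h1
    dsimp only
    rw [e, _root_.map_add, h3, h4, add_zero]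
  obtain ⟨r, hr, u, huE, hu0, hred, hgen⟩ := exists_reduced_basis mm Wᗮ E RE inferInstance le_rfl
    (fun p hp => hp.1) hEfin hEloc
  have hupos : ∀ i, 0 < ‖u i‖ := fun i => norm_pos_iff.2 (hu0 i)
  let M : Fin r → ℕ := fun i => ⌊RE / ‖u i‖⌋₊
  have h16 : (16 : ℝ) ^ mm ≤ 16 ^ q := pow_le_pow_right₀ (by norm_num) (by omega)
  have hone : (1 / 16 : ℝ) ^ mm * 16 ^ mm = 1 := by rw [← mul_pow]; norm_num
  refine ⟨r, by omega, u, M, ?_, fun i => (huE i).2.2, ?_, ?_, ?_⟩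
  · intro i
    refine Nat.le_floor ?_
    rw [Nat.cast_one, one_le_div (hupos i)]
    exact (huE i).2.1
  · intro n hn
    set p := Wᗮ.starProjection (scaledLattice N n) with hp
    have hw : scaledLattice N n - p = W.starProjection (scaledLattice N n) := by
      rw [hp, Submodule.starProjection_orthogonal_val, _root_.sub_sub_cancel]
    have hwW : scaledLattice N n - p ∈ W := by rw [hw]; exact Submodule.starProjection_apply_mem _ _
    have hpn : ‖p‖ ≤ R := (Submodule.norm_starProjection_apply_le _ _).trans hn
    have hRle : R ≤ (1 / 16) ^ mm * RE := by
      calc R = ((1 / 16) ^ mm * 16 ^ mm) * R := by rw [hone, one_mul]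
        _ ≤ ((1 / 16) ^ mm * 16 ^ q) * R := by gcongr
        _ = _ := by rw [hRE]; ring
    have hRE2 : R ≤ RE := by
      rw [hRE]
      exact le_mul_of_one_le_left hR.le (one_le_pow₀ (by norm_num))
    obtain ⟨m, hm⟩ := hgen p ⟨Submodule.starProjection_apply_mem _ _, hpn.trans hRE2, n, hwW⟩ (hpn.trans hRle)
    refine ⟨m, fun i => ?_, scaledLattice N n - p, hwW, ?_, ?_⟩
    · have h1 := hred fun i => (m i : ℝ)
      simp only [Int.cast_smul_eq_zsmul] at h1
      rw [← hm] at h1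
      have h2 : |(m i : ℝ)| * ‖u i‖ ≤ ∑ i, |(m i : ℝ)| * ‖u i‖ :=
        Finset.single_le_sum (f := fun i => |(m i : ℝ)| * ‖u i‖) (fun i _ => by positivity)
          (Finset.mem_univ i)
      have h3 : |(m i : ℝ)| * ‖u i‖ ≤ RE := by
        have h4 : (1 / 16 : ℝ) ^ mm * (|(m i : ℝ)| * ‖u i‖) ≤ (1 / 16 : ℝ) ^ mm * RE :=
          (mul_le_mul_of_nonneg_left h2 (by positivity)).trans (h1.trans (hpn.trans hRle))
        exact le_of_mul_le_mul_left h4 (by positivity)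
      have h6 : (m i).natAbs ≤ M i := by
        refine Nat.le_floor ?_
        rw [Nat.cast_natAbs, Int.cast_abs, le_div_iff₀ (hupos i)]; exact h3
      rw [Int.abs_eq_natAbs]; exact_mod_cast h6
    · rw [hw]; exact (Submodule.norm_starProjection_apply_le _ _).trans hn
    · rw [← hm]; abel
  · intro m hm
    have h1 : ∑ i, m i • u i ∈ Wᗮ :=
      Submodule.sum_mem _ fun i _ => zsmul_mem (huE i).1 _
    have h2 : ∑ i, m i • u i = 0 := by
      have : ∑ i, m i • u i ∈ W ⊓ Wᗮ := ⟨hm, h1⟩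
      rw [Submodule.inf_orthogonal_eq_bot] at this
      simpa using this
    have h3 := hred fun i => (m i : ℝ)
    simp only [Int.cast_smul_eq_zsmul] at h3
    rw [h2, norm_zero] at h3
    have e5 : ∑ i, |(m i : ℝ)| * ‖u i‖ ≤ 0 := by
      by_contra! hcon
      have : 0 < (1 / 16 : ℝ) ^ mm * ∑ i, |(m i : ℝ)| * ‖u i‖ := by positivity
      linarith
    have e6 := (Finset.sum_eq_zero_iff_of_nonneg (fun i _ => by positivity)).1
      (le_antisymm e5 (Finset.sum_nonneg fun i _ => by positivity))
    ext i
    rcases mul_eq_zero.1 (e6 i (Finset.mem_univ i)) with e8 | e8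
    · exact_mod_cast abs_eq_zero.1 e8
    · exact absurd e8 (hupos i).ne'
  · intro m Λ hm
    have h1 : ‖∑ i, m i • u i‖ ≤ Λ * (q * RE) := by
      have h2 : ∀ i, ‖m i • u i‖ ≤ Λ * RE := by
        intro i
        have h3 : |(m i : ℝ)| ≤ Λ * M i := by exact_mod_cast hm i
        have h4 : (M i : ℝ) * ‖u i‖ ≤ RE := by
          rw [← le_div_iff₀ (hupos i)]
          exact Nat.floor_le (by have := hupos i; positivity)
        calc ‖m i • u i‖ = |(m i : ℝ)| * ‖u i‖ := by
              rw [← Int.cast_smul_eq_zsmul ℝ, norm_smul, Real.norm_eq_abs]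
          _ ≤ Λ * M i * ‖u i‖ := by gcongr
          _ = Λ * (M i * ‖u i‖) := by ring
          _ ≤ Λ * RE := by gcongr
      refine (norm_sum_le _ _).trans ((Finset.sum_le_sum fun i _ => h2 i).trans ?_)
      rw [Finset.sum_const, Finset.card_univ, Fintype.card_fin, nsmul_eq_mul]
      have : (r : ℝ) ≤ q := by exact_mod_cast (by omega : r ≤ q)
      calc (r : ℝ) * (Λ * RE) ≤ q * (Λ * RE) := by gcongr
        _ = _ := by ring
    choose b hb using fun i => (huE i).2.2
    obtain ⟨n, hn1, hn2⟩ := exists_short_lift N 𝒦 hρ hK (∑ i, m i • u i) ⟨∑ i, m i • b i, by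
      rw [← hW, map_sum, ← Finset.sum_sub_distrib]
      refine Submodule.sum_mem _ fun i _ => ?_
      rw [map_zsmul, ← zsmul_sub]
      exact zsmul_mem (hb i) _⟩
    exact ⟨n, hn2.trans (by gcongr), by rw [hW]; exact hn1⟩

end ScaledLattice

/-- The integer points of a box. -/
noncomputable def intBox {I : Type*} [Fintype I] [DecidableEq I] (N : I → ℕ) : Finset (I → ℤ) :=
  Fintype.piFinset fun i => Finset.Icc (-(N i : ℤ)) (N i)

section

variable {I : Type*} [Fintype I] [DecidableEq I]

lemma mem_intBox {N : I → ℕ} {n : I → ℤ} : n ∈ intBox N ↔ ∀ i, |n i| ≤ N i := by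
  simp [intBox, Fintype.mem_piFinset, abs_le]

lemma card_intBox (N : I → ℕ) : (intBox N).card = ∏ i, (2 * N i + 1) := by
  rw [intBox, Fintype.card_piFinset]
  refine Finset.prod_congr rfl fun i _ => ?_
  rw [Int.card_Icc]; omega

end

/-- The real linear extension of `n ↦ ∑ i, n i • g i` in scaled coordinates. -/
noncomputable def scaledEval {I : Type*} [Fintype I] {k : ℕ} (N : I → ℕ) (g : I → Fin k → ℤ) :
    EuclideanSpace ℝ I →ₗ[ℝ] (Fin k → ℝ) where
  toFun v := fun j => ∑ i, v i * (N i * g i j)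
  map_add' x y := by ext j; simp [add_mul, Finset.sum_add_distrib]
  map_smul' c x := by ext j; simp [Finset.mul_sum, mul_assoc]

lemma scaledEval_scaledLattice {I : Type*} [Fintype I] {k : ℕ} {N : I → ℕ} (hN : ∀ i, 1 ≤ N i)
    (g : I → Fin k → ℤ) (n : I → ℤ) (j : Fin k) :
    scaledEval N g (scaledLattice N n) j = ((∑ i, n i • g i) j : ℤ) := by
  simp only [scaledEval, LinearMap.coe_mk, AddHom.coe_mk, scaledLattice_apply]
  rw [Finset.sum_apply, Int.cast_sum]
  refine Finset.sum_congr rfl fun i _ => ?_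
  have : (N i : ℝ) ≠ 0 := by have := hN i; positivity
  simp
  field_simp

lemma exists_eq_succ_of_bounded (f : ℕ → ℕ) (q : ℕ) (hf : ∀ s, f s ≤ q)
    (hmono : ∀ s, f s ≤ f (s + 1)) : ∃ s ≤ q, f s = f (s + 1) := by
  by_contra! h
  have : ∀ s, s ≤ q + 1 → s ≤ f s := by
    intro s
    induction s with
    | zero => intro _; omega
    | succ s ih =>
      intro hs
      have := ih (by omega)
      have := hmono s
      have := h s (by omega)
      omega
  have := this (q + 1) le_rfl
  have := hf (q + 1)
  omega

/-- Scales for the kernel vectors. -/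
def kernelScale (q Λ : ℕ) : ℕ → ℕ
  | 0 => 0
  | s + 1 => Λ * (q * (16 ^ q * (q + 1))) + (q + 1) * kernelScale q Λ s

lemma kernelScale_mono (q Λ : ℕ) : Monotone (kernelScale q Λ) :=
  monotone_nat_of_le_succ fun s => by
    rw [kernelScale]
    exact (Nat.le_mul_of_pos_left _ (Nat.succ_pos q)).trans (Nat.le_add_left _ _)

set_option maxHeartbeats 1000000 in
/-- Every progression in `ℤ^k` is contained in a highly proper one of comparable size. -/
lemma exists_proper_progression (k q Λ : ℕ) : ∃ C : ℕ, ∀ {I : Type} [Fintype I],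
    Fintype.card I = q → ∀ (N : I → ℕ) (g : I → Fin k → ℤ), (∀ i, 1 ≤ N i) →
    ∃ r ≤ q, ∃ (b : Fin r → Fin k → ℤ) (M : Fin r → ℕ), (∀ i, 1 ≤ M i) ∧
      (∀ n : I → ℤ, (∀ i, |n i| ≤ N i) → ∃ m : Fin r → ℤ, (∀ i, |m i| ≤ M i) ∧
        ∑ i, n i • g i = ∑ i, m i • b i) ∧
      (∀ m : Fin r → ℤ, (∀ i, |m i| ≤ Λ * M i) → ∑ i, m i • b i = 0 → m = 0) ∧
      ∏ i, (2 * M i + 1) ≤ C * ∏ i, (2 * N i + 1) := by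
  classical
  refine ⟨(q * (16 ^ q * (q + 1)) + q * kernelScale q Λ q + 1) ^ q, ?_⟩
  intro I _ hI N g hN
  let 𝒦 : ℕ → Set (I → ℤ) := fun s =>
    {κ | ∑ i, κ i • g i = 0 ∧ ‖scaledLattice N κ‖ ≤ kernelScale q Λ s}
  let W : ℕ → Submodule ℝ (EuclideanSpace ℝ I) := fun s =>
    Submodule.span ℝ (scaledLattice N '' 𝒦 s)
  have hWmono : ∀ s, W s ≤ W (s + 1) := by
    intro s
    refine Submodule.span_mono (image_mono fun κ hκ => ⟨hκ.1, hκ.2.trans ?_⟩)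
    exact_mod_cast kernelScale_mono q Λ (Nat.le_succ s)
  obtain ⟨s, hs, hdim⟩ := exists_eq_succ_of_bounded (fun s => Module.finrank ℝ (W s)) q
    (fun s => by simpa [hI] using Submodule.finrank_le (W s))
    (fun s => Submodule.finrank_mono (hWmono s))
  have hWeq : W s = W (s + 1) := Submodule.eq_of_le_of_finrank_eq (hWmono s) hdim
  have hker : ∀ w ∈ W s, scaledEval N g w = 0 := by
    intro w hw
    have : W s ≤ LinearMap.ker (scaledEval N g) := by
      refine Submodule.span_le.2 ?_
      rintro _ ⟨κ, hκ, rfl⟩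
      rw [SetLike.mem_coe, LinearMap.mem_ker]
      ext j
      rw [scaledEval_scaledLattice hN, hκ.1]; simp
    exact this hw
  obtain ⟨r, hr, u, M, hM1, hlift, hcov, hind, hshort⟩ := exists_quotient_basis N hN (𝒦 s)
    (ρ := kernelScale q Λ s) (R := q + 1) (by positivity) (by positivity) (fun κ hκ => hκ.2)
    (W s) rfl
  rw [hI] at hr hshort
  choose b hb using hlift
  have heval : ∀ (n : I → ℤ) (m : Fin r → ℤ), scaledLattice N n - ∑ i, m i • u i ∈ W s →
      ∑ i, n i • g i = ∑ i, m i • ∑ l, b i l • g l := by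
    intro n m h
    have h1 : scaledLattice N (n - ∑ i, m i • b i) ∈ W s := by
      have : scaledLattice N (n - ∑ i, m i • b i) = (scaledLattice N n - ∑ i, m i • u i) -
          ∑ i, m i • (scaledLattice N (b i) - u i) := by
        rw [_root_.map_sub, map_sum]
        simp only [map_zsmul, zsmul_sub, Finset.sum_sub_distrib]
        abel
      rw [this]
      exact Submodule.sub_mem _ h (Submodule.sum_mem _ fun i _ => zsmul_mem (hb i) _)
    have h2 := hker _ h1
    have h3 : ∑ i, (n - ∑ i, m i • b i) i • g i = 0 := by
      ext j
      have := congrFun h2 j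
      rw [scaledEval_scaledLattice hN, Pi.zero_apply] at this
      rw [Pi.zero_apply]
      exact_mod_cast this
    simp only [Pi.sub_apply, sub_smul, Finset.sum_sub_distrib, Finset.sum_apply, Pi.smul_apply,
      Finset.sum_smul, smul_assoc] at h3
    rw [sub_eq_zero] at h3
    rw [h3, Finset.sum_comm]
    simp only [Finset.smul_sum]
  refine ⟨r, by omega, fun i => ∑ l, b i l • g l, M, hM1, ?_, ?_, ?_⟩
  · intro n hn
    have h1 : ‖scaledLattice N n‖ ≤ (q : ℝ) + 1 := by
      have := norm_scaledLattice_le hN (n := n) (Λ := 1) (by simpa using hn)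
      rw [hI] at this
      push_cast at this
      linarith
    obtain ⟨m, hm, w, hw, -, e⟩ := hcov n h1
    refine ⟨m, hm, heval n m ?_⟩
    rw [e, add_sub_cancel_left]; exact hw
  · intro m hm h0
    obtain ⟨n, hn1, hn2⟩ := hshort m Λ hm
    have h1 := heval n m hn2
    rw [h0] at h1
    have h2 : n ∈ 𝒦 (s + 1) := by
      refine ⟨h1, hn1.trans ?_⟩
      rw [kernelScale]
      push_cast
      nlinarith [(Nat.cast_nonneg (kernelScale q Λ s) : (0 : ℝ) ≤ _)]
    have h3 : scaledLattice N n ∈ W s := by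
      rw [hWeq]; exact Submodule.subset_span ⟨n, h2, rfl⟩
    refine hind m ?_
    have : ∑ i, m i • u i = scaledLattice N n - (scaledLattice N n - ∑ i, m i • u i) := by abel
    rw [this]
    exact Submodule.sub_mem _ h3 hn2
  · have hex : ∀ m : Fin r → ℤ, m ∈ intBox M → ∃ n, ‖scaledLattice N n‖ ≤
        ((q * (16 ^ q * (q + 1)) + q * kernelScale q Λ q + 1 : ℕ) : ℝ) ∧
        scaledLattice N n - ∑ i, m i • u i ∈ W s := by
      intro m hm
      obtain ⟨n, h1, h2⟩ := hshort m 1 (by simpa using mem_intBox.1 hm)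
      refine ⟨n, h1.trans ?_, h2⟩
      have h3 : (kernelScale q Λ s : ℝ) ≤ kernelScale q Λ q := by
        exact_mod_cast kernelScale_mono q Λ hs
      push_cast
      have : (q : ℝ) * kernelScale q Λ s ≤ q * kernelScale q Λ q := by gcongr
      linarith
    choose! f hf1 hf2 using hex
    rw [← card_intBox]
    have hball := scaledLattice_ball N hN
      (R := q * (16 ^ q * (q + 1)) + q * kernelScale q Λ q + 1) (by omega)
    rw [hI] at hball
    refine le_trans ?_ hball.2
    rw [← Set.ncard_coe_finset]
    refine Set.ncard_le_ncard_of_injOn f (fun m hm => hf1 m hm) ?_ hball.1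
    intro m hm m' hm' hmm
    have h1 := hf2 m hm
    have h2 := hf2 m' hm'
    rw [← hmm] at h2
    have h3 := Submodule.sub_mem _ h2 h1
    have h4 : ∑ i, (m - m') i • u i ∈ W s := by
      have e : ∑ i, (m - m') i • u i = (scaledLattice N (f m) - ∑ i, m' i • u i) -
        (scaledLattice N (f m) - ∑ i, m i • u i) := by
        simp only [Pi.sub_apply, sub_smul, Finset.sum_sub_distrib]; abel
      rw [e]; exact h3
    exact sub_eq_zero.1 (hind _ h4)

lemma volume_le_card_of_floor_mem {k : ℕ} {Q : Set (Fin k → ℝ)} (T : Finset (Fin k → ℤ))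
    (h : ∀ x ∈ Q, (fun j => ⌊x j⌋) ∈ T) : volume Q ≤ T.card := by
  have h1 : Q ⊆ ⋃ t ∈ T, Set.Icc (fun j => (t j : ℝ)) (fun j => (t j : ℝ) + 1) := by
    intro x hx
    refine Set.mem_biUnion (h x hx) ⟨fun j => Int.floor_le _, fun j => (Int.lt_floor_add_one _).le⟩
  refine (measure_mono h1).trans ((measure_biUnion_finset_le _ _).trans ?_)
  simp [Real.volume_Icc_pi]

set_option maxHeartbeats 1000000 in
/-- A progression in `ℤ^k` containing the standard basis is contained, after thickening by the unit
cube, in the sum of a progression of rank smaller by `k` and a parallelotope. -/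
lemma exists_gap_parallelotope (k q : ℕ) : ∃ C : ℕ, ∀ {I : Type} [Fintype I],
    Fintype.card I = q → ∀ (N : I → ℕ) (g : I → Fin k → ℤ) (w : Fin k → I → ℤ), (∀ i, 1 ≤ N i) →
    (∀ j i, |w j i| ≤ N i) → (∀ j, ∑ i, w j i • g i = Pi.single j 1) →
    ∃ r, r + k ≤ q ∧ ∃ (a : Fin r → Fin k → ℝ) (M : Fin r → ℕ) (Q : Set (Fin k → ℝ)),
      IsParallelotope k Q ∧
      (∀ n : I → ℤ, (∀ i, |n i| ≤ N i) → ∀ θ ∈ Set.Icc (0 : Fin k → ℝ) 1,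
        ∃ m : Fin r → ℤ, (∀ i, |m i| ≤ M i) ∧ ∃ y ∈ Q,
          (fun j => ((∑ i, n i • g i) j : ℝ)) + θ = ∑ i, (m i : ℝ) • a i + y) ∧
      ((∏ i, (2 * M i + 1) : ℕ) : ℝ≥0∞) * volume Q ≤ ((C * ∏ i, (2 * N i + 1) : ℕ) : ℝ≥0∞) := by
  classical
  let R₃ : ℕ := (q + 1) + k * q
  let R₂ : ℕ := k * R₃ + k * q
  let R₁ : ℕ := q * (16 ^ q * (q + 1)) + q * q
  refine ⟨(R₁ + R₂ + 1) ^ q, ?_⟩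
  intro I _ hI N g w hN hwN hwg
  have hw : ∀ j, ‖scaledLattice N (w j)‖ ≤ q := by
    intro j
    have := norm_scaledLattice_le hN (n := w j) (Λ := 1) (by simpa using hwN j)
    rw [hI] at this
    simpa using this
  let ψ : (Fin k → ℝ) →ₗ[ℝ] EuclideanSpace ℝ I := Fintype.linearCombination ℝ fun j =>
    scaledLattice N (w j)
  have hψ : ∀ t, ψ t = ∑ j, t j • scaledLattice N (w j) := fun t => rfl
  have hφψ : ∀ t, scaledEval N g (ψ t) = t := by
    intro t
    rw [hψ, map_sum]
    ext l
    rw [Finset.sum_apply]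
    have h1 : ∀ j, scaledEval N g (t j • scaledLattice N (w j)) l =
        t j * ((Pi.single j 1 : Fin k → ℤ) l : ℤ) := fun j => by
      rw [map_smul, Pi.smul_apply, scaledEval_scaledLattice hN, hwg, smul_eq_mul]
    simp only [h1]
    simp [Pi.single_apply]
  have hψn : ∀ t : Fin k → ℝ, ∀ B : ℝ, (∀ j, |t j| ≤ B) → ‖ψ t‖ ≤ k * (B * q) := by
    intro t B ht
    rw [hψ]
    refine (norm_sum_le _ _).trans ?_
    calc ∑ j, ‖t j • scaledLattice N (w j)‖ ≤ ∑ _j : Fin k, B * (q : ℝ) := by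
          refine Finset.sum_le_sum fun j _ => ?_
          rw [norm_smul]
          exact mul_le_mul (ht j) (hw j) (norm_nonneg _) ((abs_nonneg _).trans (ht j))
      _ = _ := by simp
  obtain ⟨W, hW⟩ : ∃ W, W = Submodule.span ℝ (scaledLattice N '' Set.range w) := ⟨_, rfl⟩
  have hWψ : W = LinearMap.range ψ := by
    rw [hW, Fintype.range_linearCombination, ← Set.range_comp]; rfl
  have hψφ : ∀ y ∈ W, ψ (scaledEval N g y) = y := by
    intro y hy
    rw [hWψ] at hy
    obtain ⟨t, rfl⟩ := hy
    rw [hφψ]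
  have hfin : Module.finrank ℝ W = k := by
    rw [hWψ, LinearMap.finrank_range_of_inj]
    · simp
    · intro x y hxy
      rw [← hφψ x, ← hφψ y, hxy]
  obtain ⟨r, hr, u, M, hM1, -, hcov, hind, hshort⟩ := exists_quotient_basis N hN (Set.range w)
    (ρ := q) (R := q + 1) (by positivity) (by positivity)
    (by rintro _ ⟨j, rfl⟩; exact hw j) W hW
  rw [hI] at hr hshort
  rw [hfin] at hr
  let f : OrthonormalBasis (Fin k) ℝ W := (stdOrthonormalBasis ℝ W).reindex (finCongr hfin)
  let φ := scaledEval N g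
  let Q : Set (Fin k → ℝ) := (fun lam : Fin k → ℝ => (-∑ j, (R₃ : ℝ) • φ (f j)) +
    ∑ j, lam j • ((2 * (R₃ : ℝ)) • φ (f j))) '' Set.Icc 0 1
  have hQ1 : ∀ y ∈ W, ‖y‖ ≤ R₃ → φ y ∈ Q := by
    intro y hy hyn
    have hR3 : (0 : ℝ) < R₃ := by positivity
    have hc : ∀ j, |f.repr ⟨y, hy⟩ j| ≤ R₃ := by
      intro j
      have h1 := PiLp.norm_apply_le (f.repr ⟨y, hy⟩) j
      rw [LinearIsometryEquiv.norm_map] at h1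
      exact h1.trans hyn
    have e : y = ∑ j, f.repr ⟨y, hy⟩ j • (f j : EuclideanSpace ℝ I) := by
      have := f.sum_repr ⟨y, hy⟩
      have := congrArg Subtype.val this
      simpa using this.symm
    refine ⟨fun j => (f.repr ⟨y, hy⟩ j + R₃) / (2 * R₃), ⟨fun j => ?_, fun j => ?_⟩, ?_⟩
    · have := (abs_le.1 (hc j)).1
      exact div_nonneg (by linarith) (by positivity)
    · have := (abs_le.1 (hc j)).2
      exact (div_le_one (by positivity)).2 (by linarith)
    · conv_rhs => rw [e]
      simp only [map_sum, map_smul, smul_smul]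
      rw [← Finset.sum_neg_distrib, ← Finset.sum_add_distrib]
      refine Finset.sum_congr rfl fun j _ => ?_
      rw [← neg_smul, ← add_smul]
      congr 1
      field_simp
      ring
  have hQ2 : ∀ x ∈ Q, ‖ψ x‖ ≤ k * R₃ := by
    rintro _ ⟨lam, hlam, rfl⟩
    have e : (-∑ j, (R₃ : ℝ) • φ (f j)) + ∑ j, lam j • ((2 * (R₃ : ℝ)) • φ (f j)) =
        φ (∑ j, (((2 * lam j - 1) * R₃) • (f j : EuclideanSpace ℝ I))) := by
      simp only [map_sum, map_smul, smul_smul]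
      rw [← Finset.sum_neg_distrib, ← Finset.sum_add_distrib]
      refine Finset.sum_congr rfl fun j _ => ?_
      rw [← neg_smul, ← add_smul]
      congr 1
      ring
    simp only [e]
    rw [hψφ _ (Submodule.sum_mem _ fun j _ => Submodule.smul_mem _ _ (f j).2)]
    refine (norm_sum_le _ _).trans ?_
    calc ∑ j, ‖((2 * lam j - 1) * R₃) • (f j : EuclideanSpace ℝ I)‖ ≤
          ∑ _j : Fin k, (R₃ : ℝ) := by
          refine Finset.sum_le_sum fun j _ => ?_
          have h1 : ‖(f j : EuclideanSpace ℝ I)‖ = 1 := f.orthonormal.1 j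
          have h2 : |2 * lam j - 1| ≤ 1 := by
            have := hlam.1 j; have := hlam.2 j
            simp only [Pi.zero_apply, Pi.one_apply] at *
            rw [abs_le]; constructor <;> linarith
          rw [norm_smul, h1, mul_one, Real.norm_eq_abs, abs_mul, Nat.abs_cast]
          exact mul_le_of_le_one_left (by positivity) h2
      _ = _ := by simp
  have hball := scaledLattice_ball N hN (R := R₁ + R₂ + 1) (by omega)
  rw [hI] at hball
  have hψι : ∀ t : Fin k → ℤ, scaledLattice N (∑ j, t j • w j) = ψ fun j => (t j : ℝ) := by
    intro t
    rw [hψ, map_sum]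
    refine Finset.sum_congr rfl fun j _ => ?_
    rw [map_zsmul]
    exact (Int.cast_smul_eq_zsmul ℝ _ _).symm
  have hwinj : Function.Injective fun t : Fin k → ℤ => ∑ j, t j • w j := by
    intro t t' h
    have h1 : scaledLattice N (∑ j, t j • w j) = scaledLattice N (∑ j, t' j • w j) :=
      congrArg _ h
    rw [hψι, hψι] at h1
    have h2 := congrArg φ h1
    simp only [φ, hφψ] at h2
    ext j
    exact_mod_cast congrFun h2 j
  have hTfin : {t : Fin k → ℤ | ‖ψ fun j => (t j : ℝ)‖ ≤ R₂}.Finite := by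
    refine Set.Finite.of_finite_image (hball.1.subset ?_) hwinj.injOn
    rintro _ ⟨t, ht, rfl⟩
    simp only [mem_ofPred_eq, hψι] at ht ⊢
    refine ht.trans ?_
    push_cast
    have : (0 : ℝ) ≤ R₁ := by positivity
    linarith
  refine ⟨r, hr, fun i => φ (u i), M, Q, ⟨_, _, rfl⟩, ?_, ?_⟩
  · intro n hn θ hθ
    have h1 : ‖scaledLattice N n‖ ≤ (q : ℝ) + 1 := by
      have := norm_scaledLattice_le hN (n := n) (Λ := 1) (by simpa using hn)
      rw [hI] at this
      push_cast at this
      linarith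
    obtain ⟨m, hm, w', hw', hw'n, e⟩ := hcov n h1
    refine ⟨m, hm, φ (w' + ψ θ), hQ1 _ (Submodule.add_mem _ hw' ?_) ?_, ?_⟩
    · rw [hWψ]; exact ⟨θ, rfl⟩
    · have h2 := hψn θ 1 (fun j => by
        have := hθ.1 j; have := hθ.2 j
        simp only [Pi.zero_apply, Pi.one_apply] at *
        rw [abs_le]; constructor <;> linarith)
      refine (norm_add_le _ _).trans ?_
      simp only [R₃]
      push_cast
      linarith
    · have h2 : (fun j => ((∑ i, n i • g i) j : ℝ)) = φ (scaledLattice N n) := by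
        ext j
        exact (scaledEval_scaledLattice hN g n j).symm
      rw [h2, e, _root_.map_add, _root_.map_add, show φ (ψ θ) = θ from hφψ θ, map_sum]
      simp only [map_zsmul, Int.cast_smul_eq_zsmul]
      abel
  · have hvol := volume_le_card_of_floor_mem (Q := Q) hTfin.toFinset (by
      intro x hx
      rw [Set.Finite.mem_toFinset, mem_ofPred_eq]
      have e : (fun j => ((⌊x j⌋ : ℤ) : ℝ)) = x - fun j => Int.fract (x j) := by
        ext j; exact (Int.self_sub_fract (x j)).symm
      rw [e, _root_.map_sub]
      have h2 := hψn (fun j => Int.fract (x j)) 1 (fun j => by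
        rw [abs_of_nonneg (Int.fract_nonneg _)]; exact (Int.fract_lt_one _).le)
      refine (norm_sub_le _ _).trans ?_
      have := hQ2 x hx
      simp only [R₂]
      push_cast
      linarith)
    refine (mul_le_mul_right hvol _).trans ?_
    rw [← card_intBox]
    norm_cast
    rw [← Finset.card_product]
    refine le_trans ?_ hball.2
    have hex : ∀ m : Fin r → ℤ, m ∈ intBox M → ∃ n, ‖scaledLattice N n‖ ≤ R₁ ∧
        scaledLattice N n - ∑ i, m i • u i ∈ W := by
      intro m hm
      obtain ⟨n, h1, h2⟩ := hshort m 1 (by simpa using mem_intBox.1 hm)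
      refine ⟨n, h1.trans ?_, h2⟩
      simp only [R₁]
      push_cast
      linarith
    choose! F hF1 hF2 using hex
    rw [← Set.ncard_coe_finset]
    refine Set.ncard_le_ncard_of_injOn (fun p => F p.1 + ∑ j, p.2 j • w j) ?_ ?_ hball.1
    · rintro ⟨m, t⟩ hp
      simp only [Finset.coe_product, Set.mem_prod, Finset.mem_coe, Set.Finite.mem_toFinset,
        mem_ofPred_eq] at hp ⊢
      rw [_root_.map_add, hψι]
      refine (norm_add_le _ _).trans ?_
      have := hF1 m hp.1
      push_cast
      linarith [hp.2]
    · rintro ⟨m, t⟩ hp ⟨m', t'⟩ hp' h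
      simp only [Finset.coe_product, Set.mem_prod, Finset.mem_coe] at hp hp' h
      have hW' : ∀ t : Fin k → ℤ, scaledLattice N (∑ j, t j • w j) ∈ W := by
        intro t; rw [hψι, hWψ]; exact ⟨_, rfl⟩
      have h1 : ∑ i, (m - m') i • u i = -(scaledLattice N (F m) - ∑ i, m i • u i) +
          (scaledLattice N (F m') - ∑ i, m' i • u i) +
          (scaledLattice N (∑ j, t' j • w j) - scaledLattice N (∑ j, t j • w j)) := by
        have h2 := congrArg (scaledLattice N) h
        rw [_root_.map_add, _root_.map_add] at h2
        have h3 : scaledLattice N (F m) = scaledLattice N (F m') +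
          scaledLattice N (∑ j, t' j • w j) - scaledLattice N (∑ j, t j • w j) := by
          rw [← h2]; abel
        rw [h3]
        simp only [Pi.sub_apply, sub_smul, Finset.sum_sub_distrib]; abel
      have h4 : ∑ i, (m - m') i • u i ∈ W := by
        rw [h1]
        exact Submodule.add_mem _ (Submodule.add_mem _ (Submodule.neg_mem _ (hF2 m hp.1))
          (hF2 m' hp'.1)) (Submodule.sub_mem _ (hW' _) (hW' _))
      have h5 : m = m' := sub_eq_zero.1 (hind _ h4)
      rw [h5] at h ⊢
      rw [hwinj (add_left_cancel h)]

/-- The half-open cube of side `m` with index `z` in the tiling of `ℝ^k` by such cubes. -/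
def tile {k : ℕ} (m : ℕ) (z : Fin k → ℤ) : Set (Fin k → ℝ) :=
  Set.pi univ fun j => Set.Ico ((m : ℝ) * z j) (m * z j + m)

lemma mem_tile {k m : ℕ} {z : Fin k → ℤ} {x : Fin k → ℝ} :
    x ∈ tile m z ↔ ∀ j, (m : ℝ) * z j ≤ x j ∧ x j < m * z j + m := by
  simp [tile]

lemma measurableSet_tile {k : ℕ} (m : ℕ) (z : Fin k → ℤ) : MeasurableSet (tile m z) :=
  MeasurableSet.univ_pi fun _ => measurableSet_Ico

lemma volume_tile {k : ℕ} (m : ℕ) (z : Fin k → ℤ) : volume (tile m z) = (m : ℝ≥0∞) ^ k := by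
  rw [tile, Real.volume_pi_Ico]
  simp

lemma volume_tile_one {k : ℕ} (z : Fin k → ℤ) : volume (tile 1 z) = 1 := by
  rw [volume_tile]; simp

lemma mem_tile_iff_floor {k m : ℕ} (hm : 1 ≤ m) {z : Fin k → ℤ} {x : Fin k → ℝ} :
    x ∈ tile m z ↔ z = fun j => ⌊x j / m⌋ := by
  have hm' : (0 : ℝ) < m := by exact_mod_cast hm
  rw [mem_tile, funext_iff]
  refine forall_congr' fun j => ?_
  rw [eq_comm, Int.floor_eq_iff, le_div_iff₀ hm', div_lt_iff₀ hm']
  constructor <;> rintro ⟨h1, h2⟩ <;> constructor <;> linarith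

lemma mem_tile_one {k : ℕ} {z : Fin k → ℤ} {x : Fin k → ℝ} :
    x ∈ tile 1 z ↔ z = fun j => ⌊x j⌋ := by
  rw [mem_tile_iff_floor le_rfl]; simp

lemma pairwise_disjoint_tile {k m : ℕ} (hm : 1 ≤ m) :
    Pairwise (Function.onFun Disjoint (tile (k := k) m)) := by
  intro z z' hne
  rw [Function.onFun, Set.disjoint_left]
  intro x hx hx'
  rw [mem_tile_iff_floor hm] at hx hx'
  exact hne (hx.trans hx'.symm)

/-- The unit cells making up the tile of side `m` with index `s`. -/
noncomputable def subcells {k : ℕ} (m : ℕ) (s : Fin k → ℤ) : Finset (Fin k → ℤ) :=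
  Fintype.piFinset fun j => Finset.Ico (m * s j) (m * s j + m)

lemma mem_subcells {k m : ℕ} {s z : Fin k → ℤ} :
    z ∈ subcells m s ↔ ∀ j, m * s j ≤ z j ∧ z j < m * s j + m := by
  simp [subcells, Fintype.mem_piFinset]

lemma card_subcells {k : ℕ} (m : ℕ) (s : Fin k → ℤ) : (subcells m s).card = m ^ k := by
  simp [subcells]

lemma tile_one_subset {k m : ℕ} {s z : Fin k → ℤ} (h : z ∈ subcells m s) :
    tile 1 z ⊆ tile m s := by
  intro x hx
  rw [mem_tile] at hx ⊢
  intro j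
  have h1 := hx j
  have h2 := mem_subcells.1 h j
  have h3 : (m : ℝ) * s j ≤ z j := by exact_mod_cast h2.1
  have h4 : (z j : ℝ) + 1 ≤ m * s j + m := by exact_mod_cast h2.2
  push_cast at h1
  constructor <;> linarith [h1.1, h1.2]

lemma dist_le_of_mem_tile {k m : ℕ} {z : Fin k → ℤ} {x y : Fin k → ℝ} (hx : x ∈ tile m z)
    (hy : y ∈ tile m z) : dist x y ≤ m := by
  rw [dist_pi_le_iff (by positivity)]
  intro j
  have h1 := mem_tile.1 hx j
  have h2 := mem_tile.1 hy j
  rw [Real.dist_eq, abs_le]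
  constructor <;> linarith [h1.1, h1.2, h2.1, h2.2]

lemma disjoint_subcells {k m : ℕ} (hm : 1 ≤ m) {s s' : Fin k → ℤ} (h : s ≠ s') :
    Disjoint (subcells m s) (subcells m s') := by
  rw [Finset.disjoint_left]
  intro z hz hz'
  have hne : (fun j => (z j : ℝ)) ∈ tile 1 z := by
    rw [mem_tile]; intro j; simp
  exact Set.disjoint_left.1 (pairwise_disjoint_tile hm h) (tile_one_subset hz hne)
    (tile_one_subset hz' hne)

/-- A set squeezed between a bounded set and a neighbourhood of nearly the same measure fills most
of its cells almost completely. -/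
lemma exists_full_cells {k m : ℕ} (hm : 1 ≤ m) {η : ℝ} (hη : 0 < η) (hη1 : η < 1)
    {A K U : Set (Fin k → ℝ)} (hA : MeasurableSet A) (hKA : K ⊆ A)
    (hKb : Bornology.IsBounded K) (hU : volume U ≠ ⊤) (hAU : A ⊆ U)
    (hA0 : 0 < volume A)
    (hKU : volume.real (U \ K) ≤ η ^ 2 / (2 * m ^ k) * volume.real A)
    (hnear : ∀ x ∈ K, ∀ y, dist x y ≤ m → y ∈ U) :
    ∃ S : Finset (Fin k → ℤ), S.Nonempty ∧ (∀ z ∈ S, volume.real (tile 1 z \ A) ≤ η) ∧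
      (1 - η) * volume.real A ≤ S.card ∧ ∀ j : Fin k, ∃ z : Fin k → ℤ, ∀ t : ℕ, t < m → z + (Pi.single j (t : ℤ) : Fin k → ℤ) ∈ S := by
  classical
  have hm0 : (0 : ℝ) < (m : ℝ) ^ k := by have : (0 : ℝ) < m := by exact_mod_cast hm
                                         positivity
  have hm1 : (1 : ℝ) ≤ (m : ℝ) ^ k := one_le_pow₀ (by exact_mod_cast hm)
  have hAf : volume A ≠ ⊤ := ne_top_of_le_ne_top hU (measure_mono hAU)
  have hA0' : 0 < volume.real A := ENNReal.toReal_pos hA0.ne' hAf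
  have hFfin : {s : Fin k → ℤ | (tile m s ∩ K).Nonempty}.Finite := by
    obtain ⟨B, hB⟩ := hKb.exists_norm_le
    obtain ⟨b, hb⟩ := exists_nat_ge B
    refine (Set.finite_Icc (fun _ : Fin k => -(b : ℤ) - 1) (fun _ => (b : ℤ) + 1)).subset ?_
    rintro s ⟨x, hx, hxK⟩
    have hx1 : ∀ j, |x j| ≤ b := fun j => (norm_le_pi_norm x j).trans ((hB x hxK).trans hb)
    have hm' : (1 : ℝ) ≤ m := by exact_mod_cast hm
    have hb0 : (0 : ℝ) ≤ b := by positivity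
    rw [mem_tile] at hx
    refine ⟨fun j => ?_, fun j => ?_⟩
    · by_contra! hlt
      have h2 : (s j : ℝ) + 1 ≤ -b - 1 := by exact_mod_cast Int.add_one_le_iff.2 hlt
      have := (abs_le.1 (hx1 j)).1
      nlinarith [(hx j).2]
    · by_contra! hlt
      have h2 : (b : ℝ) + 1 ≤ s j := by exact_mod_cast hlt.le
      have := (abs_le.1 (hx1 j)).2
      nlinarith [(hx j).1]
  obtain ⟨F, hF⟩ : ∃ F : Finset (Fin k → ℤ), ∀ s, s ∈ F ↔ (tile m s ∩ K).Nonempty :=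
    ⟨hFfin.toFinset, fun s => by simp⟩
  have hFU : ∀ s ∈ F, tile m s ⊆ U := by
    intro s hs y hy
    obtain ⟨x, hx, hxK⟩ := (hF s).1 hs
    exact hnear x hxK y (dist_le_of_mem_tile hx hy)
  let G := F.filter fun s => volume.real (tile m s \ A) ≤ η
  let B := F.filter fun s => ¬ volume.real (tile m s \ A) ≤ η
  have hGB : G.card + B.card = F.card := Finset.card_filter_add_card_filter_not _
  have hBad : η * B.card ≤ volume.real (U \ K) := by
    have h1 : volume.real (⋃ s ∈ B, (tile m s \ A)) = ∑ s ∈ B, volume.real (tile m s \ A) := by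
      refine measureReal_biUnion_finset ?_ ?_ ?_
      · intro s _ s' _ h
        exact (pairwise_disjoint_tile hm h).mono sdiff_subset sdiff_subset
      · exact fun s _ => (measurableSet_tile m s).diff hA
      · intro s _
        exact ne_top_of_le_ne_top (by rw [volume_tile]; simp) (measure_mono (sdiff_subset (s := tile m s)))
    calc η * B.card = ∑ _s ∈ B, η := by simp [mul_comm]
      _ ≤ ∑ s ∈ B, volume.real (tile m s \ A) :=
          Finset.sum_le_sum fun s hs => (not_le.1 (Finset.mem_filter.1 hs).2).le
      _ = volume.real (⋃ s ∈ B, (tile m s \ A)) := h1.symm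
      _ ≤ volume.real (U \ K) := by
          refine measureReal_mono ?_ (ne_top_of_le_ne_top hU (measure_mono sdiff_subset))
          refine iUnion₂_subset fun s hs => ?_
          exact sdiff_subset_sdiff (hFU s (Finset.mem_filter.1 hs).1) hKA
  have hKF : volume.real K ≤ m ^ k * F.card := by
    have h1 : K ⊆ ⋃ s ∈ F, tile m s := by
      intro x hx
      have : x ∈ tile m fun j => ⌊x j / m⌋ := (mem_tile_iff_floor hm).2 rfl
      exact Set.mem_biUnion ((hF _).2 ⟨x, this, hx⟩) this
    have h2 : volume (⋃ s ∈ F, tile m s) ≤ ENNReal.ofReal (m ^ k * F.card) := by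
      refine (measure_biUnion_finset_le _ _).trans ?_
      simp only [volume_tile]
      rw [ENNReal.ofReal_mul hm0.le, ENNReal.ofReal_pow (by positivity)]
      simp [mul_comm]
    exact ENNReal.toReal_le_of_le_ofReal (by positivity) ((measure_mono h1).trans h2)
  have hKA' : volume.real A - volume.real (U \ K) ≤ volume.real K := by
    have h1 : volume.real A ≤ volume.real (K ∪ U \ K) := by
      refine measureReal_mono (fun x hx => ?_) ?_
      · by_cases hxK : x ∈ K
        · exact Or.inl hxK
        · exact Or.inr ⟨hAU hx, hxK⟩
      · refine ne_top_of_le_ne_top hU (measure_mono (union_subset (hKA.trans hAU) sdiff_subset))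
    have := measureReal_union_le (μ := volume) K (U \ K)
    linarith
  let S := G.biUnion (subcells m)
  have hScard : S.card = G.card * m ^ k := by
    rw [Finset.card_biUnion fun s _ s' _ h => disjoint_subcells hm h]
    simp [card_subcells]
  have hSge : (1 - η) * volume.real A ≤ S.card := by
    rw [hScard]
    push_cast
    have h1 : (G.card : ℝ) = F.card - B.card := by rw [← hGB]; push_cast; ring
    have h2 : m ^ k * (B.card : ℝ) ≤ η / 2 * volume.real A := by
      have : η * (m ^ k * B.card) ≤ η * (η / 2 * volume.real A) := by
        calc η * (m ^ k * B.card) = m ^ k * (η * B.card) := by ring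
          _ ≤ m ^ k * (η ^ 2 / (2 * m ^ k) * volume.real A) := by
            exact mul_le_mul_of_nonneg_left (hBad.trans hKU) hm0.le
          _ = _ := by field_simp
      exact le_of_mul_le_mul_left this hη
    have h3 : volume.real (U \ K) ≤ η / 2 * volume.real A := by
      refine hKU.trans ?_
      gcongr ?_ * _
      rw [div_le_div_iff₀ (by positivity) (by positivity)]
      nlinarith
    rw [h1]
    linarith
  have hGne : G.Nonempty := by
    rw [Finset.nonempty_iff_ne_empty]
    intro h
    have : S.card = 0 := by rw [hScard, h]; simp
    rw [this] at hSge
    have : 0 < (1 - η) * volume.real A := mul_pos (by linarith) hA0'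
    simp at hSge; linarith
  obtain ⟨s, hs⟩ := hGne
  have hcorner : (fun j => (m : ℤ) * s j) ∈ subcells m s := by
    rw [mem_subcells]; intro j; constructor <;> linarith [(by exact_mod_cast hm : (1 : ℤ) ≤ m)]
  refine ⟨S, ⟨_, Finset.mem_biUnion.2 ⟨s, hs, hcorner⟩⟩, ?_, hSge, ?_⟩
  · intro z hz
    obtain ⟨s', hs', hz'⟩ := Finset.mem_biUnion.1 hz
    refine le_trans (measureReal_mono (sdiff_subset_sdiff_left (tile_one_subset hz')) ?_)
      (Finset.mem_filter.1 hs').2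
    exact ne_top_of_le_ne_top (by rw [volume_tile]; simp) (measure_mono (sdiff_subset (s := tile m s')))
  · intro j
    refine ⟨fun j => (m : ℤ) * s j, fun t ht => Finset.mem_biUnion.2 ⟨s, hs, ?_⟩⟩
    rw [mem_subcells]
    intro i
    rw [Pi.add_apply]
    by_cases hij : i = j
    · subst hij
      simp only [Pi.single_eq_same]
      constructor <;> omega
    · rw [Pi.single_eq_of_ne hij]
      constructor <;> linarith [(by exact_mod_cast hm : (1 : ℤ) ≤ m)]

/-- Every set of finite positive measure is, at a small enough scale, nearly a union of cells. -/
lemma exists_discretization {k m : ℕ} (hm : 1 ≤ m) {η : ℝ} (hη : 0 < η) (hη1 : η < 1)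
    {A : Set (Fin k → ℝ)} (hA : MeasurableSet A) (hA0 : 0 < volume A) (hAf : volume A < ⊤) :
    ∃ δ : ℝ, 0 < δ ∧ ∃ S : Finset (Fin k → ℤ), S.Nonempty ∧
      (∀ z ∈ S, volume.real (tile 1 z \ δ⁻¹ • A) ≤ η) ∧
      (1 - η) * volume.real (δ⁻¹ • A) ≤ S.card ∧
      ∀ j : Fin k, ∃ z : Fin k → ℤ, ∀ t : ℕ, t < m → z + (Pi.single j (t : ℤ) : Fin k → ℤ) ∈ S := by
  have hm0 : (0 : ℝ) < m := by exact_mod_cast hm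
  have hA0' : 0 < volume.real A := ENNReal.toReal_pos hA0.ne' hAf.ne
  obtain ⟨τ, hτ⟩ : ∃ τ : ℝ, τ = η ^ 2 / (2 * m ^ k) * volume.real A := ⟨_, rfl⟩
  have hτ0 : 0 < τ := by rw [hτ]; positivity
  have hτ' : ENNReal.ofReal (τ / 2) ≠ 0 := by simpa using hτ0
  obtain ⟨K, hKA, hK, hAK⟩ := hA.exists_isCompact_sdiff_lt hAf.ne hτ'
  obtain ⟨U, hAU, hU, hUf, hUA⟩ := hA.exists_isOpen_sdiff_lt hAf.ne hτ'
  obtain ⟨ρ, hρ, hρU⟩ := hK.exists_cthickening_subset_open hU (hKA.trans hAU)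
  have hδ : 0 < ρ / m := by positivity
  refine ⟨ρ / m, hδ, ?_⟩
  have hδ0 : (ρ / m)⁻¹ ≠ 0 := by positivity
  have hscale : ∀ B : Set (Fin k → ℝ), volume ((ρ / m)⁻¹ • B) =
      ENNReal.ofReal ((ρ / m)⁻¹ ^ k) * volume B := by
    intro B
    rw [Measure.addHaar_smul]
    simp only [Module.finrank_fintype_fun_eq_card, Fintype.card_fin]
    rw [abs_of_nonneg (by positivity)]
  refine exists_full_cells (K := (ρ / m)⁻¹ • K) (U := (ρ / m)⁻¹ • U) hm hη hη1
    (hA.const_smul₀ _) (smul_set_mono hKA)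
    (hK.isBounded.smul₀ _) ?_ (smul_set_mono hAU) ?_ ?_ ?_
  · rw [hscale]; exact ENNReal.mul_ne_top ofReal_ne_top hUf.ne
  · rw [hscale]
    exact ENNReal.mul_pos (by simp; positivity) hA0.ne'
  · rw [← smul_set_sdiff₀ hδ0, measureReal_def, measureReal_def, hscale, hscale, toReal_mul,
      toReal_mul]
    have h1 : (volume (U \ K)).toReal ≤ τ := by
      have h2 : volume (U \ K) ≤ ENNReal.ofReal τ := by
        calc volume (U \ K) ≤ volume (U \ A ∪ A \ K) := by
              refine measure_mono fun x hx => ?_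
              by_cases hxA : x ∈ A
              · exact Or.inr ⟨hxA, hx.2⟩
              · exact Or.inl ⟨hx.1, hxA⟩
          _ ≤ volume (U \ A) + volume (A \ K) := measure_union_le _ _
          _ ≤ ENNReal.ofReal (τ / 2) + ENNReal.ofReal (τ / 2) := add_le_add hUA.le hAK.le
          _ = ENNReal.ofReal τ := by
            rw [← ENNReal.ofReal_add (by positivity) (by positivity)]; congr 1; ring
      exact ENNReal.toReal_le_of_le_ofReal hτ0.le h2
    rw [hτ, measureReal_def] at h1
    calc _ ≤ (ENNReal.ofReal ((ρ / m)⁻¹ ^ k)).toReal * (η ^ 2 / (2 * m ^ k) * (volume A).toReal) := by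
          gcongr
      _ = _ := by ring
  · rintro _ ⟨x, hx, rfl⟩ y hy
    rw [mem_inv_smul_set_iff₀ hδ.ne']
    refine hρU (Metric.mem_cthickening_of_dist_le _ x _ _ hx ?_)
    have e : dist ((ρ / m) • y) x = (ρ / m) * dist y ((ρ / m)⁻¹ • x) := by
      conv_lhs => rw [← smul_inv_smul₀ hδ.ne' x]
      rw [dist_smul₀, Real.norm_eq_abs, abs_of_pos hδ]
    rw [e, dist_comm]
    calc ρ / m * dist ((ρ / m)⁻¹ • x) y ≤ ρ / m * m := by gcongr
      _ = ρ := by field_simp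

lemma sum_measureReal_le_of_disjoint {α ι : Type*} [MeasurableSpace α] {μ : Measure α}
    {t : Finset ι} {B : ι → Set α} {E : Set α} (hB : ∀ i ∈ t, MeasurableSet (B i))
    (hd : Set.PairwiseDisjoint (↑t) B) (hE : ∀ i ∈ t, B i ⊆ E) (hf : μ E ≠ ⊤) :
    ∑ i ∈ t, μ.real (B i) ≤ μ.real E := by
  rw [← measureReal_biUnion_finset hd hB fun i hi => ne_top_of_le_ne_top hf (measure_mono (hE i hi))]
  exact measureReal_mono (iUnion₂_subset hE) hf

/-- The union of the cells with indices in `T`. -/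
def cells {k : ℕ} (T : Finset (Fin k → ℤ)) : Set (Fin k → ℝ) := ⋃ z ∈ T, tile 1 z

lemma mem_cells {k : ℕ} {T : Finset (Fin k → ℤ)} {x : Fin k → ℝ} :
    x ∈ cells T ↔ (fun j => ⌊x j⌋) ∈ T := by
  simp [cells, mem_tile_one]

lemma measurableSet_cells {k : ℕ} (T : Finset (Fin k → ℤ)) : MeasurableSet (cells T) :=
  T.measurableSet_biUnion fun z _ => measurableSet_tile 1 z

lemma floor_sub_floor_mem {a b : ℝ} : ⌊a + b⌋ = ⌊a⌋ + ⌊b⌋ ∨ ⌊a + b⌋ = ⌊a⌋ + ⌊b⌋ + 1 := by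
  have h1 := Int.le_floor_add a b
  have h2 := Int.le_floor_add_floor a b
  omega

lemma volume_real_cell_inter_ge {k : ℕ} {A : Set (Fin k → ℝ)} {η : ℝ}
    {z : Fin k → ℤ} (hz : volume.real (tile 1 z \ A) ≤ η) :
    1 - η ≤ volume.real (A ∩ tile 1 z) := by
  have h1 : volume.real (tile 1 z) = 1 := by rw [measureReal_def, volume_tile_one]; simp
  have h2 : volume.real (tile 1 z) ≤ volume.real (A ∩ tile 1 z) + volume.real (tile 1 z \ A) := by
    refine le_trans (measureReal_mono (fun x hx => ?_) ?_) (measureReal_union_le _ _)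
    · by_cases h : x ∈ A
      · exact Or.inl ⟨h, hx⟩
      · exact Or.inr ⟨hx, h⟩
    · refine ne_top_of_le_ne_top (b := volume (tile 1 z)) (by rw [volume_tile_one]; simp) (measure_mono ?_)
      exact union_subset inter_subset_right sdiff_subset
  linarith

lemma volume_real_inter_cells_ge {k : ℕ} {A : Set (Fin k → ℝ)} (hA : MeasurableSet A) {η : ℝ}
    (T : Finset (Fin k → ℤ)) (hT : ∀ z ∈ T, volume.real (tile 1 z \ A) ≤ η)
    {E : Set (Fin k → ℝ)} (hE : A ∩ cells T ⊆ E) (hEf : volume E ≠ ⊤) :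
    (1 - η) * T.card ≤ volume.real E := by
  calc (1 - η) * T.card = ∑ _z ∈ T, (1 - η) := by rw [Finset.sum_const, nsmul_eq_mul, mul_comm]
    _ ≤ ∑ z ∈ T, volume.real (A ∩ tile 1 z) :=
        Finset.sum_le_sum fun z hz => volume_real_cell_inter_ge (hT z hz)
    _ ≤ _ := sum_measureReal_le_of_disjoint (fun z _ => hA.inter (measurableSet_tile 1 z))
        (fun z _ z' _ h => (pairwise_disjoint_tile le_rfl h).mono inter_subset_right
          inter_subset_right)
        (fun z hz x hx => hE ⟨hx.1, Set.mem_biUnion hz hx.2⟩) hEf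

/-- The translate of a cell by half of its diagonal. -/
def halfCell {k : ℕ} (z : Fin k → ℤ) : Set (Fin k → ℝ) :=
  (fun _ : Fin k => (1 / 2 : ℝ)) +ᵥ tile 1 z

lemma mem_halfCell {k : ℕ} {z : Fin k → ℤ} {x : Fin k → ℝ} :
    x ∈ halfCell z ↔ ∀ j, (z j : ℝ) + 1 / 2 ≤ x j ∧ x j < z j + 3 / 2 := by
  rw [halfCell, mem_vadd_set_iff_neg_vadd_mem, mem_tile]
  refine forall_congr' fun j => ?_
  simp only [vadd_eq_add, Pi.add_apply, Pi.neg_apply]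
  push_cast
  constructor <;> rintro ⟨h1, h2⟩ <;> constructor <;> linarith

/-- The sum of two nearly full cells contains a whole translated cell. -/
lemma halfCell_subset_add {k : ℕ} {A : Set (Fin k → ℝ)} {η : ℝ}
    (hη : 2 * η < (1 / 2) ^ k) {z w : Fin k → ℤ} (hz : volume.real (tile 1 z \ A) ≤ η)
    (hw : volume.real (tile 1 w \ A) ≤ η) :
    halfCell (z + w) ⊆ A ∩ tile 1 z + A ∩ tile 1 w := by
  intro x hx
  rw [mem_halfCell] at hx
  let J : Set (Fin k → ℝ) := Set.pi univ fun j =>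
    Set.Ioo (max (z j : ℝ) (x j - w j - 1)) (min ((z j : ℝ) + 1) (x j - w j))
  have hJ : (1 / 2 : ℝ) ^ k ≤ volume.real J := by
    have h1 : ENNReal.ofReal ((1 / 2) ^ k) ≤ volume J := by
      rw [Real.volume_pi_Ioo, ENNReal.ofReal_pow (by norm_num)]
      calc (ENNReal.ofReal (1 / 2)) ^ k = ∏ _j : Fin k, ENNReal.ofReal (1 / 2) := by simp
        _ ≤ _ := by
          refine Finset.prod_le_prod' fun j _ => ENNReal.ofReal_le_ofReal ?_
          have := hx j
          simp only [Pi.add_apply, Int.cast_add] at this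
          rcases max_choice (z j : ℝ) (x j - w j - 1) with h | h <;>
          rcases min_choice ((z j : ℝ) + 1) (x j - w j) with h' | h' <;> rw [h, h'] <;> linarith
    rw [measureReal_def]
    refine (ENNReal.ofReal_le_iff_le_toReal ?_).1 h1
    rw [Real.volume_pi_Ioo]
    exact ENNReal.prod_ne_top fun j _ => ofReal_ne_top
  have hmem : ∀ y ∈ J, y ∈ tile 1 z ∧ x - y ∈ tile 1 w := by
    intro y hy
    have h1 : ∀ j, y j ∈ Set.Ioo (max (z j : ℝ) (x j - w j - 1)) (min ((z j : ℝ) + 1) (x j - w j)) :=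
      fun j => hy j (mem_univ j)
    simp only [mem_tile, Pi.sub_apply]
    constructor <;> intro j <;> obtain ⟨h2, h3⟩ := h1 j <;> rw [max_lt_iff] at h2 <;>
      rw [lt_min_iff] at h3 <;> push_cast <;> constructor <;> linarith [h2.1, h2.2, h3.1, h3.2]
  by_contra hne
  have hsub : J ⊆ (tile 1 z \ A) ∪ ((fun y => x - y) ⁻¹' (tile 1 w \ A)) := by
    intro y hy
    obtain ⟨h1, h2⟩ := hmem y hy
    by_cases hyA : y ∈ A
    · refine Or.inr ⟨h2, fun hA => hne ?_⟩
      exact ⟨y, ⟨hyA, h1⟩, x - y, ⟨hA, h2⟩, by simp⟩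
    · exact Or.inl ⟨h1, hyA⟩
  have hpre : volume ((fun y => x - y) ⁻¹' (tile 1 w \ A)) = volume (tile 1 w \ A) :=
    (Measure.measurePreserving_sub_left volume x).measure_preimage_equiv (f := MeasurableEquiv.subLeft x) _
  have h2 := measureReal_mono (μ := volume) hsub (by
    refine ne_of_lt ((measure_union_le _ _).trans_lt (ENNReal.add_lt_top.2 ⟨?_, ?_⟩))
    · exact (measure_mono sdiff_subset).trans_lt (by rw [volume_tile_one]; simp)
    · rw [hpre]
      exact (measure_mono sdiff_subset).trans_lt (by rw [volume_tile_one]; simp))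
  have h3 := measureReal_union_le (μ := volume) (tile 1 z \ A)
    ((fun y => x - y) ⁻¹' (tile 1 w \ A))
  have h4 : volume.real ((fun y => x - y) ⁻¹' (tile 1 w \ A)) = volume.real (tile 1 w \ A) := by
    rw [measureReal_def, hpre, measureReal_def]
  linarith

lemma card_add_le_volume_real {k : ℕ} {A : Set (Fin k → ℝ)} {η : ℝ}
    (hη : 2 * η < (1 / 2) ^ k) (T T' : Finset (Fin k → ℤ))
    (hT : ∀ z ∈ T, volume.real (tile 1 z \ A) ≤ η) (hT' : ∀ z ∈ T', volume.real (tile 1 z \ A) ≤ η)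
    {E : Set (Fin k → ℝ)} (hE : A ∩ cells T + A ∩ cells T' ⊆ E) (hEf : volume E ≠ ⊤) :
    ((T + T').card : ℝ) ≤ volume.real E := by
  calc ((T + T').card : ℝ) = ∑ u ∈ T + T', volume.real (halfCell u) := by
        simp [halfCell, measureReal_def, measure_vadd, volume_tile_one]
    _ ≤ volume.real E := by
        refine sum_measureReal_le_of_disjoint (fun u _ => (measurableSet_tile 1 u).const_vadd _)
          (fun u _ u' _ h => ?_) (fun u hu => ?_) hEf
        · exact (Set.disjoint_vadd_set (a := (fun _ : Fin k => (1 / 2 : ℝ)))).2 (pairwise_disjoint_tile le_rfl h)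
        · obtain ⟨z, hz, w, hw, rfl⟩ := Finset.mem_add.1 hu
          refine (halfCell_subset_add hη (hT z hz) (hT' w hw)).trans (subset_trans ?_ hE)
          exact add_subset_add (inter_subset_inter_right _ (subset_biUnion_of_mem (u := tile 1) hz))
            (inter_subset_inter_right _ (subset_biUnion_of_mem (u := tile 1) hw))

lemma abs_floor_combination_le_one {x y u v : ℝ} (h : x + u = y + v) :
    |⌊x⌋ - ⌊y⌋ - (⌊v⌋ - ⌊u⌋)| ≤ 1 := by
  have h1 : ((⌊x⌋ - ⌊y⌋ - (⌊v⌋ - ⌊u⌋) : ℤ) : ℝ) < 2 := by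
    push_cast
    linarith [Int.floor_le x, Int.lt_floor_add_one y, Int.floor_le u, Int.lt_floor_add_one v]
  have h2 : (-2 : ℝ) < ((⌊x⌋ - ⌊y⌋ - (⌊v⌋ - ⌊u⌋) : ℤ) : ℝ) := by
    push_cast
    linarith [Int.floor_le y, Int.lt_floor_add_one x, Int.floor_le v, Int.lt_floor_add_one u]
  have h3 : ⌊x⌋ - ⌊y⌋ - (⌊v⌋ - ⌊u⌋) < 2 := by exact_mod_cast h1
  have h4 : -2 < ⌊x⌋ - ⌊y⌋ - (⌊v⌋ - ⌊u⌋) := by exact_mod_cast h2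
  rw [abs_le]; omega

set_option maxHeartbeats 1000000 in
/-- All cells met by a set of small doubling lie in a progression of bounded rank. -/
lemma exists_cell_cover (k D : ℕ) : ∃ q C : ℕ, ∀ (A : Set (Fin k → ℝ)) (η : ℝ)
    (S : Finset (Fin k → ℤ)), MeasurableSet A → 2 * η < (1 / 2) ^ k → η ≤ 1 / 4 → S.Nonempty →
    (∀ z ∈ S, volume.real (tile 1 z \ A) ≤ η) → (1 - η) * volume.real A ≤ S.card →
    volume (A + A) ≠ ⊤ → volume.real (A + A) ≤ 2 ^ D * volume.real A →
    ∃ (I : Type) (_ : Fintype I), Fintype.card I ≤ q ∧ ∃ (N : I → ℕ) (g : I → Fin k → ℤ),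
      (∀ i, 1 ≤ N i) ∧
      (∀ z, (A ∩ tile 1 z).Nonempty → ∃ n : I → ℤ, (∀ i, |n i| ≤ N i) ∧ z = ∑ i, n i • g i) ∧
      (∀ j, ∃ n : I → ℤ, (∀ i, |n i| ≤ N i) ∧ Pi.single j 1 = ∑ i, n i • g i) ∧
      ∏ i, (2 * N i + 1) ≤ C * S.card := by
  classical
  obtain ⟨r₀, t₀, C₀, hfc⟩ := freiman_covering k (2 ^ (D + 1))
  refine ⟨r₀ + k + 2 ^ (D + 1) * 2 * t₀, C₀ * 3 ^ (r₀ + k + 2 ^ (D + 1) * 2 * t₀), ?_⟩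
  intro A η S hA hη hη4 hSne hS hScard hAAf hAA
  have hAS : volume.real A ≤ 4 / 3 * S.card := by nlinarith [measureReal_nonneg (μ := volume) (s := A)]
  have hAAS : volume.real (A + A) ≤ 2 ^ (D + 1) * S.card := by
    refine hAA.trans ?_
    rw [pow_succ, mul_assoc]
    have : (0 : ℝ) ≤ S.card := by positivity
    gcongr
    linarith
  have hSS : (S + S).card ≤ 2 ^ (D + 1) * S.card := by
    have := card_add_le_volume_real hη S S hS hS
      (add_subset_add inter_subset_left inter_subset_left) hAAf
    exact_mod_cast this.trans hAAS
  obtain ⟨r, hr, v, N, X, hX, hprod, hcov⟩ := hfc S hSne hSS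
  -- a translate of the progression containing a positive proportion of `S`
  let P : (Fin k → ℤ) → Finset (Fin k → ℤ) := fun x =>
    S.filter fun s => ∃ n : Fin r → ℤ, (∀ i, |n i| ≤ N i) ∧ s = x + ∑ i, n i • v i
  obtain ⟨x₀, hx₀⟩ : ∃ x₀, S.card ≤ t₀ * (P x₀).card := by
    have h1 : S ⊆ X.biUnion P := by
      intro s hs
      obtain ⟨x, hx, n, hn, e⟩ := hcov s hs
      exact Finset.mem_biUnion.2 ⟨x, hx, Finset.mem_filter.2 ⟨hs, n, hn, e⟩⟩
    have hXne : X.Nonempty := by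
      obtain ⟨s, hs⟩ := hSne
      obtain ⟨x, hx, -⟩ := hcov s hs
      exact ⟨x, hx⟩
    obtain ⟨x₀, -, hmax⟩ := X.exists_max_image (fun x => (P x).card) hXne
    refine ⟨x₀, (Finset.card_le_card h1).trans (Finset.card_biUnion_le.trans ?_)⟩
    refine (Finset.sum_le_card_nsmul X _ _ hmax).trans ?_
    rw [smul_eq_mul]
    gcongr
  have hPne : 0 < (P x₀).card := by
    by_contra h
    have : (P x₀).card = 0 := by omega
    rw [this, mul_zero] at hx₀
    exact absurd hSne.card_pos (by omega)
  have hPS : P x₀ ⊆ S := Finset.filter_subset _ _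
  have hf : ∀ z, (A ∩ tile 1 z).Nonempty → ∃ x, x ∈ A ∧ x ∈ tile 1 z := fun z ⟨x, h⟩ => ⟨x, h⟩
  choose! f hfA hfz using hf
  let E : Set (Fin k → ℝ) := A ∩ cells (P x₀)
  have hE : MeasurableSet E := hA.inter (measurableSet_cells _)
  have hAne : A.Nonempty := by
    obtain ⟨s, hs⟩ := hSne
    by_contra h
    rw [Set.not_nonempty_iff_eq_empty] at h
    have := hS s hs
    rw [h, Set.sdiff_empty, measureReal_def, volume_tile_one] at this
    norm_num at this
    linarith
  have hAf : volume A ≠ ⊤ := by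
    obtain ⟨a, ha⟩ := hAne
    have h1 : volume (a +ᵥ A) ≤ volume (A + A) := measure_mono (by
      rintro _ ⟨b, hb, rfl⟩; exact Set.add_mem_add ha hb)
    rw [measure_vadd] at h1
    exact ne_top_of_le_ne_top hAAf h1
  have hEvol : 3 / 4 * ((P x₀).card : ℝ) ≤ volume.real E := by
    have := volume_real_inter_cells_ge hA (P x₀) (fun z hz => hS z (hPS hz)) (E := E) subset_rfl
      (ne_top_of_le_ne_top hAf (measure_mono inter_subset_left))
    have : (0 : ℝ) ≤ (P x₀).card := by positivity
    nlinarith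
  let good : Finset (Fin k → ℤ) → Prop := fun Z => (∀ z ∈ Z, (A ∩ tile 1 z).Nonempty) ∧
    ∀ z ∈ Z, ∀ z' ∈ Z, z ≠ z' → Disjoint (f z +ᵥ E) (f z' +ᵥ E)
  have hgood : ∀ Z, good Z → Z.card ≤ 2 ^ (D + 1) * 2 * t₀ := by
    intro Z hZ
    have h1 : ∑ z ∈ Z, volume.real (f z +ᵥ E) ≤ volume.real (A + A) := by
      refine sum_measureReal_le_of_disjoint (fun z _ => hE.const_vadd _)
        (fun z hz z' hz' h => hZ.2 z hz z' hz' h) (fun z hz => ?_) hAAf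
      rintro _ ⟨y, hy, rfl⟩
      exact Set.add_mem_add (hfA z (hZ.1 z hz)) hy.1
    have h2 : ∀ z ∈ Z, volume.real (f z +ᵥ E) = volume.real E := fun z _ => by
      rw [measureReal_def, measure_vadd, measureReal_def]
    rw [Finset.sum_congr rfl h2, Finset.sum_const, nsmul_eq_mul] at h1
    have h3 : (S.card : ℝ) ≤ t₀ * (P x₀).card := by exact_mod_cast hx₀
    have h4 : (Z.card : ℝ) * (3 / 4 * (P x₀).card) ≤ 2 ^ (D + 1) * (t₀ * (P x₀).card) :=
      calc (Z.card : ℝ) * (3 / 4 * (P x₀).card) ≤ Z.card * volume.real E := by gcongr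
        _ ≤ 2 ^ (D + 1) * S.card := h1.trans hAAS
        _ ≤ _ := by gcongr
    have h5 : (0 : ℝ) < (P x₀).card := by exact_mod_cast hPne
    have h6 : (Z.card : ℝ) * (3 / 4) ≤ 2 ^ (D + 1) * t₀ := by
      refine le_of_mul_le_mul_right ?_ h5
      linarith
    have h7 : (Z.card : ℝ) ≤ 2 ^ (D + 1) * 2 * t₀ := by
      have : (0 : ℝ) ≤ Z.card := by positivity
      linarith
    exact_mod_cast h7
  obtain ⟨Z, hZ, hmax⟩ : ∃ Z, good Z ∧ ∀ Z', good Z' → Z'.card ≤ Z.card := by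
    let p : ℕ → Prop := fun n => ∃ Z, good Z ∧ Z.card = n
    have hp0 : p 0 := ⟨∅, ⟨by simp, by simp⟩, rfl⟩
    obtain ⟨Z, hZ, e⟩ : p (Nat.findGreatest p (2 ^ (D + 1) * 2 * t₀)) :=
      Nat.findGreatest_spec (Nat.zero_le _) hp0
    refine ⟨Z, hZ, fun Z' hZ' => ?_⟩
    rw [e]
    exact Nat.le_findGreatest (hgood Z' hZ') ⟨Z', hZ', rfl⟩
  have hnear : ∀ z, (A ∩ tile 1 z).Nonempty → ∃ z' ∈ Z, ∃ s ∈ P x₀, ∃ s' ∈ P x₀,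
      ∀ j, |z j - z' j - (s' j - s j)| ≤ 1 := by
    intro z hz
    have key : ∃ z' ∈ Z, ¬ Disjoint (f z +ᵥ E) (f z' +ᵥ E) := by
      by_contra! hcon
      have hzZ : z ∉ Z := by
        intro h
        have h1 := hcon z h
        rw [disjoint_self, Set.bot_eq_empty, Set.vadd_set_eq_empty] at h1
        rw [h1] at hEvol
        have : (0 : ℝ) < (P x₀).card := by exact_mod_cast hPne
        simp at hEvol; linarith
      have h2 : good (insert z Z) := by
        refine ⟨fun w hw => ?_, fun w hw w' hw' hne => ?_⟩
        · rcases Finset.mem_insert.1 hw with rfl | hw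
          · exact hz
          · exact hZ.1 w hw
        · rcases Finset.mem_insert.1 hw with hw1 | hw1 <;>
          rcases Finset.mem_insert.1 hw' with hw2 | hw2
          · exact absurd (hw1.trans hw2.symm) hne
          · rw [hw1]; exact hcon w' hw2
          · rw [hw2]; exact (hcon w hw1).symm
          · exact hZ.2 w hw1 w' hw2 hne
      have := hmax _ h2
      rw [Finset.card_insert_of_notMem hzZ] at this
      omega
    obtain ⟨z', hz', hnd⟩ := key
    rw [Set.not_disjoint_iff] at hnd
    obtain ⟨x, ⟨u, hu, rfl⟩, ⟨u', hu', e⟩⟩ := hnd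
    refine ⟨z', hz', _, mem_cells.1 hu.2, _, mem_cells.1 hu'.2, fun j => ?_⟩
    have h1 := mem_tile_one.1 (hfz z hz)
    have h2 := mem_tile_one.1 (hfz z' (hZ.1 z' hz'))
    rw [h1, h2]
    refine abs_floor_combination_le_one ?_
    have := congrFun e j
    simpa using this.symm
  -- the progression
  let N' : (Fin r ⊕ Fin k) ⊕ Z → ℕ := Sum.elim (Sum.elim (fun i => max 1 (2 * N i)) fun _ => 1) fun _ => 1
  let g : (Fin r ⊕ Fin k) ⊕ Z → Fin k → ℤ :=
    Sum.elim (Sum.elim v fun j => Pi.single j 1) fun z => z.1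
  have hZc := hgood Z hZ
  refine ⟨(Fin r ⊕ Fin k) ⊕ Z, inferInstance, ?_, N', g, ?_, ?_, ?_, ?_⟩
  · simp only [Fintype.card_sum, Fintype.card_fin, Fintype.card_coe]; omega
  · rintro ((i | j) | z)
    · exact le_max_left _ _
    · exact le_rfl
    · exact le_rfl
  · intro z hz
    obtain ⟨z', hz', s, hs, s', hs', hj⟩ := hnear z hz
    obtain ⟨n, hn, e⟩ := (Finset.mem_filter.1 hs).2
    obtain ⟨n', hn', e'⟩ := (Finset.mem_filter.1 hs').2
    refine ⟨Sum.elim (Sum.elim (n' - n) fun j => z j - z' j - (s' j - s j))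
      (Pi.single ⟨z', hz'⟩ 1), ?_, ?_⟩
    · rintro ((i | j) | w)
      · simp only [N', Sum.elim_inl, Pi.sub_apply]
        have h1 := abs_sub (n' i) (n i)
        have h2 := hn i
        have h3 := hn' i
        have h4 := le_max_right 1 (2 * N i)
        have h5 : ((2 * N i : ℕ) : ℤ) ≤ (max 1 (2 * N i) : ℕ) := by exact_mod_cast h4
        push_cast at h5 ⊢
        omega
      · simpa [N'] using hj j
      · simp only [N', Sum.elim_inr]
        by_cases h : w = ⟨z', hz'⟩
        · rw [h]; simp
        · rw [Pi.single_eq_of_ne h]; simp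
    · simp only [Fintype.sum_sum_type, Sum.elim_inl, Sum.elim_inr, g]
      have h1 : ∑ w : Z, (Pi.single (⟨z', hz'⟩ : Z) (1 : ℤ) : Z → ℤ) w • (w : Fin k → ℤ) = z' := by
        rw [Finset.sum_eq_single (⟨z', hz'⟩ : Z)]
        · simp
        · intro w _ hw; rw [Pi.single_eq_of_ne hw]; simp
        · simp
      have h2 : ∑ j, (z j - z' j - (s' j - s j)) • (Pi.single j 1 : Fin k → ℤ) =
          z - z' - (s' - s) := by
        ext l; simp [Finset.sum_apply, Pi.single_apply]
      have h3 : ∑ i, (n' - n) i • v i = s' - s := by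
        rw [e, e']; simp only [Pi.sub_apply, sub_smul, Finset.sum_sub_distrib]; abel
      rw [h1, h2, h3]; abel
  · intro j
    refine ⟨Pi.single (Sum.inl (Sum.inr j)) 1, fun i => ?_, ?_⟩
    · by_cases h : i = Sum.inl (Sum.inr j)
      · rw [h]; simp [N']
      · rw [Pi.single_eq_of_ne h]; simp
    · rw [Finset.sum_eq_single (Sum.inl (Sum.inr j))]
      · simp [g]
      · intro w _ hw; rw [Pi.single_eq_of_ne hw]; simp
      · simp
  · simp only [Fintype.prod_sum_type, N', Sum.elim_inl, Sum.elim_inr]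
    have h1 : ∏ i, (2 * max 1 (2 * N i) + 1) ≤ 3 ^ r * ∏ i, (2 * N i + 1) := by
      calc ∏ i, (2 * max 1 (2 * N i) + 1) ≤ ∏ i, (3 * (2 * N i + 1)) := by
            refine Finset.prod_le_prod' fun i _ => ?_
            rcases max_choice 1 (2 * N i) with h | h <;> rw [h] <;> omega
        _ = _ := by rw [Finset.prod_mul_distrib]; simp
    calc (∏ i, (2 * max 1 (2 * N i) + 1)) * (∏ _j : Fin k, (2 * 1 + 1)) * ∏ _z : Z, (2 * 1 + 1)
        ≤ (3 ^ r * (C₀ * S.card)) * 3 ^ k * 3 ^ (2 ^ (D + 1) * 2 * t₀) := by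
          simp only [Finset.prod_const, Finset.card_univ, Fintype.card_fin, Fintype.card_coe]
          gcongr
          · exact h1.trans (Nat.mul_le_mul_left _ hprod)
          · norm_num
      _ ≤ (3 ^ r₀ * (C₀ * S.card)) * 3 ^ k * 3 ^ (2 ^ (D + 1) * 2 * t₀) := by
          gcongr; norm_num
      _ = _ := by rw [pow_add, pow_add]; ring

/-- All cells met by a set of small doubling lie in a highly proper progression. -/
lemma exists_proper_cell_cover (k D Λ : ℕ) : ∃ q C : ℕ, ∀ (A : Set (Fin k → ℝ)) (η : ℝ)
    (S : Finset (Fin k → ℤ)), MeasurableSet A → 2 * η < (1 / 2) ^ k → η ≤ 1 / 4 → S.Nonempty →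
    (∀ z ∈ S, volume.real (tile 1 z \ A) ≤ η) → (1 - η) * volume.real A ≤ S.card →
    volume (A + A) ≠ ⊤ → volume.real (A + A) ≤ 2 ^ D * volume.real A →
    ∃ r ≤ q, ∃ (b : Fin r → Fin k → ℤ) (M : Fin r → ℕ), (∀ i, 1 ≤ M i) ∧
      (∀ z, (A ∩ tile 1 z).Nonempty →
        ∃ m : Fin r → ℤ, (∀ i, |m i| ≤ M i) ∧ z = ∑ i, m i • b i) ∧
      (∀ j, ∃ m : Fin r → ℤ, (∀ i, |m i| ≤ M i) ∧ Pi.single j 1 = ∑ i, m i • b i) ∧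
      (∀ m : Fin r → ℤ, (∀ i, |m i| ≤ Λ * M i) → ∑ i, m i • b i = 0 → m = 0) ∧
      ∏ i, (2 * M i + 1) ≤ C * S.card := by
  obtain ⟨q, C, h⟩ := exists_cell_cover k D
  choose C' hC' using fun q => exists_proper_progression k q Λ
  refine ⟨q, (∑ i ∈ Finset.range (q + 1), C' i) * C, ?_⟩
  intro A η S h1 h2 h3 h4 h5 h6 h7 h8
  obtain ⟨I, _, hI, N, g, hN, hz, hj, hprod⟩ := h A η S h1 h2 h3 h4 h5 h6 h7 h8
  obtain ⟨r, hr, b, M, hM, hcov, hprop, hp⟩ := hC' _ rfl N g hN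
  refine ⟨r, hr.trans hI, b, M, hM, ?_, ?_, hprop, ?_⟩
  · intro z hz'
    obtain ⟨n, hn, e⟩ := hz z hz'
    obtain ⟨m, hm, e'⟩ := hcov n hn
    exact ⟨m, hm, e.trans e'⟩
  · intro j
    obtain ⟨n, hn, e⟩ := hj j
    obtain ⟨m, hm, e'⟩ := hcov n hn
    exact ⟨m, hm, e.trans e'⟩
  · refine hp.trans ?_
    rw [mul_assoc]
    refine Nat.mul_le_mul ?_ hprod
    exact Finset.single_le_sum (f := C') (fun _ _ => Nat.zero_le _)
      (Finset.mem_range.2 (Nat.lt_succ_of_le hI))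

/-- Rearrangement in decreasing order, combined with the Cauchy–Davenport inequality. -/
lemma exists_sorted_sums {G : Type*} [AddCommGroup G] [IsAddTorsionFree G] [DecidableEq G]
    {D : ℕ} (hD : D ≠ 0) (X : Finset G) (hX : X.Nonempty) (a g : G → ℝ) (ha : ∀ x, 0 ≤ a x)
    (hg : ∀ x ∈ X, ∀ y ∈ X, a x + a y ≤ g (x + y)) :
    ∃ (n : ℕ) (a' b' : ℕ → ℝ), n + 1 = X.card ∧ Antitone a' ∧ (∀ i, 0 ≤ a' i) ∧
      (∀ i j, i ≤ n → j ≤ n → a' i + a' j ≤ b' (i + j)) ∧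
      (∀ i, 0 ≤ b' i) ∧
      ∑ i ∈ Finset.range (n + 1), a' i ^ D = ∑ x ∈ X, a x ^ D ∧
      ∑ l ∈ Finset.range (2 * n + 1), b' l ^ D ≤ ∑ v ∈ X + X, g v ^ D := by
  obtain ⟨n, hn⟩ : ∃ n, n + 1 = X.card := ⟨X.card - 1, by have := hX.card_pos; omega⟩
  let e₀ : Fin (n + 1) ≃ X := (finCongr hn).trans X.equivFin.symm
  let e : Fin (n + 1) ≃ X := (Tuple.sort fun i => -a (e₀ i)).trans e₀
  have he : ∀ i j, i ≤ j → a (e j) ≤ a (e i) := by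
    intro i j hij
    have := Tuple.monotone_sort (fun i => -a (e₀ i)) hij
    simpa [e] using this
  let a' : ℕ → ℝ := fun i => if h : i < n + 1 then a (e ⟨i, h⟩) else 0
  have ha' : ∀ (i : ℕ) (h : i < n + 1), a' i = a (e ⟨i, h⟩) := fun i h => dif_pos h
  have hnon : ∀ i, 0 ≤ a' i := by
    intro i
    simp only [a']
    split_ifs
    · exact ha _
    · exact le_rfl
  have hanti : Antitone a' := by
    intro i j hij
    by_cases hj : j < n + 1
    · rw [ha' j hj, ha' i (by omega)]
      exact he _ _ hij
    · simp only [a', dif_neg hj]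
      exact hnon i
  have hb : ∀ l, l ≤ 2 * n → ∃ p : ℕ × ℕ, p.1 ≤ n ∧ p.2 ≤ n ∧ p.1 + p.2 = l ∧
      ∀ i j, i ≤ n → j ≤ n → i + j = l → a' i + a' j ≤ a' p.1 + a' p.2 := by
    intro l hl
    obtain ⟨p, hp, hmax⟩ := Finset.exists_max_image
      ((Finset.range (n + 1) ×ˢ Finset.range (n + 1)).filter fun p => p.1 + p.2 = l)
      (fun p => a' p.1 + a' p.2) ⟨(min l n, l - min l n), by
        simp only [Finset.mem_filter, Finset.mem_product, Finset.mem_range]; omega⟩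
    simp only [Finset.mem_filter, Finset.mem_product, Finset.mem_range] at hp hmax
    refine ⟨p, by omega, by omega, hp.2, fun i j hi hj hij => hmax (i, j) ⟨⟨?_, ?_⟩, hij⟩⟩ <;>
      simp only <;> omega
  choose! p hp1 hp2 hp3 hp4 using hb
  let b' : ℕ → ℝ := fun l => a' (p l).1 + a' (p l).2
  have hbnon : ∀ l, 0 ≤ b' l := fun l => add_nonneg (hnon _) (hnon _)
  have hX' : ∀ v ∈ X + X, 0 ≤ g v := by
    intro v hv
    obtain ⟨x, hx, y, hy, rfl⟩ := Finset.mem_add.1 hv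
    exact (add_nonneg (ha x) (ha y)).trans (hg x hx y hy)
  refine ⟨n, a', b', hn, hanti, hnon, fun i j hi hj => hp4 (i + j) (by omega) i j hi hj rfl,
    hbnon, ?_, ?_⟩
  · rw [Finset.sum_range, ← Finset.sum_coe_sort X, ← e.sum_comp]
    exact Finset.sum_congr rfl fun i _ => by rw [ha' i i.2]
  · refine sum_pow_le_of_card_superlevel_le hD _ _ g b' hX' (fun l _ => hbnon l) ?_
    intro u hu
    by_cases hne : ((Finset.range (2 * n + 1)).filter (u ≤ b' ·)).Nonempty
    · obtain ⟨l, hl, hmax⟩ := Finset.exists_max_image _ id hne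
      simp only [Finset.mem_filter, Finset.mem_range, id] at hl hmax
      have h1 : ((Finset.range (2 * n + 1)).filter (u ≤ b' ·)).card ≤ l + 1 := by
        rw [← Finset.card_range (l + 1)]
        refine Finset.card_le_card fun i hi => ?_
        simp only [Finset.mem_filter, Finset.mem_range] at hi ⊢
        exact Nat.lt_succ_of_le (hmax i hi)
      let Y : ℕ → Finset G := fun i =>
        (Finset.univ.filter fun s : Fin (n + 1) => (s : ℕ) ≤ i).image fun s => (e s : G)
      have hY : ∀ i, i ≤ n → (Y i).card = i + 1 := by
        intro i hi
        rw [show (Y i).card = _ from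
          Finset.card_image_of_injective _ (Subtype.val_injective.comp e.injective)]
        have : (Finset.univ.filter fun s : Fin (n + 1) => (s : ℕ) ≤ i) =
          Finset.Iic (⟨i, by omega⟩ : Fin (n + 1)) := by ext s; simp [Fin.le_def]
        rw [this, Fin.card_Iic]
      have hYmem : ∀ i, i ≤ n → ∀ x ∈ Y i, x ∈ X ∧ a' i ≤ a x := by
        intro i hi x hx
        obtain ⟨s, hs, rfl⟩ := Finset.mem_image.1 hx
        refine ⟨(e s).2, ?_⟩
        rw [ha' i (by omega)]
        exact he _ _ (by simpa [Fin.le_def] using hs)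
      have hl2 : l ≤ 2 * n := by omega
      have h2 : (Y (p l).1 + Y (p l).2) ⊆ (X + X).filter (u ≤ g ·) := by
        intro v hv
        obtain ⟨x, hx, y, hy, rfl⟩ := Finset.mem_add.1 hv
        obtain ⟨hxX, hxa⟩ := hYmem _ (hp1 l hl2) x hx
        obtain ⟨hyX, hya⟩ := hYmem _ (hp2 l hl2) y hy
        refine Finset.mem_filter.2 ⟨Finset.add_mem_add hxX hyX, ?_⟩
        exact hl.2.trans ((add_le_add hxa hya).trans (hg x hxX y hyX))
      have h3 := cauchy_davenport_of_isAddTorsionFree (s := Y (p l).1) (t := Y (p l).2)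
        (Finset.card_pos.1 (by rw [hY _ (hp1 l hl2)]; omega))
        (Finset.card_pos.1 (by rw [hY _ (hp2 l hl2)]; omega))
      rw [hY _ (hp1 l hl2), hY _ (hp2 l hl2)] at h3
      have h4 := Finset.card_le_card h2
      have h5 := hp3 l hl2
      omega
    · rw [Finset.not_nonempty_iff_eq_empty] at hne
      rw [hne]; simp

/-- Coordinates, with respect to a proper progression, on the cells met by `A`; the coordinates of
the standard basis vectors vanish at the indices in `sh`. -/
structure CellCoordinates {k r : ℕ} (A : Set (Fin k → ℝ)) (b : Fin r → Fin k → ℤ) (M : Fin r → ℕ)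
    (sh : Finset (Fin r)) (coord : (Fin k → ℤ) → Fin r → ℤ) : Prop where
  coord_sum : ∀ n : Fin r → ℤ, (∀ i, |n i| ≤ (k + 2) * M i) → coord (∑ i, n i • b i) = n
  abs_coord_le : ∀ z, (A ∩ tile 1 z).Nonempty → ∀ i, |coord z i| ≤ M i
  eq_sum : ∀ z, (A ∩ tile 1 z).Nonempty → z = ∑ i, coord z i • b i
  abs_coord_single_le : ∀ j i, |coord (Pi.single j 1) i| ≤ M i
  single_eq_sum : ∀ j, (Pi.single j 1 : Fin k → ℤ) = ∑ i, coord (Pi.single j 1) i • b i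
  coord_single_eq_zero : ∀ j, ∀ i ∈ sh, coord (Pi.single j 1) i = 0

/-- The short part of a coordinate vector. -/
def shortPart {r : ℕ} (sh : Finset (Fin r)) (n : Fin r → ℤ) : Fin r → ℤ :=
  fun i => if i ∈ sh then n i else 0

lemma shortPart_add {r : ℕ} (sh : Finset (Fin r)) (n m : Fin r → ℤ) :
    shortPart sh (n + m) = shortPart sh n + shortPart sh m := by
  ext i; simp only [shortPart, Pi.add_apply]; split_ifs <;> simp

/-- The short parts of the coordinates of the cells met by `A`. -/
noncomputable def shortClasses {k r : ℕ} (A : Set (Fin k → ℝ)) (M : Fin r → ℕ)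
    (sh : Finset (Fin r)) (coord : (Fin k → ℤ) → Fin r → ℤ) : Finset (Fin r → ℤ) :=
  open Classical in
  (intBox fun i => if i ∈ sh then M i else 0).filter
    fun x => ∃ z, (A ∩ tile 1 z).Nonempty ∧ shortPart sh (coord z) = x

lemma mem_shortClasses_iff {k r : ℕ} {A : Set (Fin k → ℝ)} {M : Fin r → ℕ}
    {sh : Finset (Fin r)} {coord : (Fin k → ℤ) → Fin r → ℤ} {x : Fin r → ℤ} :
    x ∈ shortClasses A M sh coord ↔ x ∈ intBox (fun i => if i ∈ sh then M i else 0) ∧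
      ∃ z, (A ∩ tile 1 z).Nonempty ∧ shortPart sh (coord z) = x := by
  classical
  unfold shortClasses
  exact Finset.mem_filter

namespace CellCoordinates

variable {k r : ℕ} {A : Set (Fin k → ℝ)} {b : Fin r → Fin k → ℤ} {M : Fin r → ℕ}
  {sh : Finset (Fin r)} {coord : (Fin k → ℤ) → Fin r → ℤ}

lemma mem_shortClasses (h : CellCoordinates A b M sh coord) {z : Fin k → ℤ}
    (hz : (A ∩ tile 1 z).Nonempty) : shortPart sh (coord z) ∈ shortClasses A M sh coord := by
  refine mem_shortClasses_iff.2 ⟨mem_intBox.2 fun i => ?_, z, hz, rfl⟩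
  simp only [shortPart]
  split_ifs
  · exact h.abs_coord_le z hz i
  · simp

lemma card_shortClasses_le {H : ℕ} (hH : ∀ i ∈ sh, M i ≤ H) :
    (shortClasses A M sh coord).card ≤ (2 * H + 1) ^ r := by
  refine (Finset.card_le_card fun x hx => (mem_shortClasses_iff.1 hx).1).trans ?_
  rw [card_intBox]
  calc ∏ i, (2 * (if i ∈ sh then M i else 0) + 1) ≤ ∏ _i : Fin r, (2 * H + 1) := by
        refine Finset.prod_le_prod' fun i _ => ?_
        split_ifs with hi
        · have := hH i hi; omega
        · omega
    _ = _ := by simp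

lemma card_shortClasses_add_le {H : ℕ} (hH : ∀ i ∈ sh, M i ≤ H) :
    (shortClasses A M sh coord + shortClasses A M sh coord).card ≤ (4 * H + 1) ^ r := by
  have h1 : shortClasses A M sh coord + shortClasses A M sh coord ⊆ intBox fun _ => 2 * H := by
    intro v hv
    obtain ⟨x, hx, y, hy, rfl⟩ := Finset.mem_add.1 hv
    have hx' := mem_intBox.1 (mem_shortClasses_iff.1 hx).1
    have hy' := mem_intBox.1 (mem_shortClasses_iff.1 hy).1
    refine mem_intBox.2 fun i => ?_
    have h2 := hx' i
    have h3 := hy' i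
    have h4 := abs_add_le (x i) (y i)
    have h5 : (if i ∈ sh then M i else 0) ≤ H := by
      split_ifs with hi
      · exact hH i hi
      · omega
    simp only [Pi.add_apply]
    push_cast
    omega
  refine (Finset.card_le_card h1).trans ?_
  rw [card_intBox]
  simp [← mul_assoc]

lemma coord_add (h : CellCoordinates A b M sh coord) {z w : Fin k → ℤ}
    (hz : (A ∩ tile 1 z).Nonempty) (hw : (A ∩ tile 1 w).Nonempty) :
    coord (z + w) = coord z + coord w := by
  conv_lhs => rw [h.eq_sum z hz, h.eq_sum w hw]
  have e : ∑ i, coord z i • b i + ∑ i, coord w i • b i = ∑ i, (coord z + coord w) i • b i := by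
    simp only [Pi.add_apply, add_smul, Finset.sum_add_distrib]
  rw [e]
  refine h.coord_sum _ fun i => (abs_add_le _ _).trans ?_
  have h1 := h.abs_coord_le z hz i
  have h2 := h.abs_coord_le w hw i
  have h3 : (0 : ℤ) ≤ k * M i := by positivity
  linarith

lemma shortPart_coord_floor_add (h : CellCoordinates A b M sh coord) {x y : Fin k → ℝ}
    (hx : x ∈ A) (hy : y ∈ A) :
    shortPart sh (coord fun j => ⌊(x + y) j⌋) =
      shortPart sh (coord fun j => ⌊x j⌋) + shortPart sh (coord fun j => ⌊y j⌋) := by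
  obtain ⟨z, hz⟩ : ∃ z : Fin k → ℤ, z = fun j => ⌊x j⌋ := ⟨_, rfl⟩
  obtain ⟨w, hw⟩ : ∃ w : Fin k → ℤ, w = fun j => ⌊y j⌋ := ⟨_, rfl⟩
  have hzA : (A ∩ tile 1 z).Nonempty := ⟨x, hx, mem_tile_one.2 hz⟩
  have hwA : (A ∩ tile 1 w).Nonempty := ⟨y, hy, mem_tile_one.2 hw⟩
  rw [← hz, ← hw]
  obtain ⟨e, he⟩ : ∃ e : Fin k → ℤ, e = (fun j => ⌊(x + y) j⌋) - z - w := ⟨_, rfl⟩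
  have he1 : ∀ j, |e j| ≤ 1 := by
    intro j
    rw [he, hz, hw]
    simp only [Pi.sub_apply, Pi.add_apply]
    rcases floor_sub_floor_mem (a := x j) (b := y j) with h1 | h1 <;> rw [h1] <;>
      rw [abs_le] <;> omega
  have hv : (fun j => ⌊(x + y) j⌋) = z + w + e := by rw [he]; abel
  have hesum : e = ∑ j, e j • (Pi.single j 1 : Fin k → ℤ) := by
    ext l; simp [Finset.sum_apply, Pi.single_apply]
  let m : Fin r → ℤ := coord z + coord w + ∑ j, e j • coord (Pi.single j 1)
  have hm : z + w + e = ∑ i, m i • b i := by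
    simp only [m, Pi.add_apply, Finset.sum_apply, Pi.smul_apply, add_smul, Finset.sum_add_distrib]
    rw [← h.eq_sum z hzA, ← h.eq_sum w hwA]
    congr 1
    simp only [Finset.sum_smul]
    rw [Finset.sum_comm]
    conv_lhs => rw [hesum]
    refine Finset.sum_congr rfl fun j _ => ?_
    conv_lhs => rw [h.single_eq_sum j, Finset.smul_sum]
    simp only [smul_assoc]
  have hmb : ∀ i, |m i| ≤ (k + 2) * M i := by
    intro i
    have h1 := h.abs_coord_le z hzA i
    have h2 := h.abs_coord_le w hwA i
    have h3 : |(∑ j, e j • coord (Pi.single j 1)) i| ≤ k * M i := by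
      rw [Finset.sum_apply]
      refine (Finset.abs_sum_le_sum_abs _ _).trans ?_
      calc ∑ j, |(e j • coord (Pi.single j 1)) i| ≤ ∑ _j : Fin k, (M i : ℤ) := by
            refine Finset.sum_le_sum fun j _ => ?_
            rw [Pi.smul_apply, smul_eq_mul, abs_mul]
            calc |e j| * |coord (Pi.single j 1) i| ≤ 1 * M i :=
                  mul_le_mul (he1 j) (h.abs_coord_single_le j i) (abs_nonneg _) (by norm_num)
              _ = _ := one_mul _
        _ = _ := by simp
    have h4 := abs_add_le (coord z i + coord w i) ((∑ j, e j • coord (Pi.single j 1)) i)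
    have h5 := abs_add_le (coord z i) (coord w i)
    simp only [m, Pi.add_apply] at *
    linarith
  have hc : coord (fun j => ⌊(x + y) j⌋) = m := by rw [hv, hm]; exact h.coord_sum m hmb
  rw [hc, ← shortPart_add]
  ext i
  simp only [shortPart]
  split_ifs with hi
  · simp only [m, Pi.add_apply, Finset.sum_apply, Pi.smul_apply, h.coord_single_eq_zero _ i hi,
      smul_zero, Finset.sum_const_zero, add_zero]
  · rfl

lemma coord_injOn (h : CellCoordinates A b M sh coord) {z w : Fin k → ℤ}
    (hz : (A ∩ tile 1 z).Nonempty) (hw : (A ∩ tile 1 w).Nonempty) (e : coord z = coord w) :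
    z = w := by
  rw [h.eq_sum z hz, h.eq_sum w hw, e]

set_option maxHeartbeats 1000000 in
/-- Brunn–Minkowski for the part of `S` in two classes. -/
lemma card_add_ge (h : CellCoordinates A b M sh coord) {m : ℕ} (hm : shᶜ.card = m + 1) {c : ℝ}
    (hc0 : 0 ≤ c)
    (hc : ∀ (U V : Finset (Fin (m + 1) → ℤ)) (M : Fin (m + 1) → ℕ) (L : ℕ) (α γ : ℝ), 1 ≤ L →
      (∀ i, L ≤ M i) → U.Nonempty → V.Nonempty → (∀ x ∈ U, ∀ i, |x i| ≤ M i) →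
      (∀ x ∈ V, ∀ i, |x i| ≤ M i) → 0 ≤ α → 0 ≤ γ → α ^ (m + 1) ≤ U.card → γ ^ (m + 1) ≤ V.card →
      (α + γ) ^ (m + 1) - c * (∏ i, (2 * (M i : ℝ) + 1)) / L ≤ (U + V).card)
    {G : ℕ} (hG : 1 ≤ G) (hlong : ∀ i ∉ sh, G ≤ M i)
    {T T' : Finset (Fin k → ℤ)} (hT : ∀ z ∈ T, (A ∩ tile 1 z).Nonempty)
    (hT' : ∀ z ∈ T', (A ∩ tile 1 z).Nonempty) (hTne : T.Nonempty) (hTne' : T'.Nonempty)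
    (hTs : ∀ z ∈ T, ∀ w ∈ T, shortPart sh (coord z) = shortPart sh (coord w))
    (hTs' : ∀ z ∈ T', ∀ w ∈ T', shortPart sh (coord z) = shortPart sh (coord w))
    {α γ : ℝ} (hα : 0 ≤ α) (hγ : 0 ≤ γ) (hαT : α ^ (m + 1) ≤ T.card)
    (hγT : γ ^ (m + 1) ≤ T'.card) :
    (α + γ) ^ (m + 1) - c * (∏ i, (2 * (M i : ℝ) + 1)) / G ≤ (T + T').card := by
  classical
  let ℓ : Fin (m + 1) ≃ {i // i ∈ shᶜ} := (shᶜ.equivFinOfCardEq hm).symm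
  let π : (Fin k → ℤ) → Fin (m + 1) → ℤ := fun z s => coord z (ℓ s)
  have hinj : ∀ T : Finset (Fin k → ℤ), (∀ z ∈ T, (A ∩ tile 1 z).Nonempty) →
      (∀ z ∈ T, ∀ w ∈ T, shortPart sh (coord z) = shortPart sh (coord w)) →
      (T.image π).card = T.card := by
    intro T hT hTs
    refine Finset.card_image_of_injOn fun z hz w hw e => ?_
    refine h.coord_injOn (hT z hz) (hT w hw) ?_
    ext i
    by_cases hi : i ∈ sh
    · have := congrFun (hTs z hz w hw) i
      simpa [shortPart, hi] using this
    · have := congrFun e (ℓ.symm ⟨i, Finset.mem_compl.2 hi⟩)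
      simpa [π] using this
  have hsum : T.image π + T'.image π ⊆ (T + T').image π := by
    intro v hv
    obtain ⟨x, hx, y, hy, rfl⟩ := Finset.mem_add.1 hv
    obtain ⟨z, hz, rfl⟩ := Finset.mem_image.1 hx
    obtain ⟨w, hw, rfl⟩ := Finset.mem_image.1 hy
    refine Finset.mem_image.2 ⟨z + w, Finset.add_mem_add hz hw, ?_⟩
    ext s
    simp only [π, Pi.add_apply, h.coord_add (hT z hz) (hT' w hw)]
  have hbox : ∀ T : Finset (Fin k → ℤ), (∀ z ∈ T, (A ∩ tile 1 z).Nonempty) →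
      ∀ x ∈ T.image π, ∀ i, |x i| ≤ M (ℓ i) := by
    intro T hT x hx i
    obtain ⟨z, hz, rfl⟩ := Finset.mem_image.1 hx
    exact h.abs_coord_le z (hT z hz) _
  have key := hc (T.image π) (T'.image π) (fun s => M (ℓ s)) G α γ hG
    (fun s => hlong _ (Finset.mem_compl.1 (ℓ s).2)) (hTne.image _) (hTne'.image _)
    (hbox T hT) (hbox T' hT') hα hγ (by rwa [hinj T hT hTs]) (by rwa [hinj T' hT' hTs'])
  have h1 : ((T.image π + T'.image π).card : ℝ) ≤ (T + T').card := by
    exact_mod_cast (Finset.card_le_card hsum).trans Finset.card_image_le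
  have h2 : ∏ s, (2 * (M (ℓ s) : ℝ) + 1) ≤ ∏ i, (2 * (M i : ℝ) + 1) := by
    rw [Equiv.prod_comp ℓ (fun i => 2 * (M i : ℝ) + 1),
      Finset.prod_coe_sort shᶜ (fun i => 2 * (M i : ℝ) + 1)]
    refine Finset.prod_le_prod_of_subset_of_one_le (Finset.subset_univ _) (fun i _ => by positivity)
      fun i _ _ => ?_
    have : (0 : ℝ) ≤ M i := by positivity
    linarith
  have h3 : c * (∏ s, (2 * (M (ℓ s) : ℝ) + 1)) / G ≤ c * (∏ i, (2 * (M i : ℝ) + 1)) / G := by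
    gcongr
  linarith

end CellCoordinates

lemma inter_tile_nonempty_of_full {k : ℕ} {A : Set (Fin k → ℝ)} {η : ℝ} (hη : η < 1)
    {z : Fin k → ℤ} (hz : volume.real (tile 1 z \ A) ≤ η) : (A ∩ tile 1 z).Nonempty := by
  by_contra h
  rw [Set.not_nonempty_iff_eq_empty] at h
  have := volume_real_cell_inter_ge hz
  rw [h, measureReal_empty] at this
  linarith

namespace CellCoordinates

variable {k r : ℕ} {A : Set (Fin k → ℝ)} {b : Fin r → Fin k → ℤ} {M : Fin r → ℕ}
  {sh : Finset (Fin r)} {coord : (Fin k → ℤ) → Fin r → ℤ}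

set_option maxHeartbeats 1000000 in
/-- The class sizes, sorted, satisfy a one-dimensional sumset inequality. -/
lemma exists_class_sums (h : CellCoordinates A b M sh coord) {m : ℕ} (hm : shᶜ.card = m + 1) {c : ℝ}
    (hc0 : 0 ≤ c)
    (hc : ∀ (U V : Finset (Fin (m + 1) → ℤ)) (M : Fin (m + 1) → ℕ) (L : ℕ) (α γ : ℝ), 1 ≤ L →
      (∀ i, L ≤ M i) → U.Nonempty → V.Nonempty → (∀ x ∈ U, ∀ i, |x i| ≤ M i) →
      (∀ x ∈ V, ∀ i, |x i| ≤ M i) → 0 ≤ α → 0 ≤ γ → α ^ (m + 1) ≤ U.card → γ ^ (m + 1) ≤ V.card →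
      (α + γ) ^ (m + 1) - c * (∏ i, (2 * (M i : ℝ) + 1)) / L ≤ (U + V).card)
    {G H : ℕ} (hG : 1 ≤ G) (hlong : ∀ i ∉ sh, G ≤ M i) (hH : ∀ i ∈ sh, M i ≤ H)
    (hA : MeasurableSet A) {η : ℝ} (hη0 : 0 ≤ η) (hη1 : η < 1) (hη : 2 * η < (1 / 2) ^ k)
    {S : Finset (Fin k → ℤ)} (hSne : S.Nonempty)
    (hS : ∀ z ∈ S, volume.real (tile 1 z \ A) ≤ η) (hAAf : volume (A + A) ≠ ⊤) :
    ∃ (n : ℕ) (a' b' : ℕ → ℝ), n + 1 = (shortClasses A M sh coord).card ∧ Antitone a' ∧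
      (∀ i, 0 ≤ a' i) ∧ (∀ i j, i ≤ n → j ≤ n → a' i + a' j ≤ b' (i + j)) ∧ (∀ i, 0 ≤ b' i) ∧
      ∑ i ∈ Finset.range (n + 1), a' i ^ (m + 1) = S.card ∧
      ∑ l ∈ Finset.range (2 * n + 1), b' l ^ (m + 1) ≤ volume.real (A + A) +
        (c * (∏ i, (2 * (M i : ℝ) + 1)) / G + η * S.card) * (4 * H + 1) ^ r := by
  classical
  have hSA : ∀ z ∈ S, (A ∩ tile 1 z).Nonempty := fun z hz =>
    inter_tile_nonempty_of_full hη1 (hS z hz)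
  obtain ⟨κ, hκ⟩ : ∃ κ : ℝ, κ = c * (∏ i, (2 * (M i : ℝ) + 1)) / G + η * S.card := ⟨_, rfl⟩
  have hκ1 : 0 ≤ c * (∏ i, (2 * (M i : ℝ) + 1)) / G := by positivity
  have hκ0 : 0 ≤ κ := by rw [hκ]; positivity
  let X := shortClasses A M sh coord
  let σ : (Fin k → ℝ) → Fin r → ℤ := fun p => shortPart sh (coord fun j => ⌊p j⌋)
  let V : (Fin r → ℤ) → Set (Fin k → ℝ) := fun v => {p | σ p = v}
  have hV : ∀ v, MeasurableSet (V v) := by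
    intro v
    have h1 : Measurable fun p : Fin k → ℝ => fun j => ⌊p j⌋ :=
      measurable_pi_lambda _ fun j => Int.measurable_floor.comp (measurable_pi_apply j)
    have h2 : MeasurableSet {z : Fin k → ℤ | shortPart sh (coord z) = v} :=
      (Set.to_countable _).measurableSet
    exact h1 h2
  let μ : Measure (Fin k → ℝ) := volume.restrict (A + A)
  have hμ : ∀ v, μ.real (V v) = volume.real (V v ∩ (A + A)) := fun v => by
    rw [measureReal_def, Measure.restrict_apply (hV v), measureReal_def]
  have hEf : ∀ v, volume (V v ∩ (A + A)) ≠ ⊤ := fun v =>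
    ne_top_of_le_ne_top hAAf (measure_mono inter_subset_right)
  let T : (Fin r → ℤ) → Finset (Fin k → ℤ) := fun x =>
    S.filter fun z => shortPart sh (coord z) = x
  have hTS : ∀ x, ∀ z ∈ T x, z ∈ S := fun x z hz => (Finset.mem_filter.1 hz).1
  have hTx : ∀ x, ∀ z ∈ T x, shortPart sh (coord z) = x := fun x z hz => (Finset.mem_filter.1 hz).2
  have hTσ : ∀ x, ∀ p ∈ cells (T x), σ p = x := fun x p hp => hTx x _ (mem_cells.1 hp)
  have hVadd : ∀ p ∈ A, ∀ p' ∈ A, p + p' ∈ V (σ p + σ p') ∩ (A + A) := fun p hp p' hp' =>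
    ⟨h.shortPart_coord_floor_add hp hp', Set.add_mem_add hp hp'⟩
  let a : (Fin r → ℤ) → ℝ := fun x => ((T x).card : ℝ) ^ (((m + 1 : ℕ) : ℝ)⁻¹)
  have ha0 : ∀ x, 0 ≤ a x := fun x => Real.rpow_nonneg (by positivity) _
  have hapow : ∀ x, a x ^ (m + 1) = (T x).card := fun x =>
    Real.rpow_inv_natCast_pow (by positivity) (by omega)
  let g : (Fin r → ℤ) → ℝ := fun v => (μ.real (V v) + κ) ^ (((m + 1 : ℕ) : ℝ)⁻¹)
  have hgpow : ∀ v, g v ^ (m + 1) = μ.real (V v) + κ := fun v =>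
    Real.rpow_inv_natCast_pow (add_nonneg measureReal_nonneg hκ0) (by omega)
  have hone : ∀ x ∈ X, ∀ y, ((T y).card : ℝ) ≤ μ.real (V (x + y)) + κ := by
    intro x hx y
    obtain ⟨z, ⟨f, hfA, hfz⟩, hzx⟩ := (mem_shortClasses_iff.1 hx).2
    have h1 : A ∩ cells (T y) ⊆ -f +ᵥ (V (x + y) ∩ (A + A)) := by
      intro p hp
      rw [mem_vadd_set_iff_neg_vadd_mem, neg_neg, vadd_eq_add]
      have h2 := hVadd f hfA p hp.1
      rw [hTσ y p hp.2] at h2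
      have h3 : σ f = x := by
        rw [mem_tile_one] at hfz
        simp only [σ]; rw [← hfz]; exact hzx
      rwa [h3] at h2
    have h2 := volume_real_inter_cells_ge hA (T y) (fun z hz => hS z (hTS y z hz)) h1
      (by rw [measure_vadd]; exact hEf _)
    rw [measureReal_def, measure_vadd, ← measureReal_def, ← hμ] at h2
    have h3 : ((T y).card : ℝ) ≤ S.card := by exact_mod_cast Finset.card_filter_le _ _
    have h4 : η * (T y).card ≤ η * S.card := by gcongr
    rw [hκ]
    linarith
  have hmain : ∀ x ∈ X, ∀ y ∈ X, (a x + a y) ^ (m + 1) ≤ μ.real (V (x + y)) + κ := by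
    intro x hx y hy
    rcases (T x).eq_empty_or_nonempty with hTe | hTne
    · have : a x = 0 := by
        have := hapow x
        rw [hTe] at this
        simpa using this
      rw [this, zero_add, hapow]
      exact hone x hx y
    rcases (T y).eq_empty_or_nonempty with hTe' | hTne'
    · have : a y = 0 := by
        have := hapow y
        rw [hTe'] at this
        simpa using this
      rw [this, add_zero, hapow, add_comm x y]
      exact hone y hy x
    have h1 := h.card_add_ge hm hc0 hc hG hlong (fun z hz => hSA z (hTS x z hz))
      (fun z hz => hSA z (hTS y z hz)) hTne hTne'
      (fun z hz w hw => (hTx x z hz).trans (hTx x w hw).symm)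
      (fun z hz w hw => (hTx y z hz).trans (hTx y w hw).symm)
      (ha0 x) (ha0 y) (hapow x).le (hapow y).le
    have h2 := card_add_le_volume_real hη (T x) (T y) (fun z hz => hS z (hTS x z hz))
      (fun z hz => hS z (hTS y z hz)) (E := V (x + y) ∩ (A + A)) (by
        rintro _ ⟨p, hp, p', hp', rfl⟩
        have := hVadd p hp.1 p' hp'.1
        rwa [hTσ x p hp.2, hTσ y p' hp'.2] at this) (hEf _)
    rw [← hμ] at h2
    have h3 : 0 ≤ η * S.card := by positivity
    rw [hκ]
    linarith
  have hg : ∀ x ∈ X, ∀ y ∈ X, a x + a y ≤ g (x + y) := by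
    intro x hx y hy
    rw [← Real.pow_rpow_inv_natCast (add_nonneg (ha0 x) (ha0 y)) (Nat.succ_ne_zero m)]
    exact Real.rpow_le_rpow (pow_nonneg (add_nonneg (ha0 x) (ha0 y)) _) (hmain x hx y hy)
      (by positivity)
  have hXne : X.Nonempty := by
    obtain ⟨z, hz⟩ := hSne
    exact ⟨_, h.mem_shortClasses (hSA z hz)⟩
  obtain ⟨n, a', b', hn, hanti, ha', hab, hb', hsa, hsb⟩ :=
    exists_sorted_sums (Nat.succ_ne_zero m) X hXne a g ha0 hg
  refine ⟨n, a', b', hn, hanti, ha', hab, hb', ?_, ?_⟩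
  · rw [hsa, Finset.sum_congr rfl fun x _ => hapow x]
    have := Finset.card_eq_sum_card_fiberwise (s := S) (t := X)
      (f := fun z => shortPart sh (coord z)) fun z hz => h.mem_shortClasses (hSA z hz)
    rw [this]
    push_cast
    rfl
  · refine hsb.trans ?_
    rw [Finset.sum_congr rfl fun v _ => hgpow v, Finset.sum_add_distrib, Finset.sum_const,
      nsmul_eq_mul, mul_comm _ κ, ← hκ]
    have h1 : ∑ v ∈ X + X, μ.real (V v) ≤ volume.real (A + A) := by
      have hu : μ univ = volume (A + A) := Measure.restrict_apply_univ _
      have := sum_measureReal_le_of_disjoint (μ := μ) (t := X + X) (B := V) (E := univ)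
        (fun v _ => hV v) (fun v _ v' _ hne => Set.disjoint_left.2 fun p hp hp' =>
          hne (Eq.trans (Eq.symm hp) hp')) (fun v _ => subset_univ _) (by rw [hu]; exact hAAf)
      rwa [measureReal_def (s := univ), hu] at this
    have h2 : ((X + X).card : ℝ) ≤ (4 * H + 1) ^ r := by
      exact_mod_cast card_shortClasses_add_le hH
    gcongr

end CellCoordinates

/-- Cells met by a set `A` that contains a long run of cells in each coordinate direction admit
cell coordinates, with a prescribed gap between the short and the long sides. -/
lemma exists_cellCoordinates {k q r : ℕ} (hr : r ≤ q) {L : ℕ → ℕ} (hL : Monotone L) {m : ℕ}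
    (hm : ∀ s ≤ q, 2 * L s + 2 ≤ m) {A : Set (Fin k → ℝ)} {b : Fin r → Fin k → ℤ}
    {M : Fin r → ℕ}
    (hcov : ∀ z, (A ∩ tile 1 z).Nonempty →
      ∃ n : Fin r → ℤ, (∀ i, |n i| ≤ M i) ∧ z = ∑ i, n i • b i)
    (hsingle : ∀ j, ∃ n : Fin r → ℤ, (∀ i, |n i| ≤ M i) ∧ Pi.single j 1 = ∑ i, n i • b i)
    (hprop : ∀ n : Fin r → ℤ, (∀ i, |n i| ≤ (2 * k + 4 : ℕ) * M i) → ∑ i, n i • b i = 0 → n = 0)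
    (hrun : ∀ j : Fin k, ∃ z : Fin k → ℤ, ∀ t : ℕ, t < m →
      (A ∩ tile 1 (z + (Pi.single j (t : ℤ) : Fin k → ℤ))).Nonempty) :
    ∃ s ≤ q, ∃ (sh : Finset (Fin r)) (coord : (Fin k → ℤ) → Fin r → ℤ),
      CellCoordinates A b M sh coord ∧ (∀ i ∉ sh, L (s + 1) ≤ M i) ∧ ∀ i ∈ sh, M i ≤ L s := by
  classical
  obtain ⟨s, hs, hcard⟩ := exists_eq_succ_of_bounded
    (fun s => (Finset.univ.filter fun i => M i ≤ L s).card) q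
    (fun s => (Finset.card_le_univ _).trans (by simpa using hr))
    (fun s => Finset.card_le_card fun i hi => by
      simp only [Finset.mem_filter, Finset.mem_univ, true_and] at hi ⊢
      exact hi.trans (hL (Nat.le_succ s)))
  have hfilter : (Finset.univ.filter fun i => M i ≤ L s) =
      Finset.univ.filter fun i => M i ≤ L (s + 1) := by
    refine Finset.eq_of_subset_of_card_le (fun i hi => ?_) hcard.ge
    simp only [Finset.mem_filter, Finset.mem_univ, true_and] at hi ⊢
    exact hi.trans (hL (Nat.le_succ s))
  let coord : (Fin k → ℤ) → Fin r → ℤ := fun z =>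
    if h : ∃ n : Fin r → ℤ, (∀ i, |n i| ≤ (k + 2) * M i) ∧ z = ∑ i, n i • b i then h.choose else 0
  have hcoord : ∀ n : Fin r → ℤ, (∀ i, |n i| ≤ (k + 2) * M i) → coord (∑ i, n i • b i) = n := by
    intro n hn
    have h : ∃ n' : Fin r → ℤ, (∀ i, |n' i| ≤ (k + 2) * M i) ∧
        ∑ i, n i • b i = ∑ i, n' i • b i := ⟨n, hn, rfl⟩
    simp only [coord, dif_pos h]
    have hc := h.choose_spec
    refine sub_eq_zero.1 (hprop _ (fun i => ?_) ?_)
    · have h1 := abs_sub (h.choose i) (n i)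
      have h2 := hc.1 i
      have h3 := hn i
      rw [Pi.sub_apply]
      push_cast
      linarith
    · simp only [Pi.sub_apply, sub_smul, Finset.sum_sub_distrib]
      rw [← hc.2, sub_self]
  have hMk : ∀ i, (M i : ℤ) ≤ (k + 2) * M i := fun i => by
    have : (0 : ℤ) ≤ M i := by positivity
    have : (0 : ℤ) ≤ (k : ℤ) * M i := by positivity
    linarith
  have hcoord' : ∀ z, (∃ n : Fin r → ℤ, (∀ i, |n i| ≤ M i) ∧ z = ∑ i, n i • b i) →
      (∀ i, |coord z i| ≤ M i) ∧ z = ∑ i, coord z i • b i := by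
    rintro z ⟨n, hn, rfl⟩
    rw [hcoord n fun i => (hn i).trans (hMk i)]
    exact ⟨hn, rfl⟩
  refine ⟨s, hs, Finset.univ.filter fun i => M i ≤ L s, coord, ⟨hcoord,
    fun z hz => (hcoord' z (hcov z hz)).1, fun z hz => (hcoord' z (hcov z hz)).2,
    fun j => (hcoord' _ (hsingle j)).1, fun j => (hcoord' _ (hsingle j)).2, ?_⟩, ?_, ?_⟩
  · intro j i hi
    have hiL : M i ≤ L s := by simpa using hi
    obtain ⟨z, hz⟩ := hrun j
    have hstep : ∀ t : ℕ, t < m →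
        coord (z + (Pi.single j (t : ℤ) : Fin k → ℤ)) = coord z + (t : ℤ) • coord (Pi.single j 1) := by
      intro t
      induction t with
      | zero => intro _; simp
      | succ t ih =>
        intro ht
        have ih' := ih (by omega)
        have h1 := hcoord' _ (hcov _ (hz t (by omega)))
        have h2 := hcoord' _ (hcov _ (hz (t + 1) ht))
        have h3 := hcoord' _ (hsingle j)
        have h4 : coord (z + (Pi.single j ((t + 1 : ℕ) : ℤ) : Fin k → ℤ)) -
            coord (z + (Pi.single j (t : ℤ) : Fin k → ℤ)) - coord (Pi.single j 1) = 0 := by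
          refine hprop _ (fun i => ?_) ?_
          · simp only [Pi.sub_apply]
            have := abs_sub (coord (z + (Pi.single j ((t + 1 : ℕ) : ℤ) : Fin k → ℤ)) i -
              coord (z + (Pi.single j (t : ℤ) : Fin k → ℤ)) i) (coord (Pi.single j 1) i)
            have := abs_sub (coord (z + (Pi.single j ((t + 1 : ℕ) : ℤ) : Fin k → ℤ)) i)
              (coord (z + (Pi.single j (t : ℤ) : Fin k → ℤ)) i)
            have := h1.1 i
            have := h2.1 i
            have := h3.1 i
            have : (0 : ℤ) ≤ M i := by positivity
            have : (0 : ℤ) ≤ (k : ℤ) * M i := by positivity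
            push_cast at *
            linarith
          · simp only [Pi.sub_apply, sub_smul, Finset.sum_sub_distrib]
            rw [← h1.2, ← h2.2, ← h3.2, add_sub_add_left_eq_sub, ← Pi.single_sub, ← Pi.single_sub]
            simp
        rw [sub_eq_zero, sub_eq_iff_eq_add, ih'] at h4
        rw [h4]
        push_cast
        rw [add_smul, one_smul]
        abel
    have hm' := hm s hs
    have h1 := congrFun (hstep (2 * M i + 1) (by omega)) i
    have h2 := (hcoord' _ (hcov _ (hz (2 * M i + 1) (by omega)))).1 i
    have h3 := (hcoord' _ (hcov _ (hz 0 (by omega)))).1 i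
    rw [h1] at h2
    simp only [Nat.cast_zero, Pi.single_zero, add_zero] at h3
    simp only [Pi.add_apply, Pi.smul_apply, smul_eq_mul] at h2
    by_contra hne
    have h4 := Int.one_le_abs hne
    have h5 : |((2 * M i + 1 : ℕ) : ℤ) * coord (Pi.single j 1) i| ≤ 2 * M i := by
      have := abs_sub (coord z i + ((2 * M i + 1 : ℕ) : ℤ) * coord (Pi.single j 1) i) (coord z i)
      rw [add_sub_cancel_left] at this
      linarith
    rw [abs_mul, Nat.abs_cast] at h5
    push_cast at h5
    have : (0 : ℤ) ≤ M i := by positivity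
    nlinarith
  · intro i hi
    rw [hfilter] at hi
    simp only [Finset.mem_filter, Finset.mem_univ, true_and, not_le] at hi
    exact hi.le
  · intro i hi
    simpa using hi

lemma volume_finite_add_le {k : ℕ} {S : Set (Fin k → ℝ)} (hS : S.Finite) (Q : Set (Fin k → ℝ)) :
    volume (S + Q) ≤ S.ncard * volume Q := by
  rw [← iUnion_add_left_image]
  calc volume (⋃ a ∈ S, (a + ·) '' Q) = volume (⋃ a ∈ hS.toFinset, (a + ·) '' Q) := by simp
    _ ≤ ∑ a ∈ hS.toFinset, volume ((a + ·) '' Q) := measure_biUnion_finset_le _ _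
    _ = ∑ _a ∈ hS.toFinset, volume Q := by
        refine Finset.sum_congr rfl fun a _ => ?_
        rw [image_add_left, measure_preimage_add]
    _ = _ := by rw [Finset.sum_const, nsmul_eq_mul, ncard_eq_toFinset_card S hS]

lemma exists_isGAPR_of_le {k d' d : ℕ} (h : d' ≤ d) (a : Fin d' → Fin k → ℝ) (M : Fin d' → ℕ) :
    ∃ (P : Set (Fin k → ℝ)) (x₀ : Fin k → ℝ), IsGAPR k d P ∧ P.Finite ∧
      P.ncard ≤ ∏ i, (2 * M i + 1) ∧
      ∀ m : Fin d' → ℤ, (∀ i, |m i| ≤ M i) → ∑ i, (m i : ℝ) • a i + x₀ ∈ P := by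
  classical
  obtain ⟨e, rfl⟩ := Nat.exists_eq_add_of_le h
  let a' : Fin (d' + e) → Fin k → ℝ := Fin.append a 0
  let l : Fin (d' + e) → ℕ := Fin.append (fun i => 2 * M i + 1) 1
  have hl : {lam : Fin (d' + e) → ℕ | ∀ i, 1 ≤ lam i ∧ lam i ≤ l i} =
      ((Fintype.piFinset fun i => Finset.Icc 1 (l i) : Finset (Fin (d' + e) → ℕ)) : Set _) := by
    ext lam; simp [Pi.le_def, forall_and]
  refine ⟨_, ∑ i, ((M i : ℝ) + 1) • a i, ⟨a', l, fun i => ?_, rfl⟩, ?_, ?_, ?_⟩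
  · refine Fin.addCases (fun i => ?_) (fun i => ?_) i <;> simp [l]
  · rw [hl]
    exact (Finset.finite_toSet _).image _
  · rw [hl]
    refine (ncard_image_le (Finset.finite_toSet _)).trans ?_
    rw [ncard_coe_finset, Fintype.card_piFinset]
    simp [Fin.prod_univ_add, l]
  · intro m hm
    refine ⟨Fin.append (fun i => (m i + M i + 1).toNat) 1, fun i => ?_, ?_⟩
    · refine Fin.addCases (fun i => ?_) (fun i => ?_) i
      · have := abs_le.1 (hm i)
        simp only [Fin.append_left, l]
        omega
      · simp [l]
    · simp only [Fin.sum_univ_add, Fin.append_left, Fin.append_right, a', Pi.zero_apply, smul_zero,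
        Finset.sum_const_zero, add_zero, ← Finset.sum_add_distrib, ← add_smul]
      refine Finset.sum_congr rfl fun i _ => ?_
      have h1 := abs_le.1 (hm i)
      have h2 : (((m i + M i + 1).toNat : ℤ) : ℝ) = ((m i + M i + 1 : ℤ) : ℝ) := by
        rw [Int.toNat_of_nonneg (by omega)]
      rw [Int.cast_natCast] at h2
      rw [h2]
      push_cast
      rw [add_assoc]

/-- A set with cell coordinates is covered by few translates of the sum of a progression and a
parallelotope. -/
lemma CellCoordinates.exists_cover (k q : ℕ) : ∃ C : ℕ, ∀ {r : ℕ} {A : Set (Fin k → ℝ)}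
    {b : Fin r → Fin k → ℤ} {M : Fin r → ℕ} {sh : Finset (Fin r)}
    {coord : (Fin k → ℤ) → Fin r → ℤ}, r ≤ q → CellCoordinates A b M sh coord →
    (∀ i, 1 ≤ M i) → ∃ d', d' + k ≤ shᶜ.card ∧ ∀ d, d' ≤ d → ∃ X P Q : Set (Fin k → ℝ),
      X.Finite ∧ X.ncard ≤ (shortClasses A M sh coord).card ∧ IsGAPR k d P ∧
      IsParallelotope k Q ∧ A ⊆ X + P + Q ∧
      volume (X + P + Q) ≤ ((C * ∏ i, (2 * M i + 1) : ℕ) : ℝ≥0∞) := by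
  classical
  choose C hC using fun q => exists_gap_parallelotope k q
  refine ⟨∑ i ∈ Finset.range (q + 1), C i, ?_⟩
  intro r A b M sh coord hr h hM
  have hcard : Fintype.card {i // i ∉ sh} = shᶜ.card := by
    rw [Fintype.card_subtype]
    congr 1
    ext i; simp
  have hsplit : ∀ f : Fin r → Fin k → ℤ,
      ∑ i, f i = ∑ i ∈ sh, f i + ∑ i : {i // i ∉ sh}, f i := by
    intro f
    rw [← Finset.sum_add_sum_compl sh f]
    congr 1
    exact Finset.sum_subtype _ (by simp) f
  obtain ⟨d', hd', a, M', Q, hQ, hcov, hvol⟩ := hC _ hcard (fun i => M i) (fun i => b i)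
    (fun j i => coord (Pi.single j 1) i) (fun i => hM i)
    (fun j i => h.abs_coord_single_le j i) (fun j => by
      have h1 := hsplit fun i => coord (Pi.single j 1) i • b i
      rw [← h.single_eq_sum j, Finset.sum_eq_zero (s := sh) (fun i hi => by
        rw [h.coord_single_eq_zero j i hi, zero_smul]), zero_add] at h1
      exact h1.symm)
  refine ⟨d', hd', fun d hd => ?_⟩
  obtain ⟨P, x₀, hP, hPf, hPc, hPm⟩ := exists_isGAPR_of_le (k := k) hd a M'
  let cl := shortClasses A M sh coord
  let f : (Fin r → ℤ) → Fin k → ℝ := fun n => (fun j => ((∑ i, n i • b i) j : ℝ)) - x₀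
  let X : Set (Fin k → ℝ) := f '' (cl : Set (Fin r → ℤ))
  have hXf : X.Finite := (Finset.finite_toSet _).image _
  have hXc : X.ncard ≤ cl.card := (ncard_image_le (Finset.finite_toSet _)).trans (by simp)
  refine ⟨X, P, Q, hXf, hXc, hP, hQ, ?_, ?_⟩
  · intro x hx
    let z : Fin k → ℤ := fun j => ⌊x j⌋
    have hz : (A ∩ tile 1 z).Nonempty := ⟨x, hx, mem_tile_one.2 rfl⟩
    obtain ⟨m, hm, y, hy, e⟩ := hcov (fun i => coord z i) (fun i => h.abs_coord_le z hz i)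
      (fun j => x j - z j) ⟨fun j => sub_nonneg.2 (Int.floor_le _), fun j => by
        have := Int.lt_floor_add_one (x j)
        simp only [z, Pi.one_apply]
        linarith⟩
    have hs : ∑ i, shortPart sh (coord z) i • b i = ∑ i ∈ sh, coord z i • b i := by
      simp [shortPart, Finset.sum_ite_mem, ite_smul]
    have hz' := h.eq_sum z hz
    rw [hsplit] at hz'
    refine ⟨f (shortPart sh (coord z)) + (∑ i, (m i : ℝ) • a i + x₀),
      add_mem_add ⟨_, h.mem_shortClasses hz, rfl⟩ (hPm m hm), y, hy, ?_⟩
    ext j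
    have e' := congrFun e j
    have hz'' : (z j : ℝ) = ((∑ i ∈ sh, coord z i • b i) j : ℤ) +
        ((∑ i : {i // i ∉ sh}, coord z i • b i) j : ℤ) := by
      have := congrFun hz' j
      rw [Pi.add_apply] at this
      exact_mod_cast this
    simp only [Pi.add_apply] at e'
    simp only [f, hs, Pi.add_apply, Pi.sub_apply]
    linarith
  · have hqle : C (shᶜ.card) ≤ ∑ i ∈ Finset.range (q + 1), C i := by
      refine Finset.single_le_sum (f := C) (fun _ _ => Nat.zero_le _) ?_
      have := Finset.card_le_univ shᶜ
      simp only [Fintype.card_fin] at this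
      exact Finset.mem_range.2 (by omega)
    have hcl : cl.card ≤ ∏ i ∈ sh, (2 * M i + 1) := by
      refine (Finset.card_le_card fun x hx => (mem_shortClasses_iff.1 hx).1).trans ?_
      rw [card_intBox, ← Finset.prod_mul_prod_compl sh]
      rw [Finset.prod_congr rfl (g := fun i => 2 * M i + 1) (fun i hi => by simp [hi]),
        Finset.prod_eq_one (s := shᶜ) (fun i hi => by simp [Finset.mem_compl.1 hi]), mul_one]
    have hprod : ∏ i : {i // i ∉ sh}, (2 * M i + 1) = ∏ i ∈ shᶜ, (2 * M i + 1) :=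
      (Finset.prod_subtype _ (by simp) fun i => 2 * M i + 1).symm
    calc volume (X + P + Q) ≤ (X + P).ncard * volume Q := volume_finite_add_le (hXf.add hPf) Q
      _ ≤ ((cl.card * ∏ i, (2 * M' i + 1) : ℕ) : ℝ≥0∞) * volume Q := by
          gcongr
          refine (natCard_add_le).trans ?_
          exact Nat.mul_le_mul hXc hPc
      _ = cl.card * (((∏ i, (2 * M' i + 1) : ℕ) : ℝ≥0∞) * volume Q) := by
          push_cast; ring
      _ ≤ cl.card * ((C (shᶜ.card) * ∏ i : {i // i ∉ sh}, (2 * M i + 1) : ℕ) : ℝ≥0∞) := by gcongr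
      _ ≤ _ := by
          rw [← Nat.cast_mul, Nat.cast_le, hprod, ← Finset.prod_mul_prod_compl sh]
          calc cl.card * (C shᶜ.card * ∏ i ∈ shᶜ, (2 * M i + 1))
              ≤ (∏ i ∈ sh, (2 * M i + 1)) * ((∑ i ∈ Finset.range (q + 1), C i) *
                ∏ i ∈ shᶜ, (2 * M i + 1)) := by gcongr
            _ = _ := by ring

lemma exists_threshold_sequence (K : ℝ) (q : ℕ) :
    ∃ L : ℕ → ℕ, Monotone L ∧ (∀ s, 1 ≤ L s) ∧
      ∀ s, K * (4 * (L s : ℝ) + 1) ^ q ≤ L (s + 1) := by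
  obtain ⟨L, hL0, hL⟩ : ∃ L : ℕ → ℕ, L 0 = 1 ∧
      ∀ s, L (s + 1) = L s + ⌈K * (4 * (L s : ℝ) + 1) ^ q⌉₊ :=
    ⟨fun s => Nat.rec 1 (fun _ x => x + ⌈K * (4 * (x : ℝ) + 1) ^ q⌉₊) s, rfl, fun _ => rfl⟩
  have hmono : Monotone L := monotone_nat_of_le_succ fun s => by rw [hL]; exact Nat.le_add_right _ _
  refine ⟨L, hmono, fun s => hL0 ▸ hmono (Nat.zero_le s), fun s => ?_⟩
  rw [hL]
  push_cast
  have := Nat.le_ceil (K * (4 * (L s : ℝ) + 1) ^ q)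
  have : (0 : ℝ) ≤ L s := by positivity
  linarith

lemma two_pow_mul_sum_le {D n : ℕ} {a b : ℕ → ℝ} (ha : ∀ i, 0 ≤ a i) (hb : ∀ i, 0 ≤ b i)
    (hab : ∀ i j, i ≤ n → j ≤ n → a i + a j ≤ b (i + j)) :
    2 ^ D * ∑ i ∈ Finset.range (n + 1), a i ^ D ≤ ∑ l ∈ Finset.range (2 * n + 1), b l ^ D := by
  calc 2 ^ D * ∑ i ∈ Finset.range (n + 1), a i ^ D
      ≤ ∑ i ∈ Finset.range (n + 1), b (2 * i) ^ D := by
        rw [Finset.mul_sum]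
        refine Finset.sum_le_sum fun i hi => ?_
        have hi' := Nat.lt_succ_iff.1 (Finset.mem_range.1 hi)
        rw [← mul_pow]
        have := hab i i hi' hi'
        rw [← two_mul, ← two_mul] at this
        exact pow_le_pow_left₀ (by have := ha i; positivity) this D
    _ = ∑ l ∈ (Finset.range (n + 1)).image (2 * ·), b l ^ D := by
        rw [Finset.sum_image fun _ _ _ _ h => by simpa using h]
    _ ≤ _ := Finset.sum_le_sum_of_subset_of_nonneg (fun l hl => by
        obtain ⟨i, hi, rfl⟩ := Finset.mem_image.1 hl
        have := Finset.mem_range.1 hi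
        exact Finset.mem_range.2 (by omega)) fun l _ _ => by
          have := hb l; positivity

set_option maxHeartbeats 1000000 in
/-- Structure of a discretized set with small sumset: it either has an efficient cover of lower
rank, or an efficient cover of rank `d` by few translates whose number is controlled by the
length of a sequence. -/
lemma exists_cover_dichotomy (k d : ℕ) (hk : 1 ≤ k) (hd : 1 ≤ d) : ∃ C : ℕ, ∀ ε : ℝ, 0 < ε →
    ε < 1 → ∃ (T m : ℕ) (η : ℝ), 1 ≤ m ∧ 0 < η ∧ η < 1 ∧
      ∀ (A : Set (Fin k → ℝ)) (S : Finset (Fin k → ℤ)), MeasurableSet A → volume A ≠ ⊤ →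
      volume (A + A) ≠ ⊤ →
      volume.real (A + A) ≤ 2 ^ (k + d) * (2 - ε) * volume.real A → S.Nonempty →
      (∀ z ∈ S, volume.real (tile 1 z \ A) ≤ η) → (1 - η) * volume.real A ≤ S.card →
      (∀ j : Fin k, ∃ z : Fin k → ℤ, ∀ t : ℕ, t < m → z + (Pi.single j (t : ℤ) : Fin k → ℤ) ∈ S) →
      (∃ X P Q : Set (Fin k → ℝ), X.Finite ∧ X.ncard ≤ T ∧ IsGAPR k (d - 1) P ∧
        IsParallelotope k Q ∧ A ⊆ X + P + Q ∧ volume (X + P + Q) ≤ C * volume A) ∨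
      ∃ (n : ℕ) (a b : ℕ → ℝ), Antitone a ∧ (∀ i, 0 ≤ a i) ∧ 0 < a 0 ∧
        (∀ i j, i ≤ n → j ≤ n → a i + a j ≤ b (i + j)) ∧
        ∑ l ∈ Finset.range (2 * n + 1), b l ^ (k + d) ≤
          2 ^ (k + d) * (2 - (ε - ε ^ 2)) * ∑ i ∈ Finset.range (n + 1), a i ^ (k + d) ∧
        ∃ X P Q : Set (Fin k → ℝ), X.Finite ∧ X.ncard ≤ n + 1 ∧ IsGAPR k d P ∧
          IsParallelotope k Q ∧ A ⊆ X + P + Q ∧ volume (X + P + Q) ≤ C * volume A := by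
  obtain ⟨q, C₁, hprog⟩ := exists_proper_cell_cover k (k + d + 1) (2 * k + 4)
  obtain ⟨C₂, hcover⟩ := CellCoordinates.exists_cover k q
  choose c hc0 hc using discrete_brunn_minkowski
  refine ⟨2 * (C₂ * C₁), fun ε hε hε1 => ?_⟩
  obtain ⟨K, hK⟩ : ∃ K, K = 4 / ε ^ 2 * ((∑ i ∈ Finset.range (q + 1), c i) * C₁) := ⟨_, rfl⟩
  obtain ⟨L, hLmono, hL1, hL⟩ := exists_threshold_sequence K q
  obtain ⟨B, hB⟩ : ∃ B : ℝ, B = (4 * (L q : ℝ) + 1) ^ q := ⟨_, rfl⟩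
  have hB1 : 1 ≤ B := by rw [hB]; exact one_le_pow₀ (by have : (0 : ℝ) ≤ L q := by positivity
                                                        linarith)
  have hB0 : 0 < B := by linarith
  obtain ⟨η, hη⟩ : ∃ η : ℝ, η = ε ^ 2 / 5 * ((1 / 2) ^ k / 3) / B := ⟨_, rfl⟩
  have hη0 : 0 < η := by rw [hη]; positivity
  have hpk : ((1 : ℝ) / 2) ^ k ≤ 1 := pow_le_one₀ (by norm_num) (by norm_num)
  have hpk0 : (0 : ℝ) < (1 / 2) ^ k := by positivity
  have hηB : η * B = ε ^ 2 / 5 * ((1 / 2) ^ k / 3) := by rw [hη]; field_simp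
  have hε2 : ε ^ 2 ≤ 1 := pow_le_one₀ hε.le hε1.le
  have hε20 : 0 < ε ^ 2 := by positivity
  have hηB1 : η * B ≤ ε ^ 2 / 15 := by rw [hηB]; nlinarith
  have hηle : η ≤ η * B := le_mul_of_one_le_right hη0.le hB1
  have hη2 : 2 * η < (1 / 2) ^ k := by nlinarith
  have hη4 : η ≤ 1 / 4 := by linarith
  refine ⟨(2 * L q + 1) ^ q, 2 * L q + 2, η, by omega, hη0, by linarith, ?_⟩
  intro A S hA hAf hAAf hAA hSne hS hSc hrun
  have hσ : (0 : ℝ) < S.card := by exact_mod_cast hSne.card_pos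
  have hSA : (S.card : ℝ) ≤ 2 * volume.real A := by
    have h1 := volume_real_inter_cells_ge hA S hS inter_subset_left hAf
    nlinarith
  have hA0 : 0 ≤ volume.real A := measureReal_nonneg
  obtain ⟨r, hr, b, M, hM, hcov, hsingle, hprop, hprod⟩ := hprog A η S hA hη2 hη4 hSne hS hSc hAAf
    (hAA.trans (by
      rw [pow_succ (2 : ℝ) (k + d)]
      gcongr
      linarith))
  obtain ⟨s, hs, sh, coord, h, hlong, hshort⟩ := exists_cellCoordinates (A := A) hr hLmono
    (m := 2 * L q + 2) (fun s hs => by have := hLmono hs; omega) hcov hsingle hprop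
    (fun j => by
      obtain ⟨z, hz⟩ := hrun j
      exact ⟨z, fun t ht => inter_tile_nonempty_of_full (by linarith) (hS _ (hz t ht))⟩)
  obtain ⟨d', hd', hcover'⟩ := hcover hr h hM
  have hvol : ((C₂ * ∏ i, (2 * M i + 1) : ℕ) : ℝ≥0∞) ≤ (2 * (C₂ * C₁) : ℕ) * volume A := by
    calc ((C₂ * ∏ i, (2 * M i + 1) : ℕ) : ℝ≥0∞) ≤ ((C₂ * (C₁ * S.card) : ℕ) : ℝ≥0∞) := by
          exact_mod_cast Nat.mul_le_mul_left _ hprod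
      _ = (C₂ * C₁ : ℕ) * ENNReal.ofReal S.card := by
          rw [ENNReal.ofReal_natCast]; push_cast; ring
      _ ≤ (C₂ * C₁ : ℕ) * ENNReal.ofReal (2 * volume.real A) := by gcongr
      _ = _ := by
          rw [ENNReal.ofReal_mul (by norm_num), ofReal_measureReal hAf]
          push_cast
          rw [ENNReal.ofReal_ofNat]
          ring
  have hD'q : shᶜ.card ≤ q := by
    have := Finset.card_le_univ shᶜ
    simp only [Fintype.card_fin] at this
    omega
  rcases lt_or_ge shᶜ.card (k + d) with hlt | hge
  · obtain ⟨X, P, Q, hXf, hXc, hP, hQ, hAX, hXv⟩ := hcover' (d - 1) (by omega)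
    refine Or.inl ⟨X, P, Q, hXf, hXc.trans ?_, hP, hQ, hAX, hXv.trans hvol⟩
    refine (CellCoordinates.card_shortClasses_le hshort).trans ?_
    calc (2 * L s + 1) ^ r ≤ (2 * L s + 1) ^ q := Nat.pow_le_pow_right (by omega) hr
      _ ≤ _ := Nat.pow_le_pow_left (by have := hLmono hs; omega) q
  · obtain ⟨m, hm⟩ : ∃ m, shᶜ.card = m + 1 := ⟨shᶜ.card - 1, by omega⟩
    obtain ⟨n, a, b', hn, ha, ha0, hab, hb0, hsa, hsb⟩ := h.exists_class_sums hm (hc0 m) (hc m)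
      (hL1 (s + 1)) hlong hshort hA hη0.le (by linarith) hη2 hSne hS hAAf
    have hcm : c m ≤ ∑ i ∈ Finset.range (q + 1), c i :=
      Finset.single_le_sum (f := c) (fun i _ => hc0 i) (Finset.mem_range.2 (by omega))
    have hprod' : ∏ i, (2 * (M i : ℝ) + 1) ≤ C₁ * S.card := by exact_mod_cast hprod
    have hL0 : (0 : ℝ) ≤ L s := by positivity
    have hLpos : (0 : ℝ) < L (s + 1) := by exact_mod_cast hL1 (s + 1)
    have hpow : (4 * (L s : ℝ) + 1) ^ r ≤ (4 * (L s : ℝ) + 1) ^ q :=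
      pow_le_pow_right₀ (by linarith) hr
    have hpowB : (4 * (L s : ℝ) + 1) ^ q ≤ B := by
      rw [hB]
      have : (L s : ℝ) ≤ L q := by exact_mod_cast hLmono hs
      gcongr
    have herr1 : c m * (∏ i, (2 * (M i : ℝ) + 1)) / L (s + 1) * (4 * (L s : ℝ) + 1) ^ r ≤
        ε ^ 2 / 4 * S.card := by
      have h1 : c m * (∏ i, (2 * (M i : ℝ) + 1)) ≤
          (∑ i ∈ Finset.range (q + 1), c i) * (C₁ * S.card) := by
        have := hc0 m
        gcongr
        exact Finset.sum_nonneg fun i _ => hc0 i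
      have h2 : (∑ i ∈ Finset.range (q + 1), c i) * (C₁ * S.card) = ε ^ 2 / 4 * (K * S.card) := by
        rw [hK]; field_simp
      rw [div_mul_eq_mul_div, div_le_iff₀ hLpos]
      calc c m * (∏ i, (2 * (M i : ℝ) + 1)) * (4 * (L s : ℝ) + 1) ^ r
          ≤ (ε ^ 2 / 4 * (K * S.card)) * (4 * (L s : ℝ) + 1) ^ q := by
            rw [← h2]
            exact mul_le_mul h1 hpow (by positivity) ((mul_nonneg (hc0 m) (by positivity)).trans h1)
        _ = ε ^ 2 / 4 * S.card * (K * (4 * (L s : ℝ) + 1) ^ q) := by ring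
        _ ≤ _ := by gcongr; exact hL s
    have herr2 : η * S.card * (4 * (L s : ℝ) + 1) ^ r ≤ ε ^ 2 / 15 * S.card := by
      calc η * S.card * (4 * (L s : ℝ) + 1) ^ r ≤ η * S.card * B := by
            gcongr; exact hpow.trans hpowB
        _ = η * B * S.card := by ring
        _ ≤ _ := by gcongr
    have hp1 : (1 : ℝ) ≤ 2 ^ (k + d) := one_le_pow₀ (by norm_num)
    have hAσ : (2 - ε) * volume.real A ≤ (2 - ε + ε ^ 2 / 2) * S.card := by
      have h1 : (2 - ε) ≤ (2 - ε + ε ^ 2 / 2) * (1 - η) := by nlinarith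
      calc (2 - ε) * volume.real A ≤ (2 - ε + ε ^ 2 / 2) * (1 - η) * volume.real A := by gcongr
        _ = (2 - ε + ε ^ 2 / 2) * ((1 - η) * volume.real A) := by ring
        _ ≤ _ := by
          have : 0 ≤ 2 - ε + ε ^ 2 / 2 := by nlinarith
          gcongr
    have hsum : ∑ l ∈ Finset.range (2 * n + 1), b' l ^ (m + 1) ≤
        2 ^ (k + d) * (2 - (ε - ε ^ 2)) * S.card := by
      have h1 : volume.real (A + A) ≤ 2 ^ (k + d) * ((2 - ε + ε ^ 2 / 2) * S.card) :=
        hAA.trans (by rw [mul_assoc]; gcongr)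
      have h2 : ε ^ 2 / 2 * S.card ≤ 2 ^ (k + d) * (ε ^ 2 / 2 * S.card) :=
        le_mul_of_one_le_left (by positivity) hp1
      have h3 : 0 ≤ ε ^ 2 * (S.card : ℝ) := by positivity
      have h4 : 2 ^ (k + d) * (2 - (ε - ε ^ 2)) * (S.card : ℝ) =
          2 ^ (k + d) * ((2 - ε + ε ^ 2 / 2) * S.card) + 2 ^ (k + d) * (ε ^ 2 / 2 * S.card) := by
        ring
      rw [add_mul] at hsb
      linarith
    have hDm : k + d = m + 1 := by
      by_contra hne
      have h1 := two_pow_mul_sum_le (D := m + 1) ha0 hb0 hab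
      rw [hsa] at h1
      have h2 : (2 : ℝ) ^ (k + d) * 2 ≤ 2 ^ (m + 1) := by
        rw [← pow_succ]
        exact pow_le_pow_right₀ (by norm_num) (by omega)
      have h3 : (2 : ℝ) ^ (k + d) * 2 * S.card ≤ 2 ^ (m + 1) * S.card := by gcongr
      have h4 : 0 < 2 ^ (k + d) * ((ε - ε ^ 2) * S.card) := by
        have : 0 < ε - ε ^ 2 := by nlinarith
        positivity
      nlinarith
    obtain ⟨X, P, Q, hXf, hXc, hP, hQ, hAX, hXv⟩ := hcover' d (by omega)
    refine Or.inr ⟨n, a, b', ha, ha0, ?_, hab, ?_, X, P, Q, hXf, hn ▸ hXc, hP, hQ, hAX,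
      hXv.trans hvol⟩
    · refine (ha0 0).lt_of_ne fun h0 => ?_
      have : ∑ i ∈ Finset.range (n + 1), a i ^ (m + 1) = 0 := Finset.sum_eq_zero fun i _ => by
        have : a i = 0 := le_antisymm (h0 ▸ ha (Nat.zero_le i)) (ha0 i)
        rw [this, zero_pow (Nat.succ_ne_zero m)]
      linarith
    · rw [hDm, hsa, ← hDm]
      rw [← hDm] at hsum
      exact hsum

lemma IsGAPR.smul {k d : ℕ} {P : Set (Fin k → ℝ)} (hP : IsGAPR k d P) (δ : ℝ) :
    IsGAPR k d (δ • P) := by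
  obtain ⟨a, l, hl, rfl⟩ := hP
  refine ⟨fun i => δ • a i, l, hl, ?_⟩
  rw [← image_smul, image_image]
  refine image_congr fun lam _ => ?_
  rw [Finset.smul_sum]
  exact Finset.sum_congr rfl fun i _ => smul_comm _ _ _

lemma IsParallelotope.smul {k : ℕ} {Q : Set (Fin k → ℝ)} (hQ : IsParallelotope k Q) (δ : ℝ) :
    IsParallelotope k (δ • Q) := by
  obtain ⟨x₀, v, rfl⟩ := hQ
  refine ⟨δ • x₀, fun i => δ • v i, ?_⟩
  rw [← image_smul, image_image]
  refine image_congr fun lam _ => ?_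
  rw [smul_add, Finset.smul_sum]
  exact congrArg _ (Finset.sum_congr rfl fun i _ => smul_comm _ _ _)

lemma subset_smul_and_volume_smul_le {k : ℕ} {δ : ℝ} (hδ : 0 < δ) {A X P Q : Set (Fin k → ℝ)}
    {c : ℝ≥0∞} (hA : δ⁻¹ • A ⊆ X + P + Q)
    (hv : volume (X + P + Q) ≤ c * volume (δ⁻¹ • A)) :
    A ⊆ δ • X + δ • P + δ • Q ∧ volume (δ • X + δ • P + δ • Q) ≤ c * volume A := by
  have hA' : δ • (δ⁻¹ • A) = A := by rw [smul_smul, mul_inv_cancel₀ hδ.ne', one_smul]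
  have hs : δ • X + δ • P + δ • Q = δ • (X + P + Q) := by rw [smul_add, smul_add]
  rw [hs]
  refine ⟨?_, ?_⟩
  · rw [← hA']
    exact smul_set_mono hA
  · have hsm : ∀ E : Set (Fin k → ℝ), volume (δ • E) = ENNReal.ofReal |δ ^ k| * volume E := by
      intro E
      rw [Measure.addHaar_smul, Module.finrank_fin_fun]
    calc volume (δ • (X + P + Q)) = ENNReal.ofReal |δ ^ k| * volume (X + P + Q) := hsm _
      _ ≤ ENNReal.ofReal |δ ^ k| * (c * volume (δ⁻¹ • A)) := by gcongr
      _ = c * (ENNReal.ofReal |δ ^ k| * volume (δ⁻¹ • A)) := by ring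
      _ = c * volume A := by rw [← hsm, hA']

/-- Structure of a set with small sumset: it either has an efficient cover of lower rank, or an
efficient cover of rank `d` by few translates whose number is controlled by the length of a
sequence. -/
lemma exists_cover_dichotomy_of_measurable (k d : ℕ) (hk : 1 ≤ k) (hd : 1 ≤ d) : ∃ C : ℕ,
    ∀ ε : ℝ, 0 < ε → ε < 1 → ∃ T : ℕ, ∀ A : Set (Fin k → ℝ), MeasurableSet A → 0 < volume A →
      volume A < ⊤ →
      volume (A + A) ≤ ENNReal.ofReal (2 ^ (k + d) * (2 - ε)) * volume A →
      (∃ X P Q : Set (Fin k → ℝ), X.Finite ∧ X.ncard ≤ T ∧ IsGAPR k (d - 1) P ∧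
        IsParallelotope k Q ∧ A ⊆ X + P + Q ∧ volume (X + P + Q) ≤ C * volume A) ∨
      ∃ (n : ℕ) (a b : ℕ → ℝ), Antitone a ∧ (∀ i, 0 ≤ a i) ∧ 0 < a 0 ∧
        (∀ i j, i ≤ n → j ≤ n → a i + a j ≤ b (i + j)) ∧
        ∑ l ∈ Finset.range (2 * n + 1), b l ^ (k + d) ≤
          2 ^ (k + d) * (2 - (ε - ε ^ 2)) * ∑ i ∈ Finset.range (n + 1), a i ^ (k + d) ∧
        ∃ X P Q : Set (Fin k → ℝ), X.Finite ∧ X.ncard ≤ n + 1 ∧ IsGAPR k d P ∧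
          IsParallelotope k Q ∧ A ⊆ X + P + Q ∧ volume (X + P + Q) ≤ C * volume A := by
  obtain ⟨C, hC⟩ := exists_cover_dichotomy k d hk hd
  refine ⟨C, fun ε hε hε1 => ?_⟩
  obtain ⟨T, m, η, hm, hη, hη1, h⟩ := hC ε hε hε1
  refine ⟨T, fun A hA hA0 hAf hAA => ?_⟩
  obtain ⟨δ, hδ, S, hSne, hS, hSc, hrun⟩ := exists_discretization hm hη hη1 hA hA0 hAf
  have hδ' : δ⁻¹ ≠ 0 := inv_ne_zero hδ.ne'
  have hsm : ∀ E : Set (Fin k → ℝ),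
      volume (δ⁻¹ • E) = ENNReal.ofReal |δ⁻¹ ^ k| * volume E := by
    intro E
    rw [Measure.addHaar_smul, Module.finrank_fin_fun]
  have hAAf : volume (A + A) ≠ ⊤ :=
    (hAA.trans_lt (ENNReal.mul_lt_top ENNReal.ofReal_lt_top hAf)).ne
  have hsum : δ⁻¹ • A + δ⁻¹ • A = δ⁻¹ • (A + A) := (smul_add _ _ _).symm
  have hfin : ∀ E : Set (Fin k → ℝ), volume E ≠ ⊤ → volume (δ⁻¹ • E) ≠ ⊤ := fun E hE => by
    rw [hsm]
    exact ENNReal.mul_ne_top ENNReal.ofReal_ne_top hE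
  have hK0 : 0 ≤ 2 ^ (k + d) * (2 - ε) := mul_nonneg (by positivity) (by linarith)
  have hAA' : volume.real (δ⁻¹ • A + δ⁻¹ • A) ≤
      2 ^ (k + d) * (2 - ε) * volume.real (δ⁻¹ • A) := by
    have h1 : volume (δ⁻¹ • A + δ⁻¹ • A) ≤
        ENNReal.ofReal (2 ^ (k + d) * (2 - ε)) * volume (δ⁻¹ • A) := by
      rw [hsum, hsm, hsm, mul_left_comm]
      gcongr
    have h2 := ENNReal.toReal_mono (ENNReal.mul_ne_top ENNReal.ofReal_ne_top (hfin A hAf.ne)) h1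
    rwa [ENNReal.toReal_mul, ENNReal.toReal_ofReal hK0] at h2
  rcases h (δ⁻¹ • A) S (hA.const_smul₀ _) (hfin A hAf.ne) (hsum ▸ hfin _ hAAf) hAA' hSne hS hSc
    hrun with ⟨X, P, Q, hXf, hXc, hP, hQ, hAX, hv⟩ |
      ⟨n, a, b, ha, ha0, ha1, hab, hs, X, P, Q, hXf, hXc, hP, hQ, hAX, hv⟩
  · obtain ⟨h1, h2⟩ := subset_smul_and_volume_smul_le hδ hAX hv
    exact Or.inl ⟨δ • X, δ • P, δ • Q, hXf.smul_set, (ncard_image_le hXf).trans hXc, hP.smul δ,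
      hQ.smul δ, h1, h2⟩
  · obtain ⟨h1, h2⟩ := subset_smul_and_volume_smul_le hδ hAX hv
    exact Or.inr ⟨n, a, b, ha, ha0, ha1, hab, hs, δ • X, δ • P, δ • Q, hXf.smul_set,
      (ncard_image_le hXf).trans hXc, hP.smul δ, hQ.smul δ, h1, h2⟩

theorem stmt_15 (k d : ℕ) (hk : 1 ≤ k) (hd : 1 ≤ d) :
    ∃ (T : ℝ → ℕ) (c C : ℝ → ℝ),
      ∀ β : ℝ, 0 < β → ∃ ε₀ : ℝ, 0 < ε₀ ∧
        ∀ ε : ℝ, ε ∈ Set.Ioo 0 ε₀ →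
          0 < c ε ∧ 0 < C ε ∧
          ∀ A : Set (Fin k → ℝ), MeasurableSet A → 0 < volume A → volume A < ⊤ →
            volume (A + A) ≤ ENNReal.ofReal (2 ^ (k + d) * (2 - ε)) * volume A →
            (∀ X P Q : Set (Fin k → ℝ), X.Finite → X.ncard ≤ T ε →
              IsGAPR k (d - 1) P → IsParallelotope k Q → A ⊆ X + P + Q →
              ENNReal.ofReal (c ε) * volume A ≤ volume (X + P + Q)) →
            ∃ X' P' Q' : Set (Fin k → ℝ), X'.Finite ∧
              (X'.ncard : ℝ) ≤ (1 + β) * (k + d + 1) / (2 * ε) ∧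
              IsGAPR k d P' ∧ IsParallelotope k Q' ∧ A ⊆ X' + P' + Q' ∧
              volume (X' + P' + Q') ≤ ENNReal.ofReal (C ε) * volume A := by
  obtain ⟨C, hC⟩ := exists_cover_dichotomy_of_measurable k d hk hd
  choose! T hT using hC
  refine ⟨T, fun _ => C + 1, fun _ => C + 1, fun β hβ => ?_⟩
  obtain ⟨ε₁, hε₁, hseq⟩ := seq_length_le (D := k + d) (by omega) (half_pos hβ)
  have hβ' : 0 < β / (2 * (1 + β)) := by positivity
  refine ⟨min (min 1 ε₁) (β / (2 * (1 + β))), lt_min (lt_min one_pos hε₁) hβ', fun ε hε => ?_⟩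
  obtain ⟨hε0, hε⟩ := hε
  rw [lt_min_iff, lt_min_iff] at hε
  obtain ⟨⟨hε1, hεε₁⟩, hεβ⟩ := hε
  have hC0 : (0 : ℝ) < C + 1 := by positivity
  refine ⟨hC0, hC0, fun A hA hA0 hAf hAA hlow => ?_⟩
  have hCe : ENNReal.ofReal (C + 1) = C + 1 := by
    rw [← Nat.cast_add_one, ENNReal.ofReal_natCast, Nat.cast_add_one]
  rcases hT ε hε0 hε1 A hA hA0 hAf hAA with ⟨X, P, Q, hXf, hXc, hP, hQ, hAX, hv⟩ |
    ⟨n, a, b, ha, ha0, ha1, hab, hs, X, P, Q, hXf, hXc, hP, hQ, hAX, hv⟩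
  · exfalso
    have h1 := (hlow X P Q hXf hXc hP hQ hAX).trans hv
    rw [hCe, ENNReal.mul_le_mul_iff_left hA0.ne' hAf.ne] at h1
    exact absurd h1 (by exact_mod_cast Nat.not_succ_le_self C)
  · refine ⟨X, P, Q, hXf, ?_, hP, hQ, hAX, hv.trans ?_⟩
    · have hε2 : 0 < ε - ε ^ 2 := by nlinarith
      have h1 := hseq (ε - ε ^ 2) hε2 (by nlinarith) n a b ha ha0 ha1 hab hs
      rw [lt_div_iff₀ (by positivity)] at hεβ
      calc (X.ncard : ℝ) ≤ n + 1 := by exact_mod_cast hXc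
        _ ≤ _ := h1
        _ ≤ _ := by
          rw [div_le_div_iff₀ (by linarith) (by linarith)]
          push_cast
          have h2 : 1 + β / 2 ≤ (1 + β) * (1 - ε) := by linarith
          have h3 : 0 ≤ ((k : ℝ) + d + 1) * (2 * ε) := by positivity
          calc (1 + β / 2) * ((k : ℝ) + d + 1) * (2 * ε)
              = (1 + β / 2) * (((k : ℝ) + d + 1) * (2 * ε)) := by ring
            _ ≤ (1 + β) * (1 - ε) * (((k : ℝ) + d + 1) * (2 * ε)) := by gcongr
            _ = _ := by ring
    · rw [hCe]
      gcongr
      exact le_self_add
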